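/- arXiv:2501.10090 — 5 statements merged into one kernel-verified Lean document; each statement's English description precedes it below -/
import Mathlib

section
/- Let K₀(t) = ∫₀^∞ e^{-t·cosh u} du for t > 0. Then the integral ∫₀^∞ K₀(t)³ dt converges and equals 3·Γ(1/3)⁶/(32·2^{2/3}·π). -/
open MeasureTheory Real

open Set Filter Topology

/-- Change of variables in one dimension for the lower integral of a real function. -/
lemma lintegral_ofReal_subst {f f' g h : ℝ → ℝ} {s t : Set ℝ} (hs : MeasurableSet s)
    (hf : ∀ x ∈ s, HasDerivAt f (f' x) x) (hinj : InjOn f s) (himg : f '' s = t)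
    (hgh : ∀ x ∈ s, |f' x| * g (f x) = h x) :
    ∫⁻ x in t, ENNReal.ofReal (g x) = ∫⁻ x in s, ENNReal.ofReal (h x) := by
  rw [← himg, lintegral_image_eq_lintegral_abs_deriv_mul hs
    (fun x hx => (hf x hx).hasDerivWithinAt) hinj]
  refine setLIntegral_congr_fun hs fun x hx => ?_
  rw [← hgh x hx, ENNReal.ofReal_mul (abs_nonneg _)]

lemma lintegral_ofReal_const_mul {α : Type*} [MeasurableSpace α] {μ : Measure α} {c : ℝ}
    (hc : 0 ≤ c) (f : α → ℝ) :
    ∫⁻ x, ENNReal.ofReal (c * f x) ∂μ = ENNReal.ofReal c * ∫⁻ x, ENNReal.ofReal (f x) ∂μ := by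
  simp_rw [ENNReal.ofReal_mul hc]
  exact lintegral_const_mul' _ _ ENNReal.ofReal_ne_top

lemma lintegral_beta {a b : ℝ} (ha : 0 < a) (hb : 0 < b) :
    ∫⁻ x in Ioo (0 : ℝ) 1, ENNReal.ofReal (x ^ (a - 1) * (1 - x) ^ (b - 1)) =
      ENNReal.ofReal (ProbabilityTheory.beta a b) := by
  have hβ := ProbabilityTheory.beta_pos ha hb
  have h := ProbabilityTheory.lintegral_betaPDF_eq_one ha hb
  rw [ProbabilityTheory.lintegral_betaPDF] at h
  simp_rw [mul_assoc] at h
  rw [lintegral_ofReal_const_mul (by positivity)] at h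
  set I := ∫⁻ x in Ioo (0 : ℝ) 1, ENNReal.ofReal (x ^ (a - 1) * (1 - x) ^ (b - 1))
  rw [← one_mul I, ← ENNReal.ofReal_one, ← mul_one_div_cancel hβ.ne',
    ENNReal.ofReal_mul hβ.le, mul_assoc, h, mul_one]

lemma lintegral_inv_sqrt_cube_sub_one :
    ∫⁻ s in Ioi (1 : ℝ), ENNReal.ofReal (1 / √(s ^ 3 - 1)) =
      ENNReal.ofReal (1 / 3 * ProbabilityTheory.beta (1 / 6) (1 / 2)) := by
  rw [ENNReal.ofReal_mul (by norm_num), ← lintegral_beta (by norm_num) (by norm_num),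
    ← lintegral_ofReal_const_mul (by norm_num)]
  refine lintegral_ofReal_subst (f := fun x => x ^ (-(1 / 3) : ℝ))
    (f' := fun x => (-(1 / 3) : ℝ) * x ^ (-(1 / 3) - 1 : ℝ)) measurableSet_Ioo
    (fun x hx => hasDerivAt_rpow_const (Or.inl hx.1.ne')) ?_ ?_ ?_
  · intro x hx y hy h
    exact (rpow_left_inj hx.1.le hy.1.le (by norm_num)).1 h
  · ext s
    constructor
    · rintro ⟨x, hx, rfl⟩
      exact one_lt_rpow_of_pos_of_lt_one_of_neg hx.1 hx.2 (by norm_num)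
    · intro hs
      have hs : 1 < s := hs
      have h0 : 0 < s := by linarith
      refine ⟨s ^ (-3 : ℝ), ⟨by positivity, rpow_lt_one_of_one_lt_of_neg hs (by norm_num)⟩, ?_⟩
      simp only
      rw [← rpow_mul h0.le]
      norm_num
  · intro x hx
    have h0 := hx.1
    have h1 : 0 < 1 - x := by linarith [hx.2]
    have e1 : (x ^ (-(1 / 3) : ℝ)) ^ 3 - 1 = x⁻¹ * (1 - x) := by
      rw [← rpow_natCast, ← rpow_mul h0.le]
      norm_num [rpow_neg_one]
      field_simp
    rw [e1, sqrt_mul (by positivity), sqrt_eq_rpow, sqrt_eq_rpow, ← rpow_neg_one,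
      ← rpow_mul h0.le, abs_mul, abs_of_pos (rpow_pos_of_pos h0 _), one_div (_ * _), mul_inv,
      ← rpow_neg h0.le, ← rpow_neg h1.le, mul_assoc, ← mul_assoc (x ^ _) (x ^ _), ← rpow_add h0]
    norm_num

lemma lintegral_inv_sqrt_one_sub_cube :
    ∫⁻ s in Ioo (0 : ℝ) 1, ENNReal.ofReal (1 / √(1 - s ^ 3)) =
      ENNReal.ofReal (1 / 3 * ProbabilityTheory.beta (1 / 3) (1 / 2)) := by
  rw [ENNReal.ofReal_mul (by norm_num), ← lintegral_beta (by norm_num) (by norm_num),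
    ← lintegral_ofReal_const_mul (by norm_num)]
  refine lintegral_ofReal_subst (f := fun x => x ^ (1 / 3 : ℝ))
    (f' := fun x => (1 / 3 : ℝ) * x ^ (1 / 3 - 1 : ℝ)) measurableSet_Ioo
    (fun x hx => hasDerivAt_rpow_const (Or.inl hx.1.ne')) ?_ ?_ ?_
  · intro x hx y hy h
    exact (rpow_left_inj hx.1.le hy.1.le (by norm_num)).1 h
  · ext s
    constructor
    · rintro ⟨x, hx, rfl⟩
      exact ⟨rpow_pos_of_pos hx.1 _, rpow_lt_one hx.1.le hx.2 (by norm_num)⟩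
    · intro hs
      have h0 : 0 < s := hs.1
      refine ⟨s ^ (3 : ℝ), ⟨by positivity, rpow_lt_one h0.le hs.2 (by norm_num)⟩, ?_⟩
      simp only
      rw [← rpow_mul h0.le]
      norm_num
  · intro x hx
    have h0 := hx.1
    have h1 : 0 < 1 - x := by linarith [hx.2]
    have e1 : (x ^ (1 / 3 : ℝ)) ^ 3 = x := by
      rw [← rpow_natCast, ← rpow_mul h0.le]
      norm_num
    rw [e1, sqrt_eq_rpow, abs_mul, abs_of_pos (rpow_pos_of_pos h0 _), one_div (_ ^ _),
      ← rpow_neg h1.le]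
    norm_num [mul_assoc]

lemma lintegral_inv_sqrt_one_add_cube :
    ∫⁻ s in Ioi (0 : ℝ), ENNReal.ofReal (1 / √(1 + s ^ 3)) =
      ENNReal.ofReal (1 / 3 * ProbabilityTheory.beta (1 / 6) (1 / 3)) := by
  rw [ENNReal.ofReal_mul (by norm_num), ← lintegral_beta (by norm_num) (by norm_num),
    ← lintegral_ofReal_const_mul (by norm_num)]
  have key : ∀ x ∈ Ioo (0 : ℝ) 1, 0 < x⁻¹ - 1 := fun x hx => by
    linarith [(one_lt_inv₀ hx.1).2 hx.2]
  refine lintegral_ofReal_subst (f := fun x => (x⁻¹ - 1) ^ (1 / 3 : ℝ))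
    (f' := fun x => (-(x ^ 2)⁻¹) * (1 / 3 : ℝ) * (x⁻¹ - 1) ^ (1 / 3 - 1 : ℝ)) measurableSet_Ioo
    (fun x hx => ((hasDerivAt_inv hx.1.ne').sub_const 1).rpow_const (Or.inl (key x hx).ne'))
    ?_ ?_ ?_
  · intro x hx y hy h
    have := (rpow_left_inj (key x hx).le (key y hy).le (by norm_num)).1 h
    simpa using this
  · ext s
    constructor
    · rintro ⟨x, hx, rfl⟩
      exact rpow_pos_of_pos (key x hx) _
    · intro hs
      have h0 : 0 < s := hs
      refine ⟨(s ^ (3 : ℝ) + 1)⁻¹, ⟨by positivity, inv_lt_one_of_one_lt₀ ?_⟩, ?_⟩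
      · linarith [rpow_pos_of_pos h0 3]
      · simp only [inv_inv, add_sub_cancel_right]
        rw [← rpow_mul h0.le]
        norm_num
  · intro x hx
    have h0 := hx.1
    have h1 : 0 < 1 - x := by linarith [hx.2]
    have hk := key x hx
    have e1 : 1 + ((x⁻¹ - 1) ^ (1 / 3 : ℝ)) ^ 3 = x⁻¹ := by
      rw [← rpow_natCast, ← rpow_mul hk.le]
      norm_num
    have e2 : x⁻¹ - 1 = x ^ (-1 : ℝ) * (1 - x) := by
      rw [rpow_neg_one]; field_simp
    have e3 : (x ^ 2)⁻¹ = x ^ (-2 : ℝ) := by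
      rw [rpow_neg h0.le]; norm_num
    rw [e1, e2, mul_rpow (by positivity) h1.le, ← rpow_mul h0.le, sqrt_eq_rpow, e3, abs_mul,
      abs_of_pos (mul_pos (rpow_pos_of_pos h0 _) (rpow_pos_of_pos h1 _)), abs_mul, abs_neg,
      abs_of_pos (rpow_pos_of_pos h0 _), one_div (_ ^ _), ← rpow_neg_one x,
      ← rpow_mul h0.le, ← rpow_neg h0.le]
    have e4 : x ^ (1 / 6 - 1 : ℝ) = x ^ (-2 : ℝ) * x ^ (-1 * (1 / 3 - 1) : ℝ) *
        x ^ (-(-1 * (1 / 2)) : ℝ) := by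
      rw [← rpow_add h0, ← rpow_add h0]; norm_num
    rw [e4, abs_of_pos (by norm_num : (0 : ℝ) < 1 / 3)]
    ring

lemma lintegral_inv_sqrt_one_sub_cube_Iio :
    ∫⁻ s in Iio (1 : ℝ), ENNReal.ofReal (1 / √(1 - s ^ 3)) =
      ENNReal.ofReal (1 / 3 * ProbabilityTheory.beta (1 / 6) (1 / 3) +
        1 / 3 * ProbabilityTheory.beta (1 / 3) (1 / 2)) := by
  have h1 := ProbabilityTheory.beta_pos (α := 1 / 6) (β := 1 / 3) (by norm_num) (by norm_num)
  have h2 := ProbabilityTheory.beta_pos (α := 1 / 3) (β := 1 / 2) (by norm_num) (by norm_num)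
  rw [ENNReal.ofReal_add (by positivity) (by positivity), ← lintegral_inv_sqrt_one_sub_cube,
    ← lintegral_inv_sqrt_one_add_cube, ← Iio_union_Ico_eq_Iio (zero_le_one' ℝ),
    lintegral_union measurableSet_Ico, setLIntegral_congr Ioo_ae_eq_Ico]
  · congr 1
    refine lintegral_ofReal_subst (f := fun x => -x) (f' := fun _ => -1) measurableSet_Ioi
      (fun x _ => hasDerivAt_neg x) neg_injective.injOn ?_ ?_
    · simp
    · intro x _
      simp only [abs_neg, abs_one, one_mul]
      congr 3
      ring
  · exact Set.disjoint_left.2 fun x hx hy => absurd hx (not_lt.2 hy.1)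

/-- The product of the two real periods of the curve `y² = x³ - 1`. -/
lemma beta_mul_beta_add_beta :
    (1 / 3 * ProbabilityTheory.beta (1 / 6) (1 / 2)) *
      (1 / 3 * ProbabilityTheory.beta (1 / 6) (1 / 3) +
        1 / 3 * ProbabilityTheory.beta (1 / 3) (1 / 2)) * √3 =
      8 / π * (3 * Gamma (1 / 3) ^ 6 / (32 * (2 : ℝ) ^ ((2 : ℝ) / 3) * π)) := by
  have g3 : 0 < Gamma (1 / 3) := Gamma_pos_of_pos (by norm_num)
  have g6 : 0 < Gamma (1 / 6) := Gamma_pos_of_pos (by norm_num)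
  have s3 : (√3) ^ 2 = 3 := sq_sqrt (by norm_num)
  have s3p : 0 < √3 := by positivity
  have sp : (√π) ^ 2 = π := sq_sqrt pi_pos.le
  have spp : 0 < √π := by positivity
  have r1 := Real.Gamma_mul_Gamma_one_sub (1 / 3)
  have r2 := Real.Gamma_mul_Gamma_one_sub (1 / 6)
  have r3 := Real.Gamma_mul_Gamma_add_half (1 / 6)
  rw [show π * (1 / 3) = π / 3 by ring, sin_pi_div_three] at r1
  rw [show π * (1 / 6) = π / 6 by ring, sin_pi_div_six] at r2
  norm_num at r1 r2 r3
  have t0 : (0 : ℝ) < 2 ^ (2 / 3 : ℝ) := by positivity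
  have e1 : Gamma (2 / 3) = 2 * π / (√3 * Gamma (1 / 3)) := by
    rw [eq_div_iff (by positivity)]; field_simp at r1; linarith
  have e2 : Gamma (5 / 6) = 2 * π / Gamma (1 / 6) := by
    rw [eq_div_iff (by positivity)]; linarith
  have e3 : Gamma (1 / 6) = Gamma (1 / 3) ^ 2 * 2 ^ (2 / 3 : ℝ) * √π * √3 / (2 * π) := by
    rw [e1] at r3
    field_simp at r3 ⊢
    norm_num at r3 ⊢
    linarith
  unfold ProbabilityTheory.beta
  norm_num
  rw [Gamma_one_half_eq, e2, e1, e3]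
  have t3 : (2 ^ (2 / 3 : ℝ) : ℝ) ^ 3 = 4 := by
    rw [← rpow_natCast, ← rpow_mul (by norm_num)]; norm_num
  field_simp
  rw [t3, sp, show √3 ^ 4 = (√3 ^ 2) ^ 2 by ring, s3]
  ring

/-- The complete elliptic integral `∫_ℝ dx / (√(1 + x²) √(1 + k² x²)) = 2 K'(k)`. -/
noncomputable def ellipticLine (k : ℝ) : ENNReal :=
  ∫⁻ x : ℝ, ENNReal.ofReal (1 / (√(1 + x ^ 2) * √(1 + k ^ 2 * x ^ 2)))

lemma ellipticLine_eq_quartic {k σ : ℝ} (hk : 0 < k) (hσ : 4 * k ^ 2 = 2 + σ) :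
    ellipticLine k = ∫⁻ v in Ioi (0 : ℝ), ENNReal.ofReal (2 / √(v ^ 4 + σ * v ^ 2 + 1)) := by
  rw [ellipticLine, ← setLIntegral_univ]
  refine lintegral_ofReal_subst (f := fun v => (v - v⁻¹) / (2 * k))
    (f' := fun v => (1 - (-(v ^ 2)⁻¹)) / (2 * k)) measurableSet_Ioi
    (fun v hv => ((hasDerivAt_id' v).sub (hasDerivAt_inv (ne_of_gt hv))).div_const _) ?_ ?_ ?_
  · intro v hv w hw h
    have hv : 0 < v := hv
    have hw : 0 < w := hw
    have h : (v - v⁻¹) / (2 * k) = (w - w⁻¹) / (2 * k) := h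
    field_simp at h
    have : (v - w) * (v * w + 1) = 0 := by linear_combination h
    rcases mul_eq_zero.1 this with h | h
    · linarith
    · nlinarith [mul_pos hv hw]
  · refine eq_univ_of_forall fun x => ?_
    have h1 : √((k * x) ^ 2 + 1) ^ 2 = (k * x) ^ 2 + 1 := sq_sqrt (by positivity)
    have h2 : 0 < k * x + √((k * x) ^ 2 + 1) := by
      have : |k * x| < √((k * x) ^ 2 + 1) := by
        rw [← sqrt_sq_eq_abs]; exact sqrt_lt_sqrt (by positivity) (by linarith)
      linarith [neg_abs_le (k * x)]
    refine ⟨_, h2, ?_⟩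
    have h3 : (k * x + √((k * x) ^ 2 + 1))⁻¹ = √((k * x) ^ 2 + 1) - k * x :=
      inv_eq_of_mul_eq_one_right (by linear_combination h1)
    simp only [h3]
    field_simp
    ring
  · intro v hv
    have hv : 0 < v := hv
    have hq : 0 < v ^ 4 + σ * v ^ 2 + 1 := by
      nlinarith [sq_nonneg (v ^ 2 - 1), mul_pos hk (pow_pos hv 2),
        mul_pos (pow_pos hk 2) (pow_pos hv 2)]
    have e1 : 1 + ((v - v⁻¹) / (2 * k)) ^ 2 = (v ^ 4 + σ * v ^ 2 + 1) / (2 * k * v) ^ 2 := by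
      field_simp
      linear_combination v ^ 2 * hσ
    have e2 : 1 + k ^ 2 * ((v - v⁻¹) / (2 * k)) ^ 2 = ((v ^ 2 + 1) / (2 * v)) ^ 2 := by
      field_simp
      ring
    rw [e1, e2, sqrt_div hq.le, sqrt_sq (by positivity), sqrt_sq (by positivity), sub_neg_eq_add,
      abs_of_pos (by positivity)]
    have := sqrt_pos.2 hq
    field_simp

lemma lintegral_inv_sqrt_cube_sub_one_eq {k : ℝ} (hk : 0 < k) (hσ : 4 * k ^ 2 = 2 + √3) :
    ∫⁻ s in Ioi (1 : ℝ), ENNReal.ofReal (1 / √(s ^ 3 - 1)) =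
      ENNReal.ofReal (√3 / √(3 * √3)) * ellipticLine k := by
  have s3 : (√3) ^ 2 = 3 := sq_sqrt (by norm_num)
  have s3p : 0 < √3 := by positivity
  rw [ellipticLine_eq_quartic hk hσ, ← lintegral_ofReal_const_mul (by positivity)]
  refine lintegral_ofReal_subst (f := fun v => 1 + √3 * v ^ 2)
    (f' := fun v => √3 * (2 * v)) measurableSet_Ioi
    (fun v hv => by simpa using ((hasDerivAt_pow 2 v).const_mul √3).const_add 1) ?_ ?_ ?_
  · intro v hv w hw h
    have h : 1 + √3 * v ^ 2 = 1 + √3 * w ^ 2 := h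
    exact (pow_left_inj₀ (le_of_lt hv) (le_of_lt hw) two_ne_zero).1
      (mul_left_cancel₀ s3p.ne' (by linarith))
  · ext s
    constructor
    · rintro ⟨v, hv, rfl⟩
      have hv : 0 < v := hv
      have : 0 < √3 * v ^ 2 := by positivity
      simpa using this
    · intro hs
      have hs : 0 < s - 1 := sub_pos.2 hs
      refine ⟨√((s - 1) / √3), sqrt_pos.2 (by positivity), ?_⟩
      simp only
      rw [sq_sqrt (by positivity)]
      field_simp
      ring
  · intro v hv
    have hv : 0 < v := hv
    have e1 : (1 + √3 * v ^ 2) ^ 3 - 1 = v ^ 2 * ((3 * √3) * (v ^ 4 + √3 * v ^ 2 + 1)) := by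
      linear_combination v ^ 6 * √3 * s3
    rw [e1, sqrt_mul (by positivity), sqrt_mul (by positivity), sqrt_sq hv.le,
      abs_of_pos (by positivity)]
    have : 0 < √(v ^ 4 + √3 * v ^ 2 + 1) := sqrt_pos.2 (by positivity)
    have : 0 < √(3 * √3) := sqrt_pos.2 (by positivity)
    field_simp

lemma lintegral_inv_sqrt_one_sub_cube_eq {k : ℝ} (hk : 0 < k) (hσ : 4 * k ^ 2 = 2 + -√3) :
    ∫⁻ s in Iio (1 : ℝ), ENNReal.ofReal (1 / √(1 - s ^ 3)) =
      ENNReal.ofReal (√3 / √(3 * √3)) * ellipticLine k := by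
  have s3 : (√3) ^ 2 = 3 := sq_sqrt (by norm_num)
  have s3p : 0 < √3 := by positivity
  rw [ellipticLine_eq_quartic hk hσ, ← lintegral_ofReal_const_mul (by positivity)]
  refine lintegral_ofReal_subst (f := fun v => 1 - √3 * v ^ 2)
    (f' := fun v => -(√3 * (2 * v))) measurableSet_Ioi
    (fun v hv => by simpa using ((hasDerivAt_pow 2 v).const_mul √3).const_sub 1) ?_ ?_ ?_
  · intro v hv w hw h
    have h : 1 - √3 * v ^ 2 = 1 - √3 * w ^ 2 := h
    exact (pow_left_inj₀ (le_of_lt hv) (le_of_lt hw) two_ne_zero).1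
      (mul_left_cancel₀ s3p.ne' (by linarith))
  · ext s
    constructor
    · rintro ⟨v, hv, rfl⟩
      have hv : 0 < v := hv
      have : 0 < √3 * v ^ 2 := by positivity
      simpa using this
    · intro hs
      have hs : 0 < 1 - s := sub_pos.2 hs
      refine ⟨√((1 - s) / √3), sqrt_pos.2 (by positivity), ?_⟩
      simp only
      rw [sq_sqrt (by positivity)]
      field_simp
      ring
  · intro v hv
    have hv : 0 < v := hv
    have e1 : 1 - (1 - √3 * v ^ 2) ^ 3 = v ^ 2 * ((3 * √3) * (v ^ 4 + -√3 * v ^ 2 + 1)) := by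
      linear_combination v ^ 6 * √3 * s3
    have hq : 0 < v ^ 4 + -√3 * v ^ 2 + 1 := by
      nlinarith [sq_nonneg (v ^ 2 - 1), mul_pos (pow_pos hk 2) (pow_pos hv 2)]
    rw [e1, sqrt_mul (by positivity), sqrt_mul (by positivity), sqrt_sq hv.le, abs_neg,
      abs_of_pos (by positivity)]
    have := sqrt_pos.2 hq
    have : 0 < √(3 * √3) := sqrt_pos.2 (by positivity)
    field_simp

lemma exists_angle (u v : ℝ) {ρ : ℝ} (h : ρ ^ 2 = u ^ 2 + v ^ 2) :
    ∃ δ : ℝ, u = ρ * cos (2 * δ) ∧ v = ρ * sin (2 * δ) := by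
  wlog hρ : 0 ≤ ρ generalizing ρ u v
  · obtain ⟨δ, h1, h2⟩ := this (-u) (-v) (ρ := -ρ) (by linarith) (by linarith)
    exact ⟨δ, by linarith, by linarith⟩
  refine ⟨Complex.arg ⟨u, v⟩ / 2, ?_⟩
  have : ρ = ‖(⟨u, v⟩ : ℂ)‖ := by
    rw [Complex.norm_def, Complex.normSq_mk, ← sqrt_sq hρ, h]
    ring_nf
  rw [this, mul_div_cancel₀ _ two_ne_zero, Complex.norm_mul_cos_arg, Complex.norm_mul_sin_arg]
  simp

/-- The integral of `1 / √Q` over a half-turn. -/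
lemma lintegral_inv_sqrt_quadratic_eq_angle {α β γ : ℝ} :
    ∫⁻ r : ℝ, ENNReal.ofReal (1 / (√(1 + r ^ 2) * √(α + 2 * β * r + γ * r ^ 2))) =
      ∫⁻ θ in Ioo (-(π / 2)) (π / 2), ENNReal.ofReal
        (1 / √((α + γ) / 2 + ((α - γ) / 2 * cos (2 * θ) + β * sin (2 * θ)))) := by
  rw [← setLIntegral_univ]
  refine lintegral_ofReal_subst (f := tan) (f' := fun θ => 1 / cos θ ^ 2) measurableSet_Ioo
    (fun θ hθ => hasDerivAt_tan_of_mem_Ioo hθ) injOn_tan image_tan_Ioo ?_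
  intro θ hθ
  have hc : 0 < cos θ := cos_pos_of_mem_Ioo hθ
  have hs := sin_sq_add_cos_sq θ
  have e1 : 1 + tan θ ^ 2 = (1 / cos θ) ^ 2 := by
    rw [tan_eq_sin_div_cos]; field_simp; linarith
  have e2 : α + 2 * β * tan θ + γ * tan θ ^ 2 =
      ((α + γ) / 2 + ((α - γ) / 2 * cos (2 * θ) + β * sin (2 * θ))) / cos θ ^ 2 := by
    rw [tan_eq_sin_div_cos, cos_two_mul, sin_two_mul]
    field_simp
    linear_combination 2 * γ * hs
  rw [e1, e2, sqrt_sq (by positivity), sqrt_div' _ (by positivity), sqrt_sq hc.le,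
    abs_of_pos (by positivity)]
  field_simp

/-- The elliptic integral attached to a positive definite binary quadratic form depends only on the
eigenvalues of the form. -/
lemma lintegral_inv_sqrt_quadratic {α β γ m n : ℝ} (hm : 0 < m) (hn : 0 < n)
    (hadd : m + n = α + γ) (hmul : m * n = α * γ - β ^ 2) :
    ∫⁻ r : ℝ, ENNReal.ofReal (1 / (√(1 + r ^ 2) * √(α + 2 * β * r + γ * r ^ 2))) =
      ∫⁻ r : ℝ, ENNReal.ofReal (1 / (√(1 + r ^ 2) * √(m + n * r ^ 2))) := by
  obtain ⟨δ, h1, h2⟩ := exists_angle ((α - γ) / 2) β (ρ := (m - n) / 2) (by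
    linear_combination (m + n + α + γ) / 4 * hadd - hmul)
  have e := lintegral_inv_sqrt_quadratic_eq_angle (α := m) (β := 0) (γ := n)
  simp only [mul_zero, zero_mul, add_zero] at e
  rw [e, lintegral_inv_sqrt_quadratic_eq_angle]
  set G : ℝ → ℝ := fun θ => 1 / √((m + n) / 2 + (m - n) / 2 * cos (2 * θ)) with hG
  have hpos : ∀ θ, 0 < (m + n) / 2 + (m - n) / 2 * cos (2 * θ) := fun θ => by
    have hs := sin_sq_add_cos_sq θ
    have e : (m + n) / 2 + (m - n) / 2 * cos (2 * θ) = m * cos θ ^ 2 + n * sin θ ^ 2 := by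
      rw [cos_two_mul]
      linear_combination -n * hs
    rw [e]
    rcases eq_or_ne (cos θ) 0 with hc | hc
    · rw [hc] at hs ⊢
      nlinarith
    · positivity
  have hcont : Continuous G := by
    refine continuous_const.div (by fun_prop) fun θ => (sqrt_pos.2 (hpos θ)).ne'
  have hper : Function.Periodic G π := fun θ => by
    simp only [hG]
    rw [show 2 * (θ + π) = 2 * θ + 2 * π by ring, cos_add_two_pi]
  have key : ∀ F : ℝ → ℝ, Continuous F → (∀ θ, 0 ≤ F θ) →
      ∫⁻ θ in Ioo (-(π / 2)) (π / 2), ENNReal.ofReal (F θ) =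
        ENNReal.ofReal (∫ θ in (-(π / 2))..(π / 2), F θ) := fun F hF h0 => by
    rw [intervalIntegral.integral_of_le (by linarith [pi_pos]),
      ← ofReal_integral_eq_lintegral_ofReal
        (hF.continuousOn.integrableOn_compact isCompact_Icc |>.mono_set Ioo_subset_Icc_self)
        (ae_of_all _ h0), integral_Ioc_eq_integral_Ioo]
  have hG0 : ∀ θ, 0 ≤ G θ := fun θ => by positivity
  have e2 : ∀ θ, (α + γ) / 2 + ((α - γ) / 2 * cos (2 * θ) + β * sin (2 * θ)) =
      (m + n) / 2 + (m - n) / 2 * cos (2 * (θ - δ)) := fun θ => by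
    rw [h1, h2, hadd, mul_sub, cos_sub]
    ring
  simp_rw [e2]
  rw [key G hcont hG0, key (fun θ => G (θ - δ)) (by fun_prop) (fun θ => hG0 _),
    intervalIntegral.integral_comp_sub_right]
  have := hper.intervalIntegral_add_eq (-(π / 2) - δ) (-(π / 2))
  rw [show -(π / 2) - δ + π = π / 2 - δ by ring, show -(π / 2) + π = π / 2 by ring] at this
  rw [this]

lemma det_prod_fst_snd (a b c d : ℝ) :
    ((a • ContinuousLinearMap.fst ℝ ℝ ℝ + b • ContinuousLinearMap.snd ℝ ℝ ℝ).prod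
      (c • ContinuousLinearMap.fst ℝ ℝ ℝ + d • ContinuousLinearMap.snd ℝ ℝ ℝ)).det =
      a * d - b * c := by
  rw [ContinuousLinearMap.det, ← LinearMap.det_toMatrix (Module.Basis.finTwoProd ℝ),
    Matrix.det_fin_two]
  simp [LinearMap.toMatrix_apply]

lemma hasDerivAt_sqrt_one_add_sq_mul_sq (k t : ℝ) :
    HasDerivAt (fun t => √(1 + k ^ 2 * t ^ 2)) (k ^ 2 * t / √(1 + k ^ 2 * t ^ 2)) t := by
  have h := (((hasDerivAt_pow 2 t).const_mul (k ^ 2)).const_add 1).sqrt (by positivity)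
  convert h using 1
  field_simp
  simp
  ring

/-- Sphero-conal coordinates on the sphere, in the gnomonic chart centred at the axis orthogonal to
the focal lines, with the first coordinate axis rotated onto a focal line. -/
noncomputable def spheroConal (l m : ℝ) (w : ℝ × ℝ) : ℝ × ℝ :=
  (l * (w.1 * √(1 + l ^ 2 * w.2 ^ 2)) + m * (w.2 * √(1 + m ^ 2 * w.1 ^ 2)),
    m * (w.1 * √(1 + l ^ 2 * w.2 ^ 2)) - l * (w.2 * √(1 + m ^ 2 * w.1 ^ 2)))

lemma hasFDerivAt_spheroConal (l m : ℝ) (w : ℝ × ℝ) :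
    HasFDerivAt (spheroConal l m)
      (((l * √(1 + l ^ 2 * w.2 ^ 2) + m * (w.2 * (m ^ 2 * w.1 / √(1 + m ^ 2 * w.1 ^ 2)))) •
          ContinuousLinearMap.fst ℝ ℝ ℝ +
        (l * (w.1 * (l ^ 2 * w.2 / √(1 + l ^ 2 * w.2 ^ 2))) + m * √(1 + m ^ 2 * w.1 ^ 2)) •
          ContinuousLinearMap.snd ℝ ℝ ℝ).prod
      ((m * √(1 + l ^ 2 * w.2 ^ 2) - l * (w.2 * (m ^ 2 * w.1 / √(1 + m ^ 2 * w.1 ^ 2)))) •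
          ContinuousLinearMap.fst ℝ ℝ ℝ +
        (m * (w.1 * (l ^ 2 * w.2 / √(1 + l ^ 2 * w.2 ^ 2))) - l * √(1 + m ^ 2 * w.1 ^ 2)) •
          ContinuousLinearMap.snd ℝ ℝ ℝ)) w := by
  have hx := (hasFDerivAt_fst (𝕜 := ℝ) (p := w)).mul
    ((hasDerivAt_sqrt_one_add_sq_mul_sq l w.2).comp_hasFDerivAt w hasFDerivAt_snd)
  have hz := (hasFDerivAt_snd (𝕜 := ℝ) (p := w)).mul
    ((hasDerivAt_sqrt_one_add_sq_mul_sq m w.1).comp_hasFDerivAt w hasFDerivAt_fst)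
  refine HasFDerivAt.prodMk ?_ ?_
  · convert (hx.const_mul l).add (hz.const_mul m) using 1 <;> ext <;> simp
  · convert (hx.const_mul m).sub (hz.const_mul l) using 1 <;> ext <;> simp

lemma injective_spheroConal {l m : ℝ} (hlm : l ^ 2 + m ^ 2 = 1) :
    Function.Injective (spheroConal l m) := by
  rintro ⟨P, T⟩ ⟨P', T'⟩ h
  simp only [spheroConal, Prod.mk.injEq] at h
  obtain ⟨h1, h2⟩ := h
  have hx : P * √(1 + l ^ 2 * T ^ 2) = P' * √(1 + l ^ 2 * T' ^ 2) := by
    linear_combination l * h1 + m * h2 - (P * √(1 + l ^ 2 * T ^ 2) - P' * √(1 + l ^ 2 * T' ^ 2)) *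
      hlm
  have hz : T * √(1 + m ^ 2 * P ^ 2) = T' * √(1 + m ^ 2 * P' ^ 2) := by
    linear_combination m * h1 - l * h2 - (T * √(1 + m ^ 2 * P ^ 2) - T' * √(1 + m ^ 2 * P' ^ 2)) *
      hlm
  have hx2 := congrArg (· ^ 2) hx
  have hz2 := congrArg (· ^ 2) hz
  simp only [mul_pow] at hx2 hz2
  rw [sq_sqrt (by positivity), sq_sqrt (by positivity)] at hx2 hz2
  have hprod : P ^ 2 * T ^ 2 = P' ^ 2 * T' ^ 2 := by
    have e1 : P ^ 2 - P' ^ 2 = -l ^ 2 * (P ^ 2 * T ^ 2 - P' ^ 2 * T' ^ 2) := by linarith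
    have e2 : T ^ 2 - T' ^ 2 = -m ^ 2 * (P ^ 2 * T ^ 2 - P' ^ 2 * T' ^ 2) := by linarith
    have e3 : (P ^ 2 * T ^ 2 - P' ^ 2 * T' ^ 2) * (1 + m ^ 2 * P ^ 2 + l ^ 2 * T' ^ 2) = 0 := by
      linear_combination P ^ 2 * e2 + T' ^ 2 * e1
    rcases mul_eq_zero.1 e3 with h | h
    · linarith
    · nlinarith [mul_nonneg (sq_nonneg m) (sq_nonneg P), mul_nonneg (sq_nonneg l) (sq_nonneg T')]
  have hP : P ^ 2 = P' ^ 2 := by linear_combination hx2 - l ^ 2 * hprod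
  have hT : T ^ 2 = T' ^ 2 := by linear_combination hz2 - m ^ 2 * hprod
  rw [hT] at hx
  rw [hP] at hz
  rw [mul_right_cancel₀ (sqrt_pos.2 (by positivity)).ne' hx,
    mul_right_cancel₀ (sqrt_pos.2 (by positivity)).ne' hz]

lemma surjective_spheroConal {l m : ℝ} (hlm : l ^ 2 + m ^ 2 = 1) :
    Function.Surjective (spheroConal l m) := by
  rintro ⟨p, q⟩
  set x := l * p + m * q with hx
  set z := m * p - l * q with hz
  have hcont : Continuous fun P : ℝ => P * √(1 + l ^ 2 * (z / √(1 + m ^ 2 * P ^ 2)) ^ 2) := by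
    have : ∀ P : ℝ, √(1 + m ^ 2 * P ^ 2) ≠ 0 := fun P => (sqrt_pos.2 (by positivity)).ne'
    fun_prop (disch := assumption)
  have hge : ∀ P : ℝ, 1 ≤ √(1 + l ^ 2 * (z / √(1 + m ^ 2 * P ^ 2)) ^ 2) := fun P => by
    rw [one_le_sqrt]
    have : 0 ≤ l ^ 2 * (z / √(1 + m ^ 2 * P ^ 2)) ^ 2 := by positivity
    linarith
  obtain ⟨P, hP⟩ := mem_range_of_exists_le_of_exists_ge hcont (c := x)
    ⟨-|x|, by nlinarith [hge (-|x|), abs_nonneg x, neg_abs_le x]⟩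
    ⟨|x|, by nlinarith [hge (|x|), abs_nonneg x, le_abs_self x]⟩
  refine ⟨(P, z / √(1 + m ^ 2 * P ^ 2)), ?_⟩
  simp only at hP
  simp only [spheroConal]
  rw [hP, div_mul_cancel₀ _ (sqrt_pos.2 (by positivity)).ne', hx, hz]
  ext
  · simp only
    linear_combination p * hlm
  · simp only
    linear_combination q * hlm

lemma abs_jacobian_spheroConal {l m : ℝ} (hlm : l ^ 2 + m ^ 2 = 1) (P T : ℝ) :
    |(l * √(1 + l ^ 2 * T ^ 2) + m * (T * (m ^ 2 * P / √(1 + m ^ 2 * P ^ 2)))) *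
        (m * (P * (l ^ 2 * T / √(1 + l ^ 2 * T ^ 2))) - l * √(1 + m ^ 2 * P ^ 2)) -
      (l * (P * (l ^ 2 * T / √(1 + l ^ 2 * T ^ 2))) + m * √(1 + m ^ 2 * P ^ 2)) *
        (m * √(1 + l ^ 2 * T ^ 2) - l * (T * (m ^ 2 * P / √(1 + m ^ 2 * P ^ 2))))| =
      (1 + l ^ 2 * T ^ 2 + m ^ 2 * P ^ 2) / (√(1 + l ^ 2 * T ^ 2) * √(1 + m ^ 2 * P ^ 2)) := by
  have a1 : 0 < √(1 + l ^ 2 * T ^ 2) := sqrt_pos.2 (by positivity)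
  have a2 : 0 < √(1 + m ^ 2 * P ^ 2) := sqrt_pos.2 (by positivity)
  have b1 : √(1 + l ^ 2 * T ^ 2) ^ 2 = 1 + l ^ 2 * T ^ 2 := sq_sqrt (by positivity)
  have b2 : √(1 + m ^ 2 * P ^ 2) ^ 2 = 1 + m ^ 2 * P ^ 2 := sq_sqrt (by positivity)
  set a := √(1 + l ^ 2 * T ^ 2)
  set b := √(1 + m ^ 2 * P ^ 2)
  rw [← abs_neg, ← abs_of_pos (show 0 < (1 + l ^ 2 * T ^ 2 + m ^ 2 * P ^ 2) / (a * b) by positivity)]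
  congr 1
  field_simp
  linear_combination (a ^ 2 * b ^ 2 - l ^ 2 * m ^ 2 * P ^ 2 * T ^ 2) * hlm + b ^ 2 * b1 +
    (1 + l ^ 2 * T ^ 2) * b2

lemma integrand_spheroConal {l m : ℝ} (hlm : l ^ 2 + m ^ 2 = 1) (P T : ℝ) :
    (1 + l ^ 2 * T ^ 2 + m ^ 2 * P ^ 2) / (√(1 + l ^ 2 * T ^ 2) * √(1 + m ^ 2 * P ^ 2)) *
      (1 / (√(1 + (spheroConal l m (P, T)).1 ^ 2 + (spheroConal l m (P, T)).2 ^ 2) *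
        √(1 + (spheroConal l m (P, T)).2 ^ 2) *
        √(1 + (2 * l * m * (spheroConal l m (P, T)).1 +
          (m ^ 2 - l ^ 2) * (spheroConal l m (P, T)).2) ^ 2))) =
      1 / (√(1 + P ^ 2) * √(1 + m ^ 2 * P ^ 2)) * (1 / (√(1 + T ^ 2) * √(1 + l ^ 2 * T ^ 2))) := by
  have a1 : 0 < √(1 + l ^ 2 * T ^ 2) := sqrt_pos.2 (by positivity)
  have a2 : 0 < √(1 + m ^ 2 * P ^ 2) := sqrt_pos.2 (by positivity)
  have b1 : √(1 + l ^ 2 * T ^ 2) ^ 2 = 1 + l ^ 2 * T ^ 2 := sq_sqrt (by positivity)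
  have b2 : √(1 + m ^ 2 * P ^ 2) ^ 2 = 1 + m ^ 2 * P ^ 2 := sq_sqrt (by positivity)
  have c1 : 0 < √(1 + P ^ 2) := sqrt_pos.2 (by positivity)
  have c2 : 0 < √(1 + T ^ 2) := sqrt_pos.2 (by positivity)
  simp only [spheroConal]
  set a := √(1 + l ^ 2 * T ^ 2)
  set b := √(1 + m ^ 2 * P ^ 2)
  have e1 : 1 + (l * (P * a) + m * (T * b)) ^ 2 + (m * (P * a) - l * (T * b)) ^ 2 =
      (1 + P ^ 2) * (1 + T ^ 2) := by
    linear_combination (P ^ 2 * a ^ 2 + T ^ 2 * b ^ 2 + P ^ 2 * T ^ 2) * hlm + P ^ 2 * b1 + T ^ 2 * b2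
  have e2 : (1 + (m * (P * a) - l * (T * b)) ^ 2) *
      (1 + (2 * l * m * (l * (P * a) + m * (T * b)) +
        (m ^ 2 - l ^ 2) * (m * (P * a) - l * (T * b))) ^ 2) =
      (1 + l ^ 2 * T ^ 2 + m ^ 2 * P ^ 2) ^ 2 := by
    have : 2 * l * m * (l * (P * a) + m * (T * b)) +
        (m ^ 2 - l ^ 2) * (m * (P * a) - l * (T * b)) = m * (P * a) + l * (T * b) := by
      linear_combination (m * (P * a) + l * (T * b)) * hlm
    rw [this]
    have : (1 + (m * (P * a) - l * (T * b)) ^ 2) * (1 + (m * (P * a) + l * (T * b)) ^ 2) =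
        (1 + m ^ 2 * P ^ 2 * a ^ 2 + l ^ 2 * T ^ 2 * b ^ 2) ^ 2 -
          4 * m ^ 2 * P ^ 2 * l ^ 2 * T ^ 2 * a ^ 2 * b ^ 2 := by ring
    rw [this, b1, b2]
    ring
  rw [mul_assoc (√_), e1, ← sqrt_mul (show 0 ≤ 1 + (m * (P * a) - l * (T * b)) ^ 2 by positivity), e2,
    sqrt_sq (by positivity),
    sqrt_mul (by positivity)]
  field_simp

/-- Clausen-type product formula, in the form of an integral over the projective plane. -/
lemma lintegral_eq_ellipticLine_mul {l m : ℝ} (hlm : l ^ 2 + m ^ 2 = 1) :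
    ∫⁻ w : ℝ × ℝ, ENNReal.ofReal (1 / (√(1 + w.1 ^ 2 + w.2 ^ 2) * √(1 + w.2 ^ 2) *
        √(1 + (2 * l * m * w.1 + (m ^ 2 - l ^ 2) * w.2) ^ 2))) =
      ellipticLine m * ellipticLine l := by
  rw [← setLIntegral_univ, ← (surjective_spheroConal hlm).range_eq, ← image_univ,
    lintegral_image_eq_lintegral_abs_det_fderiv_mul volume MeasurableSet.univ
      (fun w _ => (hasFDerivAt_spheroConal l m w).hasFDerivWithinAt)
      (injective_spheroConal hlm).injOn, setLIntegral_univ]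
  simp_rw [det_prod_fst_snd, ← ENNReal.ofReal_mul (abs_nonneg _)]
  simp_rw [abs_jacobian_spheroConal hlm, integrand_spheroConal hlm]
  rw [ellipticLine, ellipticLine, ← lintegral_prod_mul (by fun_prop) (by fun_prop),
    Measure.volume_eq_prod]
  refine lintegral_congr fun w => ?_
  rw [ENNReal.ofReal_mul (by positivity)]

/-- Clausen-type product formula: the product of the elliptic integrals with complementary moduli
`l`, `m` is a double integral depending on `2 * l * m` only. -/
lemma lintegral_lintegral_eq_ellipticLine_mul {l m : ℝ} (hl : 0 < l) (hm : 0 < m)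
    (hlm : l ^ 2 + m ^ 2 = 1) :
    ∫⁻ q : ℝ, ∫⁻ r : ℝ, ENNReal.ofReal
      (1 / √(1 + q ^ 2) * (1 / (√(1 + r ^ 2) * √(1 + q ^ 2 + (2 * l * m) ^ 2 * r ^ 2)))) =
      ellipticLine m * ellipticLine l := by
  rw [← lintegral_eq_ellipticLine_mul hlm, Measure.volume_eq_prod,
    lintegral_prod_symm' _ (by fun_prop)]
  refine lintegral_congr fun q => ?_
  have hq : 0 < √(1 + q ^ 2) := sqrt_pos.2 (by positivity)
  have hq2 : √(1 + q ^ 2) ^ 2 = 1 + q ^ 2 := sq_sqrt (by positivity)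
  rw [lintegral_ofReal_const_mul (by positivity),
    ← lintegral_inv_sqrt_quadratic (α := 1 + ((m ^ 2 - l ^ 2) * q) ^ 2)
      (β := (m ^ 2 - l ^ 2) * q * (2 * l * m * √(1 + q ^ 2)))
      (γ := (2 * l * m * √(1 + q ^ 2)) ^ 2) (by positivity) (by positivity)
      (by
        rw [mul_pow _ (√_), hq2]
        linear_combination (-q ^ 2) * (l ^ 2 + m ^ 2 + 1) * hlm)
      (by linear_combination (-(2 * l * m) ^ 2) * hq2),
    ← lintegral_ofReal_const_mul (by positivity), ← setLIntegral_univ,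
    ← setLIntegral_univ (μ := volume)]
  symm
  refine lintegral_ofReal_subst (f := fun r => √(1 + q ^ 2) * r) (f' := fun _ => √(1 + q ^ 2))
    MeasurableSet.univ (fun r _ => by simpa using (hasDerivAt_id r).const_mul (√(1 + q ^ 2)))
    (mul_right_injective₀ hq.ne').injOn ?_ ?_
  · rw [image_univ]
    exact (mul_left_surjective₀ hq.ne').range_eq
  · intro r _
    have e1 : 1 + (√(1 + q ^ 2) * r) ^ 2 + q ^ 2 = (1 + q ^ 2) * (1 + r ^ 2) := by
      rw [mul_pow, hq2]; ring
    have e2 : 1 + (2 * l * m * (√(1 + q ^ 2) * r) + (m ^ 2 - l ^ 2) * q) ^ 2 =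
      1 + ((m ^ 2 - l ^ 2) * q) ^ 2 + 2 * ((m ^ 2 - l ^ 2) * q * (2 * l * m * √(1 + q ^ 2))) * r +
        (2 * l * m * √(1 + q ^ 2)) ^ 2 * r ^ 2 := by ring
    rw [abs_of_pos hq, e1, e2, sqrt_mul (by positivity)]
    have : 0 < √(1 + r ^ 2) := sqrt_pos.2 (by positivity)
    field_simp

lemma integrable_and_integral_div_sq_add_sq {c : ℝ} (hc : 0 < c) :
    Integrable (fun x : ℝ => c / (c ^ 2 + x ^ 2)) ∧ ∫ x : ℝ, c / (c ^ 2 + x ^ 2) = π := by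
  have e : (fun x : ℝ => c / (c ^ 2 + x ^ 2)) = fun x => c⁻¹ * (1 + (x / c) ^ 2)⁻¹ := by
    ext x
    field_simp
  rw [e]
  refine ⟨(integrable_inv_one_add_sq.comp_div hc.ne').const_mul _, ?_⟩
  rw [integral_const_mul, Measure.integral_comp_div (fun x => (1 + x ^ 2)⁻¹),
    integral_univ_inv_one_add_sq, abs_of_pos hc, smul_eq_mul, inv_mul_cancel_left₀ hc.ne']

lemma lintegral_sq_div_sq_add_sq_sq {A : ℝ} (hA : 0 < A) :
    ∫⁻ x : ℝ, ENNReal.ofReal (A / (A ^ 2 + x ^ 2) * (A / (A ^ 2 + x ^ 2))) =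
      ENNReal.ofReal (π / (A + A)) := by
  have h := lintegral_ofReal_subst (f := fun θ => A * tan θ) (f' := fun θ => A * (1 / cos θ ^ 2))
    (s := Ioo (-(π / 2)) (π / 2)) (t := univ)
    (g := fun x => A / (A ^ 2 + x ^ 2) * (A / (A ^ 2 + x ^ 2))) (h := fun θ => A⁻¹ * cos θ ^ 2)
    measurableSet_Ioo
    (fun θ hθ => (hasDerivAt_tan_of_mem_Ioo hθ).const_mul A)
    ((mul_right_injective₀ hA.ne').comp_injOn injOn_tan)
    (by
      rw [← image_image (fun x => A * x) tan, image_tan_Ioo, image_univ]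
      exact (mul_left_surjective₀ hA.ne').range_eq)
    (fun θ hθ => by
      have hc : 0 < cos θ := cos_pos_of_mem_Ioo hθ
      have e : A ^ 2 + (A * tan θ) ^ 2 = A ^ 2 / cos θ ^ 2 := by
        rw [tan_eq_sin_div_cos]
        field_simp
        linarith [sin_sq_add_cos_sq θ]
      simp only [e]
      rw [abs_of_pos (by positivity)]
      field_simp)
  rw [setLIntegral_univ] at h
  rw [h, lintegral_ofReal_const_mul (by positivity), ← ofReal_integral_eq_lintegral_ofReal
      ((by fun_prop : Continuous fun θ => cos θ ^ 2).continuousOn.integrableOn_compact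
        isCompact_Icc |>.mono_set Ioo_subset_Icc_self)
      (ae_of_all _ fun θ => sq_nonneg _), ← integral_Ioc_eq_integral_Ioo,
    ← intervalIntegral.integral_of_le (by linarith [pi_pos]), integral_cos_sq,
    ← ENNReal.ofReal_mul (by positivity)]
  congr 1
  simp
  field_simp
  ring

lemma lintegral_div_mul_div {A B : ℝ} (hA : 0 < A) (hB : 0 < B) :
    ∫⁻ x : ℝ, ENNReal.ofReal (A / (A ^ 2 + x ^ 2) * (B / (B ^ 2 + x ^ 2))) =
      ENNReal.ofReal (π / (A + B)) := by
  wlog hAB : A ≤ B generalizing A B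
  · rw [add_comm, ← this hB hA (le_of_not_ge hAB)]
    simp_rw [mul_comm]
  rcases hAB.eq_or_lt with rfl | hAB
  · exact lintegral_sq_div_sq_add_sq_sq hA
  have hD : 0 < B ^ 2 - A ^ 2 := by nlinarith
  have e : (fun x : ℝ => A / (A ^ 2 + x ^ 2) * (B / (B ^ 2 + x ^ 2))) = fun x =>
      B / (B ^ 2 - A ^ 2) * (A / (A ^ 2 + x ^ 2)) - A / (B ^ 2 - A ^ 2) * (B / (B ^ 2 + x ^ 2)) := by
    ext x
    have h1 : 0 < A ^ 2 + x ^ 2 := by positivity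
    have h2 : 0 < B ^ 2 + x ^ 2 := by positivity
    field_simp
    ring
  have iA := (integrable_and_integral_div_sq_add_sq hA).1.const_mul (B / (B ^ 2 - A ^ 2))
  have iB := (integrable_and_integral_div_sq_add_sq hB).1.const_mul (A / (B ^ 2 - A ^ 2))
  rw [← ofReal_integral_eq_lintegral_ofReal (by rw [e]; exact iA.sub iB)
    (ae_of_all _ fun x => by positivity), e, integral_sub iA iB, integral_const_mul,
    integral_const_mul, (integrable_and_integral_div_sq_add_sq hA).2,
    (integrable_and_integral_div_sq_add_sq hB).2]
  congr 1
  field_simp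
  ring

lemma lintegral_cosh_div {α : ℝ} (hα : 0 < α) (x : ℝ) :
    ∫⁻ q : ℝ, ENNReal.ofReal (α * cosh q / ((α * cosh q) ^ 2 + x ^ 2)) =
      ENNReal.ofReal (π * (1 / √(α ^ 2 + x ^ 2))) := by
  have hr : 0 < √(α ^ 2 + x ^ 2) := sqrt_pos.2 (by positivity)
  have hr2 : √(α ^ 2 + x ^ 2) ^ 2 = α ^ 2 + x ^ 2 := sq_sqrt (by positivity)
  have h := (integrable_and_integral_div_sq_add_sq one_pos)
  rw [← h.2, ← integral_mul_const, ofReal_integral_eq_lintegral_ofReal (h.1.mul_const _)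
    (ae_of_all _ fun x => by positivity), ← setLIntegral_univ,
    ← setLIntegral_univ (μ := volume)]
  symm
  refine lintegral_ofReal_subst (f := fun q => α / √(α ^ 2 + x ^ 2) * sinh q)
    (f' := fun q => α / √(α ^ 2 + x ^ 2) * cosh q) MeasurableSet.univ
    (fun q _ => (hasDerivAt_sinh q).const_mul _)
    ((mul_right_injective₀ (by positivity)).comp sinh_injective).injOn ?_ ?_
  · rw [image_univ]
    exact ((mul_left_surjective₀ (by positivity)).comp sinh_surjective).range_eq
  · intro q _
    have hc := cosh_pos q
    have e : 1 ^ 2 + (α / √(α ^ 2 + x ^ 2) * sinh q) ^ 2 =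
        ((α * cosh q) ^ 2 + x ^ 2) / (α ^ 2 + x ^ 2) := by
      rw [mul_pow, div_pow, hr2, sinh_sq]
      field_simp
      ring
    rw [e, abs_of_pos (by positivity)]
    field_simp
    rw [hr2]

lemma lintegral_inv_cosh_add_cosh {α : ℝ} (hα : 0 < α) :
    ∫⁻ z : ℝ × ℝ, ENNReal.ofReal (1 / (α * cosh z.1 + cosh z.2)) =
      ENNReal.ofReal π * ∫⁻ x : ℝ, ENNReal.ofReal (1 / (√(1 + x ^ 2) * √(α ^ 2 + x ^ 2))) := by
  have hpi := pi_pos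
  have e : ∀ z : ℝ × ℝ, ENNReal.ofReal (1 / (α * cosh z.1 + cosh z.2)) =
      ∫⁻ x : ℝ, ENNReal.ofReal π⁻¹ *
        (ENNReal.ofReal (α * cosh z.1 / ((α * cosh z.1) ^ 2 + x ^ 2)) *
        ENNReal.ofReal (1 * cosh z.2 / ((1 * cosh z.2) ^ 2 + x ^ 2))) := fun z => by
    have h1 := cosh_pos z.1
    have h2 := cosh_pos z.2
    have hA : 0 < α * cosh z.1 := by positivity
    have hB : 0 < 1 * cosh z.2 := by positivity
    rw [lintegral_const_mul' _ _ ENNReal.ofReal_ne_top]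
    have h0 : ∀ x : ℝ, 0 ≤ α * cosh z.1 / ((α * cosh z.1) ^ 2 + x ^ 2) := fun x => by positivity
    simp_rw [fun x => (ENNReal.ofReal_mul (q := 1 * cosh z.2 / ((1 * cosh z.2) ^ 2 + x ^ 2))
      (h0 x)).symm]
    rw [lintegral_div_mul_div hA hB, ← ENNReal.ofReal_mul (by positivity), one_mul]
    congr 1
    field_simp
  simp_rw [e]
  rw [lintegral_lintegral_swap (by fun_prop), ← lintegral_const_mul' _ _ ENNReal.ofReal_ne_top]
  refine lintegral_congr fun x => ?_
  rw [lintegral_const_mul' _ _ ENNReal.ofReal_ne_top, Measure.volume_eq_prod,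
    lintegral_prod_mul (f := fun y => ENNReal.ofReal (α * cosh y / ((α * cosh y) ^ 2 + x ^ 2)))
      (g := fun y => ENNReal.ofReal (1 * cosh y / ((1 * cosh y) ^ 2 + x ^ 2)))
      (by fun_prop) (by fun_prop), lintegral_cosh_div hα, lintegral_cosh_div one_pos,
    ← ENNReal.ofReal_mul (by positivity), ← ENNReal.ofReal_mul (by positivity),
    ← ENNReal.ofReal_mul (by positivity)]
  congr 1
  field_simp

lemma lintegral_comp_two_mul (F : ℝ → ENNReal) : ∫⁻ u : ℝ, F u = 2 * ∫⁻ p : ℝ, F (2 * p) := by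
  have h := lintegral_image_eq_lintegral_abs_deriv_mul (f := fun p : ℝ => 2 * p)
    (f' := fun _ => 2) MeasurableSet.univ
    (fun p _ => (show HasDerivAt (fun p : ℝ => 2 * p) 2 p by
      simpa using (hasDerivAt_id' p).const_mul 2).hasDerivWithinAt)
    (mul_right_injective₀ two_ne_zero).injOn F
  rw [image_univ, (mul_left_surjective₀ two_ne_zero).range_eq, setLIntegral_univ,
    setLIntegral_univ] at h
  rw [h, lintegral_const_mul' _ _ ENNReal.ofReal_ne_top]
  simp

lemma lintegral_lintegral_cosh_add_cosh {F : ℝ → ENNReal} (hF : Measurable F) :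
    ∫⁻ v : ℝ, ∫⁻ u : ℝ, F (cosh u + cosh v) =
      2 * ∫⁻ p : ℝ, ∫⁻ q : ℝ, F (2 * cosh p * cosh q) := by
  have e : ∀ v : ℝ, ∫⁻ u : ℝ, F (cosh u + cosh v) =
      2 * ∫⁻ p : ℝ, F (2 * cosh p * cosh (p + v)) := fun v => by
    rw [← lintegral_add_right_eq_self (fun u => F (cosh u + cosh v)) v, lintegral_comp_two_mul]
    congr 2
    ext p
    congr 1
    have h1 := cosh_add (p + v) p
    have h2 := cosh_sub (p + v) p
    rw [show p + v + p = 2 * p + v by ring] at h1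
    rw [add_sub_cancel_left] at h2
    rw [h1, h2]
    ring
  simp_rw [e]
  rw [lintegral_const_mul' _ _ ENNReal.ofNat_ne_top, lintegral_lintegral_swap (by fun_prop)]
  congr 2
  ext p
  exact lintegral_add_left_eq_self (fun q => F (2 * cosh p * cosh q)) p

lemma lintegral_exp_neg_mul {A : ℝ} (hA : 0 < A) :
    ∫⁻ t in Ioi (0 : ℝ), ENNReal.ofReal (exp (-t * A)) = ENNReal.ofReal (1 / A) := by
  simp_rw [show ∀ t, -t * A = -A * t by intro t; ring]
  rw [← ofReal_integral_eq_lintegral_ofReal (integrableOn_exp_mul_Ioi (neg_lt_zero.2 hA) 0)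
    (ae_of_all _ fun x => by positivity), integral_exp_mul_Ioi (neg_lt_zero.2 hA)]
  simp

lemma lintegral_cosh_sqrt :
    ∫⁻ p : ℝ, ∫⁻ x : ℝ, ENNReal.ofReal (1 / (√(1 + x ^ 2) * √((2 * cosh p) ^ 2 + x ^ 2))) =
      ENNReal.ofReal (1 / 2) * ∫⁻ q : ℝ, ∫⁻ r : ℝ, ENNReal.ofReal
        (1 / √(1 + q ^ 2) * (1 / (√(1 + r ^ 2) * √(1 + q ^ 2 + (1 / 2) ^ 2 * r ^ 2)))) := by
  set H : ℝ → ENNReal := fun q => ∫⁻ r : ℝ, ENNReal.ofReal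
        (1 / √(1 + q ^ 2) * (1 / (√(1 + r ^ 2) * √(1 + q ^ 2 + (1 / 2) ^ 2 * r ^ 2)))) with hH
  have h := lintegral_image_eq_lintegral_abs_deriv_mul MeasurableSet.univ
    (fun p _ => (hasDerivAt_sinh p).hasDerivWithinAt) sinh_injective.injOn H
  rw [image_univ, sinh_surjective.range_eq, setLIntegral_univ, setLIntegral_univ] at h
  rw [h, ← lintegral_const_mul' _ _ ENNReal.ofReal_ne_top]
  refine lintegral_congr fun p => ?_
  have hc := cosh_pos p
  rw [hH, ← lintegral_ofReal_const_mul (abs_nonneg _), ← lintegral_ofReal_const_mul (by norm_num)]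
  refine lintegral_congr fun x => ?_
  congr 1
  have e1 : 1 + sinh p ^ 2 = cosh p ^ 2 := by rw [sinh_sq]; ring
  have e2 : cosh p ^ 2 + (1 / 2) ^ 2 * x ^ 2 = ((2 * cosh p) ^ 2 + x ^ 2) / 2 ^ 2 := by ring
  rw [e1, e2, sqrt_sq hc.le, sqrt_div' _ (by norm_num), sqrt_sq (by norm_num), abs_of_pos hc]
  have : 0 < √((2 * cosh p) ^ 2 + x ^ 2) := sqrt_pos.2 (by positivity)
  have : 0 < √(1 + x ^ 2) := sqrt_pos.2 (by positivity)
  field_simp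

/-- `∫_ℝ e^{-t cosh u} du = 2 K₀(t)`. -/
noncomputable def besselLine (t : ℝ) : ENNReal := ∫⁻ u : ℝ, ENNReal.ofReal (exp (-t * cosh u))

lemma besselLine_pow_three (t : ℝ) :
    besselLine t ^ 3 = 2 * ∫⁻ y : ℝ × ℝ × ℝ,
      ENNReal.ofReal (exp (-t * (2 * cosh y.1 * cosh y.2.1 + cosh y.2.2))) := by
  have hsq : besselLine t * besselLine t =
      2 * ∫⁻ p : ℝ, ∫⁻ q : ℝ, ENNReal.ofReal (exp (-t * (2 * cosh p * cosh q))) := by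
    rw [← lintegral_lintegral_cosh_add_cosh (F := fun s => ENNReal.ofReal (exp (-t * s)))
      (by fun_prop)]
    simp only [mul_add, exp_add, ENNReal.ofReal_mul (exp_pos _).le]
    rw [besselLine, ← lintegral_lintegral_mul (by fun_prop) (by fun_prop)]
    simp_rw [mul_comm]
  rw [pow_succ, sq, hsq, mul_assoc]
  congr 1
  simp only [mul_add, exp_add, ENNReal.ofReal_mul (exp_pos _).le]
  rw [Measure.volume_eq_prod, lintegral_prod _ (by fun_prop), ← lintegral_mul_const _ (by fun_prop)]
  refine lintegral_congr fun p => ?_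
  rw [Measure.volume_eq_prod, besselLine]
  exact (lintegral_prod_mul (f := fun q => ENNReal.ofReal (exp (-t * (2 * cosh p * cosh q))))
    (g := fun w => ENNReal.ofReal (exp (-t * cosh w))) (by fun_prop) (by fun_prop)).symm

lemma lintegral_besselLine_pow_three :
    ∫⁻ t in Ioi (0 : ℝ), besselLine t ^ 3 =
      ENNReal.ofReal π * ∫⁻ q : ℝ, ∫⁻ r : ℝ, ENNReal.ofReal
        (1 / √(1 + q ^ 2) * (1 / (√(1 + r ^ 2) * √(1 + q ^ 2 + (1 / 2) ^ 2 * r ^ 2)))) := by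
  simp_rw [besselLine_pow_three]
  have hpos : ∀ y : ℝ × ℝ × ℝ, 0 < 2 * cosh y.1 * cosh y.2.1 + cosh y.2.2 := fun y => by
    have := cosh_pos y.1
    have := cosh_pos y.2.1
    have := cosh_pos y.2.2
    positivity
  rw [lintegral_const_mul' _ _ ENNReal.ofNat_ne_top, lintegral_lintegral_swap (by fun_prop)]
  simp_rw [fun y => lintegral_exp_neg_mul (hpos y)]
  rw [Measure.volume_eq_prod, lintegral_prod _ (by fun_prop)]
  simp_rw [fun p => lintegral_inv_cosh_add_cosh (α := 2 * cosh p) (by linarith [cosh_pos p])]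
  rw [lintegral_const_mul' _ _ ENNReal.ofReal_ne_top, lintegral_cosh_sqrt, ← mul_assoc, ← mul_assoc,
    mul_right_comm 2, ← ENNReal.ofReal_ofNat 2, ← ENNReal.ofReal_mul (by norm_num)]
  norm_num

lemma ellipticLine_mul_ellipticLine {l m : ℝ} (hl : 0 < l) (hm : 0 < m)
    (hl4 : 4 * l ^ 2 = 2 + -√3) (hm4 : 4 * m ^ 2 = 2 + √3) :
    ellipticLine m * ellipticLine l =
      ENNReal.ofReal (8 / π * (3 * Gamma (1 / 3) ^ 6 / (32 * (2 : ℝ) ^ ((2 : ℝ) / 3) * π))) := by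
  have h1 := lintegral_inv_sqrt_cube_sub_one_eq hm hm4
  have h2 := lintegral_inv_sqrt_one_sub_cube_eq hl hl4
  rw [lintegral_inv_sqrt_cube_sub_one] at h1
  rw [lintegral_inv_sqrt_one_sub_cube_Iio] at h2
  have hb1 : 0 < ProbabilityTheory.beta (1 / 6) (1 / 2) :=
    ProbabilityTheory.beta_pos (by norm_num) (by norm_num)
  have hκ : √3 * (√3 / √(3 * √3)) * (√3 / √(3 * √3)) = 1 := by
    have h3 : √3 ^ 2 = (3 : ℝ) := sq_sqrt (by norm_num)
    have h33 : √(3 * √3) ^ 2 = 3 * √3 := sq_sqrt (by positivity)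
    have : 0 < √3 := by positivity
    have : 0 < √(3 * √3) := by positivity
    rw [show √3 * (√3 / √(3 * √3)) * (√3 / √(3 * √3)) =
      √3 ^ 2 * √3 / √(3 * √3) ^ 2 by field_simp,
      h33, h3, div_self (by positivity)]
  rw [← beta_mul_beta_add_beta, mul_comm _ √3, ENNReal.ofReal_mul (sqrt_nonneg _),
    ENNReal.ofReal_mul (by positivity), h1, h2]
  calc ellipticLine m * ellipticLine l
      = ENNReal.ofReal (√3 * (√3 / √(3 * √3)) * (√3 / √(3 * √3))) *
          (ellipticLine m * ellipticLine l) := by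
        rw [hκ, ENNReal.ofReal_one, one_mul]
    _ = _ := by
        rw [ENNReal.ofReal_mul (by positivity), ENNReal.ofReal_mul (by positivity)]
        ring

lemma lintegral_besselLine_pow_three_eq :
    ∫⁻ t in Ioi (0 : ℝ), besselLine t ^ 3 =
      ENNReal.ofReal (8 * (3 * Gamma (1 / 3) ^ 6 / (32 * (2 : ℝ) ^ ((2 : ℝ) / 3) * π))) := by
  have h3 : √3 ^ 2 = (3 : ℝ) := sq_sqrt (by norm_num)
  have h32 : √3 < 2 := by nlinarith [sqrt_nonneg 3]
  have hl : 0 < √((2 + -√3) / 4) := sqrt_pos.2 (by linarith)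
  have hm : 0 < √((2 + √3) / 4) := by positivity
  have hl2 : √((2 + -√3) / 4) ^ 2 = (2 + -√3) / 4 := sq_sqrt (by linarith)
  have hm2 : √((2 + √3) / 4) ^ 2 = (2 + √3) / 4 := sq_sqrt (by positivity)
  have hlm : 2 * √((2 + -√3) / 4) * √((2 + √3) / 4) = 1 / 2 := by
    rw [mul_assoc, ← sqrt_mul (by linarith),
      show (2 + -√3) / 4 * ((2 + √3) / 4) = (1 / 4) ^ 2 by linear_combination -h3 / 16,
      sqrt_sq (by norm_num)]
    norm_num
  have h := lintegral_lintegral_eq_ellipticLine_mul hl hm (by rw [hl2, hm2]; ring)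
  rw [hlm, ellipticLine_mul_ellipticLine hl hm (by rw [hl2]; ring) (by rw [hm2]; ring)] at h
  rw [lintegral_besselLine_pow_three, h, ← ENNReal.ofReal_mul pi_pos.le]
  congr 1
  field_simp

lemma integrableOn_exp_neg_mul_cosh {t : ℝ} (ht : 0 < t) :
    IntegrableOn (fun u => exp (-t * cosh u)) (Ioi 0) := by
  refine (integrableOn_exp_mul_Ioi (a := -(t / 2)) (by linarith) 0).mono' (by fun_prop)
    ((ae_restrict_mem measurableSet_Ioi).mono fun u _ => ?_)
  rw [norm_of_nonneg (exp_pos _).le, exp_le_exp]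
  have hc : u / 2 ≤ cosh u := by
    rw [cosh_eq]
    linarith [add_one_le_exp u, exp_pos (-u)]
  nlinarith

lemma besselLine_eq {t : ℝ} (ht : 0 < t) :
    besselLine t = ENNReal.ofReal (2 * ∫ u in Ioi (0 : ℝ), exp (-t * cosh u)) := by
  have hneg : ∫⁻ u in Iio (0 : ℝ), ENNReal.ofReal (exp (-t * cosh u)) =
      ∫⁻ u in Ioi (0 : ℝ), ENNReal.ofReal (exp (-t * cosh u)) := by
    have h := (Measure.measurePreserving_neg (volume : Measure ℝ)).setLIntegral_comp_preimage_emb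
      (MeasurableEquiv.neg ℝ).measurableEmbedding
      (fun u => ENNReal.ofReal (exp (-t * cosh u))) (Ioi 0)
    simpa using h
  rw [besselLine, ← lintegral_add_compl _ (measurableSet_Ioi (a := (0 : ℝ))), compl_Ioi,
    setLIntegral_congr Iio_ae_eq_Iic.symm, hneg, ← two_mul, ENNReal.ofReal_mul zero_le_two,
    ofReal_integral_eq_lintegral_ofReal (integrableOn_exp_neg_mul_cosh ht)
      (ae_of_all _ fun u => (exp_pos _).le), ENNReal.ofReal_ofNat]

/-- The Bessel moment `∫₀^∞ K₀(t)³ dt`, where `K₀(t) = ∫₀^∞ e^{-t·cosh u} du`,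
converges and equals `3Γ(1/3)⁶/(32·2^{2/3}·π)`. -/
theorem bessel_moment_c30 (K₀ : ℝ → ℝ)
    (hK₀ : ∀ t : ℝ, 0 < t →
      K₀ t = ∫ u in Set.Ioi (0 : ℝ), Real.exp (-t * Real.cosh u)) :
    IntegrableOn (fun t => K₀ t ^ 3) (Set.Ioi (0 : ℝ)) ∧
    (∫ t in Set.Ioi (0 : ℝ), K₀ t ^ 3)
      = 3 * Real.Gamma (1 / 3) ^ 6 / (32 * (2 : ℝ) ^ ((2 : ℝ) / 3) * π) := by
  set V := 3 * Real.Gamma (1 / 3) ^ 6 / (32 * (2 : ℝ) ^ ((2 : ℝ) / 3) * π) with hV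
  have hV0 : 0 ≤ V := by
    have := pi_pos
    positivity
  have hnn : 0 ≤ᵐ[volume.restrict (Ioi (0 : ℝ))] fun t => K₀ t ^ 3 := by
    filter_upwards [ae_restrict_mem measurableSet_Ioi] with t ht
    rw [hK₀ t ht]
    exact pow_nonneg (integral_nonneg fun u => (exp_pos _).le) 3
  have hmeas : AEStronglyMeasurable (fun t => K₀ t ^ 3) (volume.restrict (Ioi (0 : ℝ))) := by
    have h : StronglyMeasurable fun t : ℝ => ∫ u in Ioi (0 : ℝ), exp (-t * cosh u) :=
      StronglyMeasurable.integral_prod_right (f := fun t u : ℝ => exp (-t * cosh u))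
        (by fun_prop : Continuous fun z : ℝ × ℝ => exp (-z.1 * cosh z.2)).stronglyMeasurable
    refine (h.pow 3).aestronglyMeasurable.congr ?_
    filter_upwards [ae_restrict_mem measurableSet_Ioi] with t ht
    simp [hK₀ t ht]
  have hval : ∫⁻ t in Ioi (0 : ℝ), ENNReal.ofReal (K₀ t ^ 3) = ENNReal.ofReal V := by
    have h8 : ENNReal.ofReal 8 * ∫⁻ t in Ioi (0 : ℝ), ENNReal.ofReal (K₀ t ^ 3) =
        ENNReal.ofReal 8 * ENNReal.ofReal V := by
      rw [← ENNReal.ofReal_mul (by norm_num), hV, ← lintegral_besselLine_pow_three_eq,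
        ← lintegral_ofReal_const_mul (by norm_num)]
      refine setLIntegral_congr_fun measurableSet_Ioi fun t ht => ?_
      have h0 : 0 ≤ ∫ u in Ioi (0 : ℝ), exp (-t * cosh u) :=
        integral_nonneg fun u => (exp_pos _).le
      rw [besselLine_eq ht, ← ENNReal.ofReal_pow (by positivity), hK₀ t ht, mul_pow]
      norm_num
    exact (ENNReal.mul_right_inj (by simp) ENNReal.ofReal_ne_top).1 h8
  refine ⟨(lintegral_ofReal_ne_top_iff_integrable hmeas hnn).1 (hval ▸ ENNReal.ofReal_ne_top), ?_⟩
  rw [integral_eq_lintegral_of_nonneg_ae hnn hmeas, hval, ENNReal.toReal_ofReal hV0]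
end

section
/- Let K₀(t) = ∫₀^∞ e^{-t·cosh u} du for t > 0, and set c_{4,k} = ∫₀^∞ t^k·K₀(t)⁴ dt for k = 0, 2 (both integrals converge). Let p, q : ℕ → ℝ both satisfy the recurrence u(n) = n(20n² + 3)·u(n-1) - (2n-1)⁶·u(n-2) for all n ≥ 2, with initial values p(0) = -128, p(1) = -128·23 + 64 = -2880, q(0) = 1, q(1) = 23. Then q(n) ≠ 0 for all n and the sequence p(n)/q(n) converges to -128 + 512·c_{4,2}/c_{4,0}. -/
open MeasureTheory Filter Real

open Set Topology

/-- The integral `∫₀^∞ cosh(u)ʲ e^{-t cosh u} du`; it is the Bessel function `K₀` when `j = 0`. -/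
noncomputable def coshExpIntegral (j : ℕ) (t : ℝ) : ℝ :=
  ∫ u in Ioi (0 : ℝ), Real.cosh u ^ j * Real.exp (-t * Real.cosh u)

lemma self_le_cosh (u : ℝ) : u ≤ Real.cosh u := by
  have h1 := Real.quadratic_le_exp_of_nonneg (x := |u|) (abs_nonneg u)
  have h2 := Real.exp_pos (-|u|)
  rw [← Real.cosh_abs, Real.cosh_eq]
  have h3 := le_abs_self u
  nlinarith [sq_nonneg (|u| - 1)]

lemma integrableOn_cosh_pow_mul_exp (j : ℕ) {t : ℝ} (ht : 0 < t) :
    IntegrableOn (fun u => Real.cosh u ^ j * Real.exp (-t * Real.cosh u)) (Ioi 0) := by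
  have hint : IntegrableOn (fun u : ℝ => (j.factorial / (t / 2) ^ j) * Real.exp (-(t / 2) * u))
      (Ioi 0) := (exp_neg_integrableOn_Ioi 0 (half_pos ht)).const_mul _
  refine hint.mono' (by fun_prop) ?_
  filter_upwards with u
  have hc := Real.cosh_pos u
  have h1 := Real.pow_div_factorial_le_exp (t / 2 * Real.cosh u) (by positivity) j
  rw [mul_pow, div_le_iff₀ (by positivity)] at h1
  have h2 : Real.cosh u ^ j ≤ (j.factorial / (t / 2) ^ j) * Real.exp (t / 2 * Real.cosh u) := by
    rw [div_mul_eq_mul_div, le_div_iff₀ (by positivity)]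
    linarith
  rw [Real.norm_of_nonneg (by positivity)]
  calc Real.cosh u ^ j * Real.exp (-t * Real.cosh u)
      ≤ (j.factorial / (t / 2) ^ j) * Real.exp (t / 2 * Real.cosh u)
          * Real.exp (-t * Real.cosh u) := by gcongr
    _ = (j.factorial / (t / 2) ^ j) * Real.exp (-(t / 2) * Real.cosh u) := by
        rw [mul_assoc, ← Real.exp_add]; ring_nf
    _ ≤ (j.factorial / (t / 2) ^ j) * Real.exp (-(t / 2) * u) := by
        gcongr ?_ * Real.exp ?_
        nlinarith [self_le_cosh u]

lemma hasDerivAt_coshExpIntegral (j : ℕ) {t : ℝ} (ht : 0 < t) :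
    HasDerivAt (coshExpIntegral j) (-coshExpIntegral (j + 1) t) t := by
  have h := (hasDerivAt_integral_of_dominated_loc_of_deriv_le
    (μ := volume.restrict (Ioi (0 : ℝ))) (s := Ioi (t / 2))
    (F := fun t u => Real.cosh u ^ j * Real.exp (-t * Real.cosh u))
    (F' := fun t u => -(Real.cosh u ^ (j + 1) * Real.exp (-t * Real.cosh u)))
    (bound := fun u => Real.cosh u ^ (j + 1) * Real.exp (-(t / 2) * Real.cosh u))
    (x₀ := t) (Ioi_mem_nhds (by linarith)) (Eventually.of_forall fun x => by fun_prop)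
    (integrableOn_cosh_pow_mul_exp j ht) (by fun_prop) ?_
    (integrableOn_cosh_pow_mul_exp (j + 1) (half_pos ht)) ?_).2
  · rw [integral_neg] at h
    exact h
  · filter_upwards with u x hx
    have hc := Real.cosh_pos u
    rw [norm_neg, Real.norm_of_nonneg (by positivity)]
    gcongr
    exact hx.le
  · filter_upwards with u x hx
    have h1 : HasDerivAt (fun x : ℝ => -x * Real.cosh u) (-1 * Real.cosh u) x :=
      (hasDerivAt_neg x).mul_const _
    refine (h1.exp.const_mul (Real.cosh u ^ j)).congr_deriv ?_
    ring

lemma coshExpIntegral_pos (j : ℕ) {t : ℝ} (ht : 0 < t) : 0 < coshExpIntegral j t := by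
  have hpos : ∀ u, 0 < Real.cosh u ^ j * Real.exp (-t * Real.cosh u) := fun u => by
    have := Real.cosh_pos u
    positivity
  refine (setIntegral_pos_iff_support_of_nonneg_ae
    (Eventually.of_forall fun u => (hpos u).le) (integrableOn_cosh_pow_mul_exp j ht)).2 ?_
  rw [Function.support_eq_univ fun u => (hpos u).ne', univ_inter]
  simp

/-- The modified Bessel equation of order zero. -/
lemma mul_coshExpIntegral_two {t : ℝ} (ht : 0 < t) :
    t * coshExpIntegral 2 t = t * coshExpIntegral 0 t + coshExpIntegral 1 t := by
  have i0 := integrableOn_cosh_pow_mul_exp 0 ht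
  have i1 := integrableOn_cosh_pow_mul_exp 1 ht
  have i2 := integrableOn_cosh_pow_mul_exp 2 ht
  have hlim : Tendsto (fun u => Real.sinh u * Real.exp (-t * Real.cosh u)) atTop (𝓝 0) := by
    have hc : Tendsto Real.cosh atTop atTop := tendsto_atTop_mono self_le_cosh tendsto_id
    have h := (tendsto_rpow_mul_exp_neg_mul_atTop_nhds_zero 1 t ht).comp hc
    refine squeeze_zero_norm' ?_ h
    filter_upwards [eventually_ge_atTop 0] with u hu
    have h1 := Real.sinh_nonneg_iff.2 hu
    rw [Real.norm_of_nonneg (by positivity)]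
    simp only [Function.comp_apply, Real.rpow_one]
    gcongr
    exact (Real.sinh_lt_cosh u).le
  have key := integral_Ioi_of_hasDerivAt_of_tendsto' (a := (0 : ℝ))
    (f := fun u => Real.sinh u * Real.exp (-t * Real.cosh u))
    (f' := fun u => Real.cosh u ^ 1 * Real.exp (-t * Real.cosh u)
      + (t * (Real.cosh u ^ 0 * Real.exp (-t * Real.cosh u))
        - t * (Real.cosh u ^ 2 * Real.exp (-t * Real.cosh u))))
    (fun u _ => by
      have h := (Real.hasDerivAt_sinh u).mul ((Real.hasDerivAt_cosh u).const_mul (-t)).exp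
      refine h.congr_deriv ?_
      linear_combination t * Real.exp (-t * Real.cosh u) * Real.cosh_sq u)
    (i1.add ((i0.const_mul t).sub (i2.const_mul t))) hlim
  rw [integral_add (g := fun u => t * (Real.cosh u ^ 0 * Real.exp (-t * Real.cosh u))
        - t * (Real.cosh u ^ 2 * Real.exp (-t * Real.cosh u)))
      i1 ((i0.const_mul t).sub (i2.const_mul t)),
    integral_sub (i0.const_mul t) (i2.const_mul t), integral_const_mul, integral_const_mul] at key
  simp only [Real.sinh_zero, zero_mul, sub_zero] at key
  simp only [coshExpIntegral]
  linarith

lemma coshExpIntegral_zero_le_rpow {a s : ℝ} (ha : 0 < a) (ha' : a ≤ 1) (hs : 0 < s) :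
    coshExpIntegral 0 s ≤ (s / 2) ^ (-a) / a := by
  have hint : IntegrableOn (fun u => (s / 2) ^ (-a) * Real.exp (-a * u)) (Ioi 0) :=
    (exp_neg_integrableOn_Ioi 0 ha).const_mul _
  have hle : coshExpIntegral 0 s ≤ ∫ u in Ioi (0 : ℝ), (s / 2) ^ (-a) * Real.exp (-a * u) := by
    refine setIntegral_mono (integrableOn_cosh_pow_mul_exp 0 hs) hint fun u => ?_
    have hcosh : Real.exp u / 2 ≤ Real.cosh u := by
      rw [Real.cosh_eq]
      linarith [Real.exp_pos (-u)]
    have hx : 0 < s / 2 * Real.exp u := by positivity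
    have hpow : (s / 2 * Real.exp u) ^ a ≤ Real.exp (s / 2 * Real.exp u) := by
      rcases le_total (s / 2 * Real.exp u) 1 with h | h
      · exact (Real.rpow_le_one hx.le h ha.le).trans (Real.one_le_exp hx.le)
      · calc (s / 2 * Real.exp u) ^ a ≤ (s / 2 * Real.exp u) ^ (1 : ℝ) :=
              Real.rpow_le_rpow_of_exponent_le h ha'
          _ ≤ _ := by
              rw [Real.rpow_one]
              linarith [Real.add_one_le_exp (s / 2 * Real.exp u)]
    calc Real.cosh u ^ 0 * Real.exp (-s * Real.cosh u)
        ≤ Real.exp (-(s / 2 * Real.exp u)) := by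
          rw [pow_zero, one_mul]
          gcongr
          nlinarith
      _ ≤ (s / 2 * Real.exp u) ^ (-a) := by
          rw [Real.exp_neg, Real.rpow_neg hx.le]
          exact inv_anti₀ (Real.rpow_pos_of_pos hx a) hpow
      _ = (s / 2) ^ (-a) * Real.exp (-a * u) := by
          rw [Real.mul_rpow (by positivity) (by positivity), ← Real.exp_mul]
          ring_nf
  refine hle.trans_eq ?_
  rw [integral_const_mul, integral_exp_mul_Ioi (neg_neg_of_pos ha)]
  simp
  ring

/-- Simultaneous bounds for `K₀(t)` and `t K₀'(t)`. -/
lemma exists_coshExpIntegral_le {a : ℝ} (ha : 0 < a) (ha' : a ≤ 1) :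
    ∃ C : ℝ, 0 < C ∧ ∀ t : ℝ, 0 < t →
      coshExpIntegral 0 t ≤ C * (t ^ (-a) * Real.exp (-(7 / 8) * t)) ∧
      t * coshExpIntegral 1 t ≤ C * (t ^ (-a) * Real.exp (-(7 / 8) * t)) := by
  refine ⟨16 * ((32 : ℝ)⁻¹ ^ (-a) / a), by positivity, fun t ht => ?_⟩
  have ht' : 0 < t / 16 := by positivity
  have i0 := integrableOn_cosh_pow_mul_exp 0 ht
  have i1 := integrableOn_cosh_pow_mul_exp 1 ht
  have hint : IntegrableOn (fun u => 16 * Real.exp (-(7 / 8) * t) *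
      (Real.cosh u ^ 0 * Real.exp (-(t / 16) * Real.cosh u))) (Ioi 0) :=
    (integrableOn_cosh_pow_mul_exp 0 ht').const_mul _
  have hbound : 16 * Real.exp (-(7 / 8) * t) * coshExpIntegral 0 (t / 16) ≤
      16 * ((32 : ℝ)⁻¹ ^ (-a) / a) * (t ^ (-a) * Real.exp (-(7 / 8) * t)) := by
    have h := coshExpIntegral_zero_le_rpow ha ha' ht'
    rw [show t / 16 / 2 = 32⁻¹ * t by ring, Real.mul_rpow (by positivity) ht.le] at h
    calc _ ≤ 16 * Real.exp (-(7 / 8) * t) * ((32 : ℝ)⁻¹ ^ (-a) * t ^ (-a) / a) := by gcongr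
      _ = _ := by ring
  have hexp : ∀ u, Real.exp (-(15 / 16) * (t * Real.cosh u)) ≤
      Real.exp (-(7 / 8) * t) * Real.exp (-(t / 16) * Real.cosh u) := fun u => by
    rw [← Real.exp_add]
    gcongr
    nlinarith [Real.one_le_cosh u]
  refine ⟨le_trans ?_ hbound, le_trans ?_ hbound⟩ <;>
    simp only [coshExpIntegral] <;> rw [← integral_const_mul]
  · refine setIntegral_mono i0 hint fun u => ?_
    have hx : 0 < t * Real.cosh u := mul_pos ht (Real.cosh_pos u)
    have h1 : Real.exp (-t * Real.cosh u) ≤ Real.exp (-(15 / 16) * (t * Real.cosh u)) := by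
      refine Real.exp_le_exp.2 ?_
      linarith
    have h2 := hexp u
    have h3 : 0 < Real.exp (-(7 / 8) * t) * Real.exp (-(t / 16) * Real.cosh u) := by positivity
    simp only [pow_zero, one_mul]
    linarith
  · rw [← integral_const_mul]
    refine setIntegral_mono (i1.const_mul t) hint fun u => ?_
    have h1 := Real.add_one_le_exp (t * Real.cosh u / 16)
    have h2 : t * Real.cosh u * Real.exp (-(t * Real.cosh u)) ≤
        16 * Real.exp (-(15 / 16) * (t * Real.cosh u)) := by
      calc _ ≤ 16 * Real.exp (t * Real.cosh u / 16) * Real.exp (-(t * Real.cosh u)) := by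
            refine mul_le_mul_of_nonneg_right ?_ (Real.exp_pos _).le
            linarith
        _ = _ := by
            rw [mul_assoc, ← Real.exp_add]
            ring_nf
    have h3 := hexp u
    simp only [pow_zero, pow_one, one_mul, neg_mul] at *
    linarith

/-- The moment `∫₀^∞ tᵏ K₀(t)ⁱ (t K₀'(t))ʲ dt`. -/
noncomputable def besselMoment (k i j : ℕ) : ℝ :=
  ∫ t in Ioi (0 : ℝ), t ^ k * (coshExpIntegral 0 t ^ i * (-t * coshExpIntegral 1 t) ^ j)

lemma exists_norm_besselMonomial_le {a : ℝ} (ha : 0 < a) (ha' : a ≤ 1) (i j : ℕ) :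
    ∃ C : ℝ, 0 < C ∧ ∀ (k : ℕ) (t : ℝ), 0 < t →
      ‖t ^ k * (coshExpIntegral 0 t ^ i * (-t * coshExpIntegral 1 t) ^ j)‖ ≤
        C * (t ^ (k - (i + j) * a) * Real.exp (-(7 / 8 * (i + j)) * t)) := by
  obtain ⟨C, hC, h⟩ := exists_coshExpIntegral_le ha ha'
  refine ⟨C ^ (i + j), by positivity, fun k t ht => ?_⟩
  have h0 := coshExpIntegral_pos 0 ht
  have h1 := coshExpIntegral_pos 1 ht
  obtain ⟨hb0, hb1⟩ := h t ht
  rw [norm_mul, norm_mul, norm_pow, norm_pow, norm_pow, norm_mul, norm_neg,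
    Real.norm_of_nonneg ht.le, Real.norm_of_nonneg h0.le, Real.norm_of_nonneg h1.le]
  calc t ^ k * (coshExpIntegral 0 t ^ i * (t * coshExpIntegral 1 t) ^ j)
      ≤ t ^ k * ((C * (t ^ (-a) * Real.exp (-(7 / 8) * t))) ^ i *
          (C * (t ^ (-a) * Real.exp (-(7 / 8) * t))) ^ j) := by gcongr
    _ = C ^ (i + j) * (t ^ k * (t ^ (-a)) ^ (i + j) * Real.exp (-(7 / 8) * t) ^ (i + j)) := by
        rw [← pow_add, mul_pow, mul_pow]
        ring
    _ = _ := by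
        rw [← Real.rpow_natCast t k, ← Real.rpow_mul_natCast ht.le, ← Real.rpow_add ht,
          ← Real.exp_nat_mul]
        push_cast
        ring_nf

lemma continuousOn_besselMonomial (k i j : ℕ) :
    ContinuousOn (fun t => t ^ k * (coshExpIntegral 0 t ^ i * (-t * coshExpIntegral 1 t) ^ j))
      (Ioi 0) := by
  have h : ∀ l, ContinuousOn (coshExpIntegral l) (Ioi 0) := fun l t ht =>
    (hasDerivAt_coshExpIntegral l ht).continuousAt.continuousWithinAt
  have h0 := h 0
  have h1 := h 1
  fun_prop

lemma integrableOn_rpow_mul_exp_neg_mul {s b : ℝ} (hs : -1 < s) (hb : 0 < b) :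
    IntegrableOn (fun t => t ^ s * Real.exp (-b * t)) (Ioi 0) := by
  simpa only [Real.rpow_one] using integrableOn_rpow_mul_exp_neg_mul_rpow hs one_pos hb

lemma integrableOn_besselMonomial (k : ℕ) {i j : ℕ} (hij : 0 < i + j) :
    IntegrableOn (fun t => t ^ k * (coshExpIntegral 0 t ^ i * (-t * coshExpIntegral 1 t) ^ j))
      (Ioi 0) := by
  have hij' : (0 : ℝ) < i + j := by exact_mod_cast hij
  have ha : (0 : ℝ) < 1 / (2 * (i + j)) := by positivity
  have ha' : 1 / (2 * ((i : ℝ) + j)) ≤ 1 := by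
    rw [div_le_one (by positivity)]
    have : (1 : ℝ) ≤ i + j := by exact_mod_cast hij
    linarith
  obtain ⟨C, -, h⟩ := exists_norm_besselMonomial_le ha ha' i j
  have hexp : (i + j) * (1 / (2 * ((i : ℝ) + j))) = 1 / 2 := by field_simp
  have hk : (0 : ℝ) ≤ k := k.cast_nonneg
  refine ((integrableOn_rpow_mul_exp_neg_mul (s := k - (i + j) * (1 / (2 * ((i : ℝ) + j))))
    (b := 7 / 8 * (i + j)) (by rw [hexp]; linarith) (by positivity)).const_mul C).mono'
    ((continuousOn_besselMonomial k i j).aestronglyMeasurable measurableSet_Ioi) ?_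
  filter_upwards [ae_restrict_mem measurableSet_Ioi] with t ht
  exact h k t ht

lemma tendsto_besselMonomial (k : ℕ) {i j : ℕ} (hij : 0 < i + j) :
    Tendsto (fun t => t ^ (k + 1) *
        (coshExpIntegral 0 t ^ i * (-t * coshExpIntegral 1 t) ^ j)) (𝓝[>] 0) (𝓝 0) ∧
      Tendsto (fun t => t ^ (k + 1) *
        (coshExpIntegral 0 t ^ i * (-t * coshExpIntegral 1 t) ^ j)) atTop (𝓝 0) := by
  have hij' : (0 : ℝ) < i + j := by exact_mod_cast hij
  have ha : (0 : ℝ) < 1 / (2 * (i + j)) := by positivity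
  have ha' : 1 / (2 * ((i : ℝ) + j)) ≤ 1 := by
    rw [div_le_one (by positivity)]
    have : (1 : ℝ) ≤ i + j := by exact_mod_cast hij
    linarith
  obtain ⟨C, -, h⟩ := exists_norm_besselMonomial_le ha ha' i j
  have hexp : (i + j) * (1 / (2 * ((i : ℝ) + j))) = 1 / 2 := by field_simp
  have hk : (0 : ℝ) ≤ k := k.cast_nonneg
  have hs : 0 < ((k + 1 : ℕ) : ℝ) - (i + j) * (1 / (2 * ((i : ℝ) + j))) := by
    rw [hexp]
    push_cast
    linarith
  constructor
  · refine squeeze_zero_norm' (eventually_nhdsWithin_of_forall fun t ht => h (k + 1) t ht) ?_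
    have hc : Continuous fun t : ℝ =>
        C * (t ^ (((k + 1 : ℕ) : ℝ) - (i + j) * (1 / (2 * ((i : ℝ) + j)))) *
          Real.exp (-(7 / 8 * (i + j)) * t)) := by
      have := Real.continuous_rpow_const hs.le
      fun_prop
    have h0 := (hc.tendsto 0).mono_left (nhdsWithin_le_nhds (s := Ioi 0))
    rwa [Real.zero_rpow hs.ne', zero_mul, mul_zero] at h0
  · refine squeeze_zero_norm' ((eventually_gt_atTop 0).mono fun t ht => h (k + 1) t ht) ?_
    have := (tendsto_rpow_mul_exp_neg_mul_atTop_nhds_zero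
      (((k + 1 : ℕ) : ℝ) - (i + j) * (1 / (2 * ((i : ℝ) + j)))) (7 / 8 * (i + j))
      (by positivity)).const_mul C
    rwa [mul_zero] at this

lemma besselMoment_integration_by_parts (k : ℕ) {i j : ℕ} (hij : 2 ≤ i + j) :
    (k + 1) * besselMoment k i j + i * besselMoment k (i - 1) (j + 1)
      + j * besselMoment (k + 2) (i + 1) (j - 1) = 0 := by
  have iA := integrableOn_besselMonomial k (i := i) (j := j) (by lia)
  have iB := integrableOn_besselMonomial k (i := i - 1) (j := j + 1) (by lia)
  have iC := integrableOn_besselMonomial (k + 2) (i := i + 1) (j := j - 1) (by lia)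
  have hv : ∀ t ∈ Ioi (0 : ℝ),
      HasDerivAt (fun t => coshExpIntegral 0 t ^ i * (-t * coshExpIntegral 1 t) ^ j)
        (i * coshExpIntegral 0 t ^ (i - 1) * (-coshExpIntegral 1 t) *
            (-t * coshExpIntegral 1 t) ^ j +
          coshExpIntegral 0 t ^ i * (j * (-t * coshExpIntegral 1 t) ^ (j - 1) *
            (t * coshExpIntegral 0 t))) t := fun t ht => by
    have h0 := hasDerivAt_coshExpIntegral 0 ht
    have h1 : HasDerivAt (fun t => -t * coshExpIntegral 1 t) (t * coshExpIntegral 0 t) t := by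
      refine ((hasDerivAt_neg t).mul (hasDerivAt_coshExpIntegral 1 ht)).congr_deriv ?_
      linear_combination mul_coshExpIntegral_two ht
    exact (h0.pow i).mul (h1.pow j)
  have hu : ∀ t ∈ Ioi (0 : ℝ), HasDerivAt (fun t : ℝ => t ^ (k + 1)) ((k + 1) * t ^ k) t :=
    fun t _ => by simpa using hasDerivAt_pow (k + 1) t
  have huv' : ∀ t : ℝ, t ^ (k + 1) * (i * coshExpIntegral 0 t ^ (i - 1) * (-coshExpIntegral 1 t) *
            (-t * coshExpIntegral 1 t) ^ j +
          coshExpIntegral 0 t ^ i * (j * (-t * coshExpIntegral 1 t) ^ (j - 1) *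
            (t * coshExpIntegral 0 t))) =
      i * (t ^ k * (coshExpIntegral 0 t ^ (i - 1) * (-t * coshExpIntegral 1 t) ^ (j + 1))) +
      j * (t ^ (k + 2) * (coshExpIntegral 0 t ^ (i + 1) *
        (-t * coshExpIntegral 1 t) ^ (j - 1))) := fun t => by ring
  have hu'v : ∀ t : ℝ,
      (k + 1) * t ^ k * (coshExpIntegral 0 t ^ i * (-t * coshExpIntegral 1 t) ^ j) =
      (k + 1) * (t ^ k * (coshExpIntegral 0 t ^ i * (-t * coshExpIntegral 1 t) ^ j)) :=
    fun t => by ring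
  obtain ⟨hz, hi⟩ := tendsto_besselMonomial k (i := i) (j := j) (by lia)
  have key := integral_Ioi_mul_deriv_eq_deriv_mul hu hv
    (IntegrableOn.congr_fun ((iB.const_mul (i : ℝ)).add (iC.const_mul (j : ℝ)))
      (fun t _ => (huv' t).symm) measurableSet_Ioi)
    (IntegrableOn.congr_fun (iA.const_mul ((k : ℝ) + 1)) (fun t _ => (hu'v t).symm) measurableSet_Ioi) hz hi
  simp only [huv', hu'v] at key
  rw [integral_add (iB.const_mul (i : ℝ)) (iC.const_mul (j : ℝ)), integral_const_mul,
    integral_const_mul, integral_const_mul] at key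
  simp only [besselMoment]
  linarith

/-- The three-term recurrence for the moments of `K₀⁴`. -/
lemma besselMoment_four_recurrence (k : ℕ) :
    (k + 1) ^ 5 * besselMoment k 4 0 -
      4 * (k + 2) * (5 * (k + 2) ^ 2 + 3) * besselMoment (k + 2) 4 0 +
      64 * (k + 3) * besselMoment (k + 4) 4 0 = 0 := by
  have a0 := besselMoment_integration_by_parts k (i := 4) (j := 0) (by lia)
  have a1 := besselMoment_integration_by_parts k (i := 3) (j := 1) (by lia)
  have a2 := besselMoment_integration_by_parts k (i := 2) (j := 2) (by lia)
  have a3 := besselMoment_integration_by_parts k (i := 1) (j := 3) (by lia)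
  have a4 := besselMoment_integration_by_parts k (i := 0) (j := 4) (by lia)
  have b0 := besselMoment_integration_by_parts (k + 2) (i := 4) (j := 0) (by lia)
  have b1 := besselMoment_integration_by_parts (k + 2) (i := 3) (j := 1) (by lia)
  have b2 := besselMoment_integration_by_parts (k + 2) (i := 2) (j := 2) (by lia)
  have c0 := besselMoment_integration_by_parts (k + 4) (i := 4) (j := 0) (by lia)
  norm_num [add_assoc] at a0 a1 a2 a3 a4 b0 b1 b2 c0
  have e1 : besselMoment k 3 1 = -(k + 1) / 4 * besselMoment k 4 0 := by linarith
  have e2 : besselMoment k 2 2 =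
      (-besselMoment (k + 2) 4 0 - (k + 1) * besselMoment k 3 1) / 3 := by linarith
  have f1 : besselMoment (k + 2) 3 1 = -(k + 3) / 4 * besselMoment (k + 2) 4 0 := by linarith
  have f2 : besselMoment (k + 2) 2 2 =
      (-besselMoment (k + 4) 4 0 - (k + 3) * besselMoment (k + 2) 3 1) / 3 := by linarith
  have g1 : besselMoment (k + 4) 3 1 = -(k + 5) / 4 * besselMoment (k + 4) 4 0 := by linarith
  have e3 : besselMoment k 1 3 =
      (-(k + 1) * besselMoment k 2 2 - 2 * besselMoment (k + 2) 3 1) / 2 := by linarith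
  have f3 : besselMoment (k + 2) 1 3 =
      (-(k + 3) * besselMoment (k + 2) 2 2 - 2 * besselMoment (k + 4) 3 1) / 2 := by linarith
  have e4 : besselMoment k 0 4 =
      -(k + 1) * besselMoment k 1 3 - 3 * besselMoment (k + 2) 2 2 := by linarith
  rw [e4, e3, f3, e2, f2, e1, f1, g1] at a4
  linear_combination 24 * a4

lemma besselMoment_four_pos (k : ℕ) : 0 < besselMoment k 4 0 := by
  have hpos : ∀ t ∈ Ioi (0 : ℝ),
      0 < t ^ k * (coshExpIntegral 0 t ^ 4 * (-t * coshExpIntegral 1 t) ^ 0) := fun t ht => by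
    have h0 := coshExpIntegral_pos 0 ht
    have ht' : 0 < t := ht
    simp only [pow_zero, mul_one]
    positivity
  refine (setIntegral_pos_iff_support_of_nonneg_ae ?_
    (integrableOn_besselMonomial k (by lia))).2 ?_
  · filter_upwards [ae_restrict_mem measurableSet_Ioi] with t ht
    exact (hpos t ht).le
  · rw [inter_eq_right.2 fun t ht => Function.mem_support.2 (hpos t ht).ne']
    simp

lemma exists_besselMoment_four_le : ∃ C : ℝ, 0 < C ∧ ∀ n : ℕ,
    besselMoment (2 * n + 2) 4 0 ≤ C * ((2 * n + 1).factorial / (49 / 4) ^ n) := by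
  obtain ⟨C, hC, h⟩ := exists_norm_besselMonomial_le (a := 1 / 4) (by norm_num) (by norm_num) 4 0
  refine ⟨C * (4 / 49), by positivity, fun n => ?_⟩
  have hs : (((2 * n + 2 : ℕ) : ℝ) - ((4 : ℕ) + (0 : ℕ)) * (1 / 4)) = 2 * n + 2 - 1 := by
    push_cast
    ring
  have hr : -(7 / 8 * (((4 : ℕ) : ℝ) + (0 : ℕ))) = -(7 / 2) := by norm_num
  have hn : (0 : ℝ) ≤ n := n.cast_nonneg
  rw [besselMoment]
  calc _ ≤ ∫ t in Ioi (0 : ℝ), C * (t ^ ((2 * n + 2 : ℝ) - 1) * Real.exp (-(7 / 2) * t)) := by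
        refine setIntegral_mono_on (integrableOn_besselMonomial _ (by lia))
          ((integrableOn_rpow_mul_exp_neg_mul (by linarith) (by norm_num)).const_mul C)
          measurableSet_Ioi fun t ht => ?_
        have h' := h (2 * n + 2) t ht
        rw [hs, hr] at h'
        exact (Real.le_norm_self _).trans h'
    _ = _ := by
        have hG : Real.Gamma (2 * n + 2) = (2 * n + 1).factorial := by
          rw [← Real.Gamma_nat_eq_factorial]
          push_cast
          ring_nf
        have hI := Real.integral_rpow_mul_exp_neg_mul_Ioi (a := 2 * n + 2) (r := 7 / 2)
          (by positivity) (by norm_num)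
        simp only [← neg_mul] at hI
        rw [integral_const_mul, hI, hG,
          show (2 * n + 2 : ℝ) = ((2 * n + 2 : ℕ) : ℝ) by push_cast; ring, Real.rpow_natCast,
          pow_add, pow_mul, show (49 / 4 : ℝ) ^ n = ((4 / 49) ^ n)⁻¹ by rw [← inv_pow]; norm_num]
        norm_num
        ring

/-- The product `3 · 5 ⋯ (2n + 1)`. -/
noncomputable def oddProd (n : ℕ) : ℝ := ∏ k ∈ Finset.range n, (2 * (k : ℝ) + 3)

lemma oddProd_succ (n : ℕ) : oddProd (n + 1) = oddProd n * (2 * n + 3) :=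
  Finset.prod_range_succ _ _

lemma oddProd_pos (n : ℕ) : 0 < oddProd n := Finset.prod_pos fun _ _ => by positivity

lemma factorial_le_oddProd_sq (n : ℕ) : ((2 * n + 1).factorial : ℝ) ≤ oddProd n ^ 2 := by
  induction n with
  | zero => simp [oddProd]
  | succ n ih =>
    rw [show 2 * (n + 1) + 1 = 2 * n + 1 + 1 + 1 by ring, Nat.factorial_succ, Nat.factorial_succ,
      oddProd_succ]
    push_cast
    calc _ = (2 * (n : ℝ) + 3) * (2 * n + 2) * ((2 * n + 1).factorial : ℝ) := by ring
      _ ≤ (2 * (n : ℝ) + 3) * (2 * n + 3) * ((2 * n + 1).factorial : ℝ) := by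
          gcongr
          norm_num
      _ ≤ (2 * (n : ℝ) + 3) * (2 * n + 3) * oddProd n ^ 2 := by gcongr
      _ = _ := by ring

lemma oddProd_cube_le {q : ℕ → ℝ}
    (hq : ∀ n : ℕ, 2 ≤ n →
      q n = (n : ℝ) * (20 * (n : ℝ) ^ 2 + 3) * q (n - 1) - (2 * (n : ℝ) - 1) ^ 6 * q (n - 2))
    (hq0 : q 0 = 1) (hq1 : q 1 = 23) (n : ℕ) : 23 / 27 * oddProd n ^ 3 ≤ q n := by
  have hstep : ∀ m : ℕ, 0 < q (m + 1) ∧ (2 * (m : ℝ) + 5) ^ 3 * q (m + 1) ≤ q (m + 2) := by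
    intro m
    induction m with
    | zero =>
      have h := hq 2 le_rfl
      norm_num [hq0, hq1] at h ⊢
      norm_num [h]
    | succ m ih =>
      obtain ⟨h0, h1⟩ := ih
      have hpos : 0 < q (m + 2) := lt_of_lt_of_le (by positivity) h1
      refine ⟨hpos, ?_⟩
      have h := hq (m + 3) (by lia)
      simp only [show m + 3 - 1 = m + 2 by lia, show m + 3 - 2 = m + 1 by lia] at h
      push_cast at h ⊢
      have hm : (0 : ℝ) ≤ m := m.cast_nonneg
      have h2 : (2 * (m : ℝ) + 5) ^ 3 * ((2 * (m : ℝ) + 5) ^ 3 * q (m + 1)) ≤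
          (2 * (m : ℝ) + 5) ^ 3 * q (m + 2) := by gcongr
      have h3 : (2 * (m : ℝ) + 7) ^ 3 * q (m + 2) ≤
          (((m : ℝ) + 3) * (20 * (m + 3) ^ 2 + 3) - (2 * m + 5) ^ 3) * q (m + 2) := by
        gcongr
        nlinarith [pow_nonneg hm 3, pow_nonneg hm 2]
      rw [show m + 1 + 2 = m + 3 by ring, show m + 1 + 1 = m + 2 by ring, h]
      linear_combination h2 + h3
  induction n with
  | zero => norm_num [oddProd, hq0]
  | succ n ih =>
    rcases n with _ | m
    · norm_num [oddProd, hq1]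
    · rw [oddProd_succ]
      push_cast
      refine le_trans ?_ (hstep m).2
      have : (0 : ℝ) ≤ (2 * m + 5) ^ 3 := by positivity
      linear_combination (2 * (m : ℝ) + 5) ^ 3 * ih

lemma oddProd_mul_besselMoment_eq {p q : ℕ → ℝ}
    (hp : ∀ n : ℕ, 2 ≤ n →
      p n = (n : ℝ) * (20 * (n : ℝ) ^ 2 + 3) * p (n - 1) - (2 * (n : ℝ) - 1) ^ 6 * p (n - 2))
    (hq : ∀ n : ℕ, 2 ≤ n →
      q n = (n : ℝ) * (20 * (n : ℝ) ^ 2 + 3) * q (n - 1) - (2 * (n : ℝ) - 1) ^ 6 * q (n - 2))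
    (hp0 : p 0 = -128) (hp1 : p 1 = -2880) (hq0 : q 0 = 1) (hq1 : q 1 = 23) (n : ℕ) :
    8 ^ n * oddProd n * besselMoment (2 * n + 2) 4 0 =
      -(besselMoment 0 4 0 / 512) * p n +
        (besselMoment 2 4 0 - besselMoment 0 4 0 / 4) * q n := by
  induction n using Nat.twoStepInduction with
  | zero =>
    simp [oddProd, hp0, hq0]
    ring
  | one =>
    have h := besselMoment_four_recurrence 0
    norm_num at h
    norm_num [oddProd, hp1, hq1]
    linear_combination (1 / 8) * h
  | more n ih0 ih1 =>
    have h := besselMoment_four_recurrence (2 * n + 2)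
    have hp' := hp (n + 2) (by lia)
    have hq' := hq (n + 2) (by lia)
    simp only [show n + 2 - 1 = n + 1 by lia, Nat.add_sub_cancel] at hp' hq'
    simp only [show 2 * (n + 1) + 2 = 2 * n + 2 + 2 by ring] at ih1
    rw [show 2 * (n + 2) + 2 = 2 * n + 2 + 4 by ring, hp', hq', oddProd_succ (n + 1)]
    rw [oddProd_succ n] at ih1 ⊢
    push_cast at h ⊢
    linear_combination ((n : ℝ) + 2) * (20 * (n + 2) ^ 2 + 3) * ih1 - (2 * (n : ℝ) + 3) ^ 6 * ih0
      + 8 ^ n * oddProd n * (2 * n + 3) * h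

/-- The continued fraction `[[-128,n(20n²+3)],[64,-(2n+1)⁶]]` converges to
`-128 + 512·c₄₂/c₄₀`, where `c₄ₖ = ∫₀^∞ tᵏK₀(t)⁴ dt` are Bessel moments
(both of which converge). -/
theorem bessel_moment_cf (K₀ : ℝ → ℝ)
    (hK₀ : ∀ t : ℝ, 0 < t →
      K₀ t = ∫ u in Set.Ioi (0 : ℝ), Real.exp (-t * Real.cosh u))
    (p q : ℕ → ℝ)
    (hp : ∀ n : ℕ, 2 ≤ n →
      p n = (n : ℝ) * (20 * (n : ℝ) ^ 2 + 3) * p (n - 1)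
              - (2 * (n : ℝ) - 1) ^ 6 * p (n - 2))
    (hq : ∀ n : ℕ, 2 ≤ n →
      q n = (n : ℝ) * (20 * (n : ℝ) ^ 2 + 3) * q (n - 1)
              - (2 * (n : ℝ) - 1) ^ 6 * q (n - 2))
    (hp0 : p 0 = -128) (hp1 : p 1 = -2880) (hq0 : q 0 = 1) (hq1 : q 1 = 23) :
    IntegrableOn (fun t => K₀ t ^ 4) (Set.Ioi (0 : ℝ)) ∧
    IntegrableOn (fun t => t ^ 2 * K₀ t ^ 4) (Set.Ioi (0 : ℝ)) ∧
    (∀ n, q n ≠ 0) ∧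
    Tendsto (fun n => p n / q n) atTop
      (nhds (-128 + 512 * (∫ t in Set.Ioi (0 : ℝ), t ^ 2 * K₀ t ^ 4)
        / (∫ t in Set.Ioi (0 : ℝ), K₀ t ^ 4))) := by
  have hmoment : ∀ k : ℕ, ∀ t ∈ Ioi (0 : ℝ),
      t ^ k * (coshExpIntegral 0 t ^ 4 * (-t * coshExpIntegral 1 t) ^ 0) = t ^ k * K₀ t ^ 4 :=
    fun k t ht => by simp [hK₀ t ht, coshExpIntegral]
  have hint : ∀ k : ℕ, IntegrableOn (fun t => t ^ k * K₀ t ^ 4) (Ioi 0) := fun k =>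
    (integrableOn_besselMonomial k (i := 4) (j := 0) (by lia)).congr_fun (hmoment k)
      measurableSet_Ioi
  have heq : ∀ k : ℕ, ∫ t in Ioi (0 : ℝ), t ^ k * K₀ t ^ 4 = besselMoment k 4 0 := fun k =>
    (setIntegral_congr_fun measurableSet_Ioi (hmoment k)).symm
  have hc0 := besselMoment_four_pos 0
  have hqlower := oddProd_cube_le hq hq0 hq1
  have hqpos : ∀ n, 0 < q n := fun n =>
    lt_of_lt_of_le (mul_pos (by norm_num) (pow_pos (oddProd_pos n) 3)) (hqlower n)
  refine ⟨by simpa using hint 0, hint 2, fun n => (hqpos n).ne', ?_⟩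
  have heq0 : ∫ t in Ioi (0 : ℝ), K₀ t ^ 4 = besselMoment 0 4 0 := by simpa using heq 0
  rw [heq 2, heq0]
  obtain ⟨C, hC, hle⟩ := exists_besselMoment_four_le
  have hu : Tendsto (fun n => 8 ^ n * oddProd n * besselMoment (2 * n + 2) 4 0 / q n) atTop
      (𝓝 0) := by
    have hgeom : Tendsto (fun n : ℕ => C * (27 / 23) * (32 / 49 : ℝ) ^ n) atTop (𝓝 0) := by
      simpa using (tendsto_pow_atTop_nhds_zero_of_lt_one (r := (32 / 49 : ℝ)) (by norm_num)
        (by norm_num)).const_mul (C * (27 / 23))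
    refine squeeze_zero (fun n => ?_) (fun n => ?_) hgeom
    · have h1 := oddProd_pos n
      have h2 := besselMoment_four_pos (2 * n + 2)
      have h3 := hqpos n
      positivity
    · have h1 := oddProd_pos n
      rw [div_le_iff₀ (hqpos n)]
      calc _ ≤ 8 ^ n * oddProd n * (C * (oddProd n ^ 2 / (49 / 4) ^ n)) := by
            gcongr
            refine (hle n).trans ?_
            gcongr
            exact factorial_le_oddProd_sq n
        _ = C * (27 / 23) * (32 / 49 : ℝ) ^ n * (23 / 27 * oddProd n ^ 3) := by
            rw [show (32 / 49 : ℝ) = 8 / (49 / 4) by norm_num, div_pow 8]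
            field_simp
        _ ≤ _ := by
            gcongr
            exact hqlower n
  have hlim := (hu.const_mul (-(512 / besselMoment 0 4 0))).const_add
    (-128 + 512 * besselMoment 2 4 0 / besselMoment 0 4 0)
  rw [mul_zero, add_zero] at hlim
  refine hlim.congr fun n => ?_
  rw [oddProd_mul_besselMoment_eq hp hq hp0 hp1 hq0 hq1]
  have := (hqpos n).ne'
  field_simp
  ring
end

section
/- Let p, q : ℕ → ℝ both satisfy the recurrence u(n) = 12n·u(n-1) - (2n-1)²·u(n-2) for all n ≥ 2, with initial values p(0) = 8, p(1) = 8·11 + 8 = 96, q(0) = 1, q(1) = 11. Then q(n) ≠ 0 for all n, the sequence p(n)/q(n) converges to L = (Γ(1/4)/Γ(3/4))², and moreover L - p(n)/q(n) is asymptotically equivalent (as n → ∞) to 4L/(1+√2)^{4n+4}. -/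
open Filter Real Asymptotics

/-- The radical `√(1 + cos² t)`. -/
noncomputable def lemniscateRadical (t : ℝ) : ℝ := √(1 + cos t ^ 2)

/-- The function `cos t / (1 + √(1 + cos² t))`. -/
noncomputable def lemniscateTan (t : ℝ) : ℝ := cos t / (1 + lemniscateRadical t)

/-- An integral representation of the Legendre function of the second kind `Q_{n-1/2}(3)`. -/
noncomputable def toroidal (n : ℕ) : ℝ :=
  ∫ t in (0 : ℝ)..(π / 2), lemniscateTan t ^ (2 * n) / lemniscateRadical t

lemma lemniscateRadical_sq (t : ℝ) : lemniscateRadical t ^ 2 = 1 + cos t ^ 2 :=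
  Real.sq_sqrt (by positivity)

lemma lemniscateRadical_pos (t : ℝ) : 0 < lemniscateRadical t :=
  Real.sqrt_pos.2 (by positivity)

lemma one_le_lemniscateRadical (t : ℝ) : 1 ≤ lemniscateRadical t :=
  Real.one_le_sqrt.2 (by nlinarith [sq_nonneg (cos t)])

lemma lemniscateRadical_le (t : ℝ) : lemniscateRadical t ≤ √2 :=
  Real.sqrt_le_sqrt (by nlinarith [cos_sq_le_one t])

lemma continuous_lemniscateRadical : Continuous lemniscateRadical := by
  unfold lemniscateRadical; fun_prop

lemma continuous_lemniscateTan : Continuous lemniscateTan := by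
  unfold lemniscateTan
  exact continuous_cos.div (continuous_const.add continuous_lemniscateRadical)
    fun t => by have := lemniscateRadical_pos t; positivity

lemma hasDerivAt_lemniscateRadical (t : ℝ) :
    HasDerivAt lemniscateRadical (-(cos t * sin t) / lemniscateRadical t) t := by
  have h := (((hasDerivAt_cos t).fun_pow 2).const_add 1).sqrt (by positivity)
  refine h.congr_deriv ?_
  rw [← lemniscateRadical]
  have := lemniscateRadical_pos t
  field_simp
  ring

lemma hasDerivAt_lemniscateTan (t : ℝ) :
    HasDerivAt lemniscateTan
      (-sin t / (lemniscateRadical t * (1 + lemniscateRadical t))) t := by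
  have hR := lemniscateRadical_pos t
  have h := (hasDerivAt_cos t).div ((hasDerivAt_lemniscateRadical t).const_add 1)
    (by positivity)
  refine h.congr_deriv ?_
  have h2 := lemniscateRadical_sq t
  field_simp
  linear_combination (-sin t) * h2

lemma lemniscateTan_sq (t : ℝ) :
    lemniscateTan t ^ 2 = (lemniscateRadical t - 1) / (1 + lemniscateRadical t) := by
  have hR := lemniscateRadical_pos t
  have h := lemniscateRadical_sq t
  unfold lemniscateTan
  field_simp
  linear_combination -h

lemma intervalIntegrable_toroidal (n : ℕ) (a b : ℝ) :
    IntervalIntegrable (fun t => lemniscateTan t ^ (2 * n) / lemniscateRadical t)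
      MeasureTheory.volume a b :=
  ((continuous_lemniscateTan.pow _).div continuous_lemniscateRadical
    fun t => (lemniscateRadical_pos t).ne').intervalIntegrable _ _

/-- The three-term recurrence of the Legendre functions `Q_{n-1/2}(3)`. -/
lemma toroidal_recurrence (k : ℕ) :
    (2 * k + 3) * toroidal (k + 2) = 12 * (k + 1) * toroidal (k + 1)
      - (2 * k + 1) * toroidal k := by
  have key : ∀ t : ℝ, HasDerivAt
      (fun t => -4 * (lemniscateTan t ^ (2 * k + 1) * (sin t / (1 + lemniscateRadical t))))
      ((2 * k + 3) * (lemniscateTan t ^ (2 * (k + 2)) / lemniscateRadical t)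
        - 12 * (k + 1) * (lemniscateTan t ^ (2 * (k + 1)) / lemniscateRadical t)
        + (2 * k + 1) * (lemniscateTan t ^ (2 * k) / lemniscateRadical t)) t := by
    intro t
    have hR := lemniscateRadical_pos t
    have h := (((hasDerivAt_lemniscateTan t).pow (2 * k + 1)).mul
      ((hasDerivAt_sin t).div ((hasDerivAt_lemniscateRadical t).const_add 1)
        (by positivity))).const_mul (-4)
    refine h.congr_deriv ?_
    have h2 := lemniscateRadical_sq t
    have hs : sin t ^ 2 = 2 - lemniscateRadical t ^ 2 := by linarith [sin_sq_add_cos_sq t]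
    have hc : cos t = lemniscateTan t * (1 + lemniscateRadical t) := by
      unfold lemniscateTan; field_simp
    have hx := lemniscateTan_sq t
    have e1 : lemniscateTan t ^ (2 * (k + 2))
      = lemniscateTan t ^ (2 * k) * (lemniscateTan t ^ 2) ^ 2 := by ring
    have e2 : lemniscateTan t ^ (2 * (k + 1))
      = lemniscateTan t ^ (2 * k) * (lemniscateTan t ^ 2) := by ring
    rw [e1, e2]
    simp only [Pi.pow_apply, Pi.div_apply, Nat.add_sub_cancel]
    rw [pow_succ (lemniscateTan t) (2 * k), hc]
    generalize lemniscateTan t ^ (2 * k) = Y at *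
    generalize lemniscateRadical t = R at *
    generalize lemniscateTan t = X at *
    push_cast
    field_simp
    simp only [hs, hx]
    field_simp
    ring
  have hi := fun n => intervalIntegrable_toroidal n 0 (π / 2)
  have h := intervalIntegral.integral_eq_sub_of_hasDerivAt
    (fun t _ => key t) ((((hi _).const_mul _).sub ((hi _).const_mul _)).add ((hi _).const_mul _))
  rw [intervalIntegral.integral_add (((hi _).const_mul _).sub ((hi _).const_mul _))
    ((hi _).const_mul _), intervalIntegral.integral_sub ((hi _).const_mul _)
    ((hi _).const_mul _)] at h
  simp only [intervalIntegral.integral_const_mul] at h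
  have h0 : lemniscateTan (π / 2) = 0 := by simp [lemniscateTan]
  rw [h0] at h
  simp only [sin_zero, zero_div, mul_zero, ne_eq, Nat.add_eq_zero_iff, 
    one_ne_zero, and_false, not_false_eq_true, zero_pow, zero_mul, sub_zero] at h
  unfold toroidal
  linarith

lemma toroidal_one :
    toroidal 1 = toroidal 0 - 2 * ∫ t in (0 : ℝ)..(π / 2), cos t ^ 2 / lemniscateRadical t := by
  have key : ∀ t : ℝ, HasDerivAt (fun t => 2 * (lemniscateTan t * sin t))
      (lemniscateTan t ^ (2 * 1) / lemniscateRadical t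
        - lemniscateTan t ^ (2 * 0) / lemniscateRadical t
        + 2 * (cos t ^ 2 / lemniscateRadical t)) t := by
    intro t
    have hR := lemniscateRadical_pos t
    have h := ((hasDerivAt_lemniscateTan t).mul (hasDerivAt_sin t)).const_mul 2
    refine h.congr_deriv ?_
    have h2 := lemniscateRadical_sq t
    have hs : sin t ^ 2 = 2 - lemniscateRadical t ^ 2 := by linarith [sin_sq_add_cos_sq t]
    have hc : cos t ^ 2 = lemniscateRadical t ^ 2 - 1 := by linarith
    rw [mul_one, lemniscateTan_sq, lemniscateTan]
    field_simp
    rw [hs, hc]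
    ring
  have hi := fun n => intervalIntegrable_toroidal n 0 (π / 2)
  have hc : IntervalIntegrable (fun t => cos t ^ 2 / lemniscateRadical t)
      MeasureTheory.volume 0 (π / 2) :=
    ((continuous_cos.pow _).div continuous_lemniscateRadical
      fun t => (lemniscateRadical_pos t).ne').intervalIntegrable _ _
  have h := intervalIntegral.integral_eq_sub_of_hasDerivAt
    (fun t _ => key t) (((hi _).sub (hi _)).add (hc.const_mul _))
  rw [intervalIntegral.integral_add ((hi _).sub (hi _)) (hc.const_mul _),
    intervalIntegral.integral_sub (hi _) (hi _), intervalIntegral.integral_const_mul] at h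
  have h0 : lemniscateTan (π / 2) = 0 := by simp [lemniscateTan]
  rw [h0] at h
  simp only [sin_zero, zero_mul, mul_zero, sub_zero] at h
  unfold toroidal
  linarith

lemma integral_rpow_mul_one_sub_rpow {a b : ℝ} (ha : 0 < a) (hb : 0 < b) :
    ∫ x in Set.Ioo (0 : ℝ) 1, x ^ (a - 1) * (1 - x) ^ (b - 1)
      = Real.Gamma a * Real.Gamma b / Real.Gamma (a + b) := by
  have h := Complex.betaIntegral_eq_Gamma_mul_div (a : ℂ) (b : ℂ) (by simpa) (by simpa)
  rw [← Complex.ofReal_add, Complex.Gamma_ofReal, Complex.Gamma_ofReal, Complex.Gamma_ofReal,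
    Complex.betaIntegral, intervalIntegral.integral_of_le zero_le_one,
    MeasureTheory.integral_Ioc_eq_integral_Ioo] at h
  have h2 : ∫ x in Set.Ioo (0 : ℝ) 1, ((x : ℂ) ^ ((a : ℂ) - 1) * (1 - (x : ℂ)) ^ ((b : ℂ) - 1))
      = ∫ x in Set.Ioo (0 : ℝ) 1, ((x ^ (a - 1) * (1 - x) ^ (b - 1) : ℝ) : ℂ) := by
    refine MeasureTheory.setIntegral_congr_fun measurableSet_Ioo fun x hx => ?_
    rw [Complex.ofReal_mul, Complex.ofReal_cpow hx.1.le, Complex.ofReal_cpow (by linarith [hx.2])]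
    push_cast
    rfl
  rw [h2, integral_complex_ofReal] at h
  exact_mod_cast h

lemma image_cos_pow_four : (fun t => cos t ^ 4) '' Set.Ioo 0 (π / 2) = Set.Ioo 0 1 := by
  ext u
  constructor
  · rintro ⟨t, ht, rfl⟩
    have h1 : 0 < cos t := cos_pos_of_mem_Ioo ⟨by linarith [ht.1, pi_pos], ht.2⟩
    have h2 : 0 < sin t := sin_pos_of_pos_of_lt_pi ht.1 (by linarith [ht.2, pi_pos])
    have h3 : cos t < 1 := by nlinarith [sin_sq_add_cos_sq t]
    exact ⟨by positivity, pow_lt_one₀ h1.le h3 (by norm_num)⟩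
  · rintro ⟨h0, h1⟩
    have hw0 : 0 < u ^ (1 / 4 : ℝ) := rpow_pos_of_pos h0 _
    have hw1 : u ^ (1 / 4 : ℝ) < 1 := rpow_lt_one h0.le h1 (by norm_num)
    refine ⟨arccos (u ^ (1 / 4 : ℝ)), ⟨arccos_pos.2 hw1, arccos_lt_pi_div_two.2 hw0⟩, ?_⟩
    simp only
    rw [cos_arccos (by linarith) hw1.le, ← rpow_natCast, ← rpow_mul h0.le]
    norm_num

lemma integral_cos_pow_div_lemniscateRadical (k : ℕ) :
    ∫ t in (0 : ℝ)..(π / 2), cos t ^ k / lemniscateRadical t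
      = √π * Real.Gamma ((k + 1) / 4) / (4 * Real.Gamma ((k + 3) / 4)) := by
  have hb := integral_rpow_mul_one_sub_rpow (a := (k + 1) / 4) (b := 1 / 2) (by positivity)
    (by norm_num)
  have hinj : Set.InjOn (fun t => cos t ^ 4) (Set.Ioo 0 (π / 2)) := by
    intro x hx y hy hxy
    have hx1 : 0 ≤ cos x := cos_nonneg_of_mem_Icc ⟨by linarith [hx.1, pi_pos], hx.2.le⟩
    have hy1 : 0 ≤ cos y := cos_nonneg_of_mem_Icc ⟨by linarith [hy.1, pi_pos], hy.2.le⟩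
    exact injOn_cos ⟨hx.1.le, by linarith [hx.2, pi_pos]⟩ ⟨hy.1.le, by linarith [hy.2, pi_pos]⟩
      ((pow_left_inj₀ hx1 hy1 (by norm_num)).1 hxy)
  rw [← image_cos_pow_four, MeasureTheory.integral_image_eq_integral_abs_deriv_smul
    measurableSet_Ioo (fun x _ => ((hasDerivAt_cos x).fun_pow 4).hasDerivWithinAt) hinj] at hb
  have hcongr : ∀ t ∈ Set.Ioo 0 (π / 2),
      |((4 : ℕ) : ℝ) * cos t ^ (4 - 1) * -sin t| • ((cos t ^ 4) ^ ((k + 1 : ℝ) / 4 - 1)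
        * (1 - cos t ^ 4) ^ ((1 : ℝ) / 2 - 1)) = 4 * (cos t ^ k / lemniscateRadical t) := by
    intro t ht
    have h1 : 0 < cos t := cos_pos_of_mem_Ioo ⟨by linarith [ht.1, pi_pos], ht.2⟩
    have h2 : 0 < sin t := sin_pos_of_pos_of_lt_pi ht.1 (by linarith [ht.2, pi_pos])
    have hR := lemniscateRadical_pos t
    have e1 : (1 - cos t ^ 4) ^ ((1 : ℝ) / 2 - 1) = (sin t * lemniscateRadical t)⁻¹ := by
      have : 1 - cos t ^ 4 = (sin t * lemniscateRadical t) ^ 2 := by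
        rw [mul_pow, lemniscateRadical_sq, sin_sq]; ring
      rw [this, ← rpow_natCast, ← rpow_mul (by positivity)]
      norm_num
      rw [rpow_neg_one, mul_inv, mul_comm]
    have e2 : (cos t ^ 4) ^ ((k + 1 : ℝ) / 4 - 1) * cos t ^ 3 = cos t ^ k := by
      rw [← rpow_natCast (cos t) 4, ← rpow_mul h1.le, ← rpow_natCast (cos t) 3, ← rpow_add h1,
        ← rpow_natCast (cos t) k]
      congr 1
      push_cast
      ring
    rw [mul_neg, abs_neg, abs_of_pos (by positivity), e1, ← e2, smul_eq_mul]
    push_cast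
    field_simp
  rw [MeasureTheory.setIntegral_congr_fun measurableSet_Ioo hcongr,
    MeasureTheory.integral_const_mul, ← MeasureTheory.integral_Ioc_eq_integral_Ioo,
    ← intervalIntegral.integral_of_le (by positivity), Real.Gamma_one_half_eq,
    show ((k : ℝ) + 1) / 4 + 1 / 2 = (k + 3) / 4 by ring] at hb
  have : Real.Gamma (((k : ℝ) + 3) / 4) ≠ 0 := (Real.Gamma_pos_of_pos (by positivity)).ne'
  field_simp at hb ⊢
  linarith

lemma toroidal_zero :
    toroidal 0 = √π / 4 * (Real.Gamma (1 / 4) / Real.Gamma (3 / 4)) := by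
  have h := integral_cos_pow_div_lemniscateRadical 0
  norm_num at h
  have h3 : Real.Gamma (3 / 4) ≠ 0 := (Real.Gamma_pos_of_pos (by norm_num)).ne'
  simp only [toroidal, mul_zero, pow_zero, one_div] at *
  rw [h]
  field_simp

lemma toroidal_one_eq :
    (Real.Gamma (1 / 4) / Real.Gamma (3 / 4)) ^ 2 * toroidal 1
      = ((Real.Gamma (1 / 4) / Real.Gamma (3 / 4)) ^ 2 - 8) * toroidal 0 := by
  have h := integral_cos_pow_div_lemniscateRadical 2
  have h1 : Real.Gamma (1 / 4) ≠ 0 := (Real.Gamma_pos_of_pos (by norm_num)).ne'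
  have h3 : Real.Gamma (3 / 4) ≠ 0 := (Real.Gamma_pos_of_pos (by norm_num)).ne'
  have h5 : Real.Gamma (5 / 4) = 1 / 4 * Real.Gamma (1 / 4) := by
    rw [← Real.Gamma_add_one (by norm_num)]; norm_num
  rw [show (((2 : ℕ) : ℝ) + 1) / 4 = 3 / 4 by norm_num,
    show (((2 : ℕ) : ℝ) + 3) / 4 = 5 / 4 by norm_num, h5] at h
  rw [toroidal_one, h, toroidal_zero]
  field_simp
  ring

lemma silver_mul_lemniscateTan_sq (t : ℝ) :
    ((1 + √2) * lemniscateTan t) ^ 2 = 1 + -(sin t ^ 2 *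
      (2 * (1 + √2) / ((lemniscateRadical t + 1) * (lemniscateRadical t + √2)))) := by
  have hR := lemniscateRadical_pos t
  have h2 : √2 ^ 2 = (2 : ℝ) := Real.sq_sqrt (by norm_num)
  have hs : sin t ^ 2 = (√2 - lemniscateRadical t) * (lemniscateRadical t + √2) := by
    linarith [sin_sq_add_cos_sq t, lemniscateRadical_sq t]
  rw [mul_pow, lemniscateTan_sq, hs]
  generalize lemniscateRadical t = R at *
  field_simp
  linear_combination (R + 1) ^ 2 * h2

lemma silver_mul_lemniscateTan_pow_le (n : ℕ) (t : ℝ) :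
    ((1 + √2) * lemniscateTan t) ^ (2 * n) ≤ exp (-(n * (sin t ^ 2 / √2))) := by
  have hR := lemniscateRadical_pos t
  have hle := lemniscateRadical_le t
  have h2 : √2 ^ 2 = (2 : ℝ) := Real.sq_sqrt (by norm_num)
  have h : ((1 + √2) * lemniscateTan t) ^ 2 ≤ exp (-(sin t ^ 2 / √2)) := by
    rw [silver_mul_lemniscateTan_sq]
    refine le_trans ?_ (add_one_le_exp _)
    have : 1 / √2 ≤ 2 * (1 + √2) / ((lemniscateRadical t + 1) * (lemniscateRadical t + √2)) := by
      rw [div_le_div_iff₀ (by positivity) (by positivity)]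
      calc 1 * ((lemniscateRadical t + 1) * (lemniscateRadical t + √2))
          ≤ 1 * ((√2 + 1) * (√2 + √2)) := by gcongr
        _ = _ := by ring
    have := mul_le_mul_of_nonneg_left this (sq_nonneg (sin t))
    rw [mul_one_div] at this
    linarith
  rw [pow_mul, ← mul_neg, Real.exp_nat_mul]
  exact pow_le_pow_left₀ (sq_nonneg _) h n

lemma tendsto_lemniscateRadical_div_sqrt (x : ℝ) :
    Tendsto (fun n : ℕ => lemniscateRadical (x / √n)) atTop (nhds √2) := by
  have h0 : lemniscateRadical 0 = √2 := by norm_num [lemniscateRadical]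
  rw [← h0]
  exact (continuous_lemniscateRadical.tendsto 0).comp (Tendsto.div_atTop tendsto_const_nhds
    (tendsto_sqrt_atTop.comp tendsto_natCast_atTop_atTop))

lemma tendsto_silver_mul_lemniscateTan_pow (x : ℝ) :
    Tendsto (fun n : ℕ => ((1 + √2) * lemniscateTan (x / √n)) ^ (2 * n)) atTop
      (nhds (exp (-(1 / √2) * x ^ 2))) := by
  have hdiv : Tendsto (fun n : ℕ => x / √n) atTop (nhds 0) :=
    Tendsto.div_atTop tendsto_const_nhds
      (tendsto_sqrt_atTop.comp tendsto_natCast_atTop_atTop)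
  have hR : Tendsto (fun n : ℕ => lemniscateRadical (x / √n)) atTop (nhds √2) :=
    tendsto_lemniscateRadical_div_sqrt x
  have hsinc : Tendsto (fun n : ℕ => x ^ 2 * sinc (x / √n) ^ 2) atTop (nhds (x ^ 2)) := by
    have := ((continuous_sinc.tendsto 0).comp hdiv).pow 2 |>.const_mul (x ^ 2)
    simpa using this
  have hmain : Tendsto (fun n : ℕ => (n : ℝ) * -(sin (x / √n) ^ 2 *
      (2 * (1 + √2) / ((lemniscateRadical (x / √n) + 1) * (lemniscateRadical (x / √n) + √2)))))
      atTop (nhds (-(1 / √2) * x ^ 2)) := by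
    have hlim := (hsinc.mul ((tendsto_const_nhds (x := 2 * (1 + √2))).div
      ((hR.add_const 1).mul (hR.add_const √2)) (by positivity))).neg
    have he : -(x ^ 2 * (2 * (1 + √2) / ((√2 + 1) * (√2 + √2)))) = -(1 / √2) * x ^ 2 := by
      field_simp
      ring
    rw [he] at hlim
    refine hlim.congr' ?_
    filter_upwards [eventually_gt_atTop 0] with n hn
    have hn' : (0 : ℝ) < n := by exact_mod_cast hn
    have hsq : √(n : ℝ) ^ 2 = n := Real.sq_sqrt hn'.le
    have : x ^ 2 * sinc (x / √n) ^ 2 = n * sin (x / √n) ^ 2 := by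
      rcases eq_or_ne x 0 with rfl | hx
      · simp
      · have : √(n : ℝ) ≠ 0 := (Real.sqrt_pos.2 hn').ne'
        rw [sinc_of_ne_zero (by positivity)]
        field_simp
        rw [hsq, mul_comm]
    rw [this, Pi.div_apply]
    ring
  simpa only [pow_mul, silver_mul_lemniscateTan_sq] using tendsto_one_add_pow_exp_of_tendsto hmain

/-- Laplace asymptotics of the integrals `toroidal n`. -/
lemma tendsto_sqrt_mul_toroidal :
    Tendsto (fun n : ℕ => √n * ((1 + √2) ^ (2 * n) * toroidal n)) atTop
      (nhds (√(π / (1 / √2)) / 2 / √2)) := by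
  set g : ℕ → ℝ → ℝ := fun n x =>
    ((1 + √2) * lemniscateTan x) ^ (2 * n) / lemniscateRadical x with hg
  set F : ℕ → ℝ → ℝ := fun n => (Set.Ioc 0 (√n * (π / 2))).indicator fun x => g n (x / √n) with hF
  set f : ℝ → ℝ := (Set.Ioi 0).indicator fun x => exp (-(1 / √2) * x ^ 2) / √2 with hf
  have hgc : ∀ n, Continuous (g n) := fun n =>
    ((continuous_const.mul continuous_lemniscateTan).pow _).div continuous_lemniscateRadical
      fun t => (lemniscateRadical_pos t).ne'
  have hsqrt : Tendsto (fun n : ℕ => √(n : ℝ)) atTop atTop :=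
    tendsto_sqrt_atTop.comp tendsto_natCast_atTop_atTop
  have hlim : Tendsto (fun n => ∫ x, F n x) atTop (nhds (∫ x, f x)) := by
    refine MeasureTheory.tendsto_integral_of_dominated_convergence
      (fun x => exp (-((2 / π) ^ 2 / √2) * x ^ 2)) (fun n => ?_)
      (integrable_exp_neg_mul_sq (by positivity)) (fun n => ?_) ?_
    · exact (((hgc n).comp (continuous_id.div_const _)).measurable.indicator
        measurableSet_Ioc).aestronglyMeasurable
    · refine Eventually.of_forall fun x => ?_
      by_cases hx : x ∈ Set.Ioc 0 (√(n : ℝ) * (π / 2))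
      · have hpos : 0 < √(n : ℝ) := by
          by_contra h
          have := hx.1.trans_le hx.2
          nlinarith [pi_pos]
        have hn : (0 : ℝ) < n := Real.sqrt_pos.1 hpos
        have hR := one_le_lemniscateRadical (x / √n)
        have h0 : 0 ≤ ((1 + √2) * lemniscateTan (x / √n)) ^ (2 * n) := by
          rw [pow_mul]; positivity
        rw [hF]
        simp only
        rw [Set.indicator_of_mem hx, hg, Real.norm_of_nonneg (div_nonneg h0 (by linarith))]
        refine (div_le_self h0 hR).trans ((silver_mul_lemniscateTan_pow_le n _).trans ?_)
        apply exp_le_exp.2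
        have hs : 2 / π * (x / √n) ≤ sin (x / √n) :=
          mul_le_sin (div_nonneg hx.1.le hpos.le) (by
            rw [div_le_iff₀ hpos]; linarith [hx.2])
        have hs2 : (2 / π * (x / √n)) ^ 2 ≤ sin (x / √n) ^ 2 :=
          pow_le_pow_left₀ (by have := hx.1; positivity) hs 2
        have hsq : √(n : ℝ) ^ 2 = n := Real.sq_sqrt hn.le
        have : (2 / π) ^ 2 / √2 * x ^ 2 = n * ((2 / π * (x / √n)) ^ 2 / √2) := by
          rw [mul_pow, div_pow x, hsq]
          field_simp
        rw [neg_mul, this]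
        gcongr
      · rw [hF]
        simp only
        rw [Set.indicator_of_notMem hx, norm_zero]
        positivity
    · refine Eventually.of_forall fun x => ?_
      rcases le_or_gt x 0 with hx | hx
      · have h1 : f x = 0 := Set.indicator_of_notMem (by simpa using hx) _
        have h2 : ∀ n, F n x = 0 := fun n => Set.indicator_of_notMem (fun h => by
          linarith [h.1]) _
        simp only [h1, h2]
        exact tendsto_const_nhds
      · rw [hf]
        rw [Set.indicator_of_mem (Set.mem_Ioi.2 hx)]
        refine ((tendsto_silver_mul_lemniscateTan_pow x).div
          (tendsto_lemniscateRadical_div_sqrt x) (by positivity)).congr' ?_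
        filter_upwards [hsqrt.eventually_ge_atTop (x / (π / 2))] with n hn
        rw [div_le_iff₀ (by positivity)] at hn
        exact (Set.indicator_of_mem (f := fun y => g n (y / √n)) (Set.mem_Ioc.2 ⟨hx, hn⟩)).symm
  have hfint : ∫ x, f x = √(π / (1 / √2)) / 2 / √2 := by
    rw [hf, MeasureTheory.integral_indicator measurableSet_Ioi,
      MeasureTheory.integral_div, integral_gaussian_Ioi]
  rw [hfint] at hlim
  refine hlim.congr' ?_
  filter_upwards [eventually_gt_atTop 0] with n hn
  have hn' : (0 : ℝ) < √(n : ℝ) := Real.sqrt_pos.2 (by exact_mod_cast hn)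
  rw [hF]
  simp only
  rw [MeasureTheory.integral_indicator measurableSet_Ioc,
    ← intervalIntegral.integral_of_le (mul_nonneg hn'.le pi_div_two_pos.le),
    intervalIntegral.integral_comp_div _ hn'.ne',
    _root_.zero_div, mul_div_cancel_left₀ _ hn'.ne', smul_eq_mul, toroidal,
    ← intervalIntegral.integral_const_mul ((1 + √2) ^ (2 * n))]
  simp only [hg, mul_pow, mul_div_assoc]

lemma toroidal_pos (n : ℕ) : 0 < toroidal n := by
  refine intervalIntegral.intervalIntegral_pos_of_pos_on (intervalIntegrable_toroidal n _ _)
    (fun t ht => ?_) pi_div_two_pos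
  have h1 : 0 < cos t := cos_pos_of_mem_Ioo ⟨by linarith [ht.1, pi_pos], ht.2⟩
  have hR := lemniscateRadical_pos t
  unfold lemniscateTan
  positivity

lemma tendsto_mul_toroidal_mul_toroidal :
    Tendsto (fun n : ℕ => (2 * (n : ℝ) + 3) * ((1 + √2) ^ (4 * n + 6) *
      (toroidal (n + 2) * toroidal (n + 1)))) atTop (nhds (π * √2 / 4)) := by
  have h1 := tendsto_sqrt_mul_toroidal.comp (tendsto_add_atTop_nat 1)
  have h2 := tendsto_sqrt_mul_toroidal.comp (tendsto_add_atTop_nat 2)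
  have h3 : Tendsto (fun n : ℕ => √(4 + 1 / ((n : ℝ) + 1) * (1 / ((n + 1 : ℕ) + 1)))) atTop
      (nhds √(4 + 0 * 0)) :=
    (((tendsto_one_div_add_atTop_nhds_zero_nat (𝕜 := ℝ)).mul
      ((tendsto_one_div_add_atTop_nhds_zero_nat (𝕜 := ℝ)).comp
        (tendsto_add_atTop_nat 1))).const_add 4).sqrt
  have h := h3.mul (h2.mul h1)
  have hval : √(4 + 0 * 0) * (√(π / (1 / √2)) / 2 / √2 * (√(π / (1 / √2)) / 2 / √2))
      = π * √2 / 4 := by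
    have e1 : √(π / (1 / √2)) ^ 2 = π / (1 / √2) := Real.sq_sqrt (by positivity)
    have e2 : √2 ^ 2 = (2 : ℝ) := Real.sq_sqrt (by norm_num)
    have e3 : √(4 + 0 * 0) = (2 : ℝ) := by
      rw [show (4 + 0 * 0 : ℝ) = 2 ^ 2 by norm_num]; exact Real.sqrt_sq (by norm_num)
    calc _ = √(4 + 0 * 0) * (√(π / (1 / √2)) ^ 2 / (4 * √2 ^ 2)) := by ring
      _ = _ := by rw [e1, e2, e3]; field_simp
  rw [hval] at h
  refine h.congr fun n => ?_
  have e : √(4 + 1 / ((n : ℝ) + 1) * (1 / ((n + 1 : ℕ) + 1))) * (√(n + 2 : ℕ) * √(n + 1 : ℕ))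
      = 2 * (n : ℝ) + 3 := by
    rw [← Real.sqrt_mul (by positivity), ← Real.sqrt_mul (by positivity)]
    rw [show (2 * (n : ℝ) + 3) = √((2 * (n : ℝ) + 3) ^ 2) from
      (Real.sqrt_sq (by positivity)).symm]
    congr 1
    push_cast
    field_simp
    ring
  rw [← e]
  simp only [Function.comp]
  ring

lemma tendsto_of_affine_recurrence {a b : ℕ → ℝ} {r β : ℝ} (hr0 : 0 ≤ r) (hr1 : r < 1)
    (h : ∀ n, a (n + 1) = r * a n + b n) (hb : Tendsto b atTop (nhds β)) :
    Tendsto a atTop (nhds (β / (1 - r))) := by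
  have hr : 0 < 1 - r := by linarith
  rw [Metric.tendsto_atTop] at hb ⊢
  intro ε hε
  obtain ⟨N, hN⟩ := hb (ε / 2 * (1 - r)) (by positivity)
  simp only [Real.dist_eq] at hN ⊢
  have hstep : ∀ k, |a (N + k) - β / (1 - r)| ≤ ε / 2 + r ^ k * |a N - β / (1 - r)| := by
    intro k
    induction k with
    | zero => simp; positivity
    | succ k ih =>
      have e : a (N + (k + 1)) - β / (1 - r)
          = r * (a (N + k) - β / (1 - r)) + (b (N + k) - β) := by
        rw [← add_assoc, h]; field_simp; ring
      rw [e]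
      refine (abs_add_le _ _).trans ?_
      rw [abs_mul, abs_of_nonneg hr0, pow_succ]
      have := mul_le_mul_of_nonneg_left ih hr0
      have := hN (N + k) (by omega)
      linarith
  have hlim : Tendsto (fun k => r ^ k * |a N - β / (1 - r)|) atTop (nhds 0) := by
    simpa using (tendsto_pow_atTop_nhds_zero_of_lt_one hr0 hr1).mul_const |a N - β / (1 - r)|
  obtain ⟨K, hK⟩ := eventually_atTop.1 (hlim.eventually_lt_const (half_pos hε))
  refine ⟨N + K, fun n hn => ?_⟩
  obtain ⟨k, rfl⟩ := Nat.exists_eq_add_of_le (show N ≤ n by omega)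
  have := hstep k
  have := hK k (by omega)
  linarith

/-- The continued fraction `[[8,11,12n],[8,-(2n+1)²]]` converges to
`(Γ(1/4)/Γ(3/4))²`, with speed `4(Γ(1/4)/Γ(3/4))²/(1+√2)^(4n+4)`. -/
theorem shifted_tiny_apery (p q : ℕ → ℝ)
    (hp : ∀ n : ℕ, 2 ≤ n →
      p n = 12 * (n : ℝ) * p (n - 1) - (2 * (n : ℝ) - 1) ^ 2 * p (n - 2))
    (hq : ∀ n : ℕ, 2 ≤ n →
      q n = 12 * (n : ℝ) * q (n - 1) - (2 * (n : ℝ) - 1) ^ 2 * q (n - 2))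
    (hp0 : p 0 = 8) (hp1 : p 1 = 96) (hq0 : q 0 = 1) (hq1 : q 1 = 11) :
    (∀ n, q n ≠ 0) ∧
    Tendsto (fun n => p n / q n) atTop
      (nhds ((Real.Gamma (1 / 4) / Real.Gamma (3 / 4)) ^ 2)) ∧
    (fun n : ℕ => (Real.Gamma (1 / 4) / Real.Gamma (3 / 4)) ^ 2 - p n / q n) ~[atTop]
      (fun n : ℕ => 4 * (Real.Gamma (1 / 4) / Real.Gamma (3 / 4)) ^ 2
        / (1 + Real.sqrt 2) ^ (4 * n + 4)) := by
  have hp' : ∀ n : ℕ, p (n + 2) = 12 * ((n : ℝ) + 2) * p (n + 1) - (2 * n + 3) ^ 2 * p n := by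
    intro n
    rw [hp (n + 2) (by omega), Nat.add_sub_cancel, show n + 2 - 1 = n + 1 by omega]
    push_cast
    ring
  have hq' : ∀ n : ℕ, q (n + 2) = 12 * ((n : ℝ) + 2) * q (n + 1) - (2 * n + 3) ^ 2 * q n := by
    intro n
    rw [hq (n + 2) (by omega), Nat.add_sub_cancel, show n + 2 - 1 = n + 1 by omega]
    push_cast
    ring
  have hpos : ∀ n : ℕ, 0 < q n ∧ (2 * (n : ℝ) + 3) * q n ≤ q (n + 1) := by
    intro n
    induction n with
    | zero => norm_num [hq0, hq1]
    | succ n ih =>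
      have h1 : 0 < q (n + 1) := lt_of_lt_of_le (mul_pos (by positivity) ih.1) ih.2
      refine ⟨h1, ?_⟩
      rw [hq' n]
      have := mul_le_mul_of_nonneg_left ih.2 (show (0 : ℝ) ≤ 2 * n + 3 by positivity)
      have := mul_pos (show (0 : ℝ) < 8 * n + 16 by positivity) h1
      push_cast
      linarith
  have hG : 0 < Real.Gamma (1 / 4) / Real.Gamma (3 / 4) :=
    div_pos (Real.Gamma_pos_of_pos (by norm_num)) (Real.Gamma_pos_of_pos (by norm_num))
  have hJ0 : toroidal 0 ^ 2 = π * (Real.Gamma (1 / 4) / Real.Gamma (3 / 4)) ^ 2 / 16 := by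
    rw [toroidal_zero, mul_pow, div_pow, Real.sq_sqrt pi_pos.le]
    ring
  have hJ1 := toroidal_one_eq
  set L : ℝ := (Real.Gamma (1 / 4) / Real.Gamma (3 / 4)) ^ 2 with hL
  have hLpos : 0 < L := by positivity
  have hJpos := toroidal_pos
  have hJ0' := (hJpos 0).ne'
  set d : ℕ → ℝ := fun n => (Nat.doubleFactorial (2 * n + 1) : ℝ) with hd
  have hd0 : d 0 = 1 := by simp [hd]
  have hdsucc : ∀ n, d (n + 1) = (2 * n + 3) * d n := by
    intro n
    simp only [hd]
    rw [show 2 * (n + 1) + 1 = (2 * n + 1) + 2 by ring, Nat.doubleFactorial_add_two]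
    push_cast
    ring
  have hdpos : ∀ n, 0 < d n := fun n => by
    simp only [hd]; exact_mod_cast Nat.doubleFactorial_pos _
  set c : ℝ := L / toroidal 0 with hc
  have hcpos : 0 < c := div_pos hLpos (hJpos 0)
  have hm : ∀ n, L * q n - p n = c * (d n * toroidal (n + 1)) ∧
      L * q (n + 1) - p (n + 1) = c * (d (n + 1) * toroidal (n + 2)) := by
    intro n
    induction n with
    | zero =>
      have h1 : c * toroidal 1 = L - 8 := by
        rw [hc]; field_simp; linarith
      have h0 : c * toroidal 0 = L := by rw [hc]; field_simp
      have hrec := toroidal_recurrence 0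
      rw [hdsucc, hd0, hq0, hp0, hq1, hp1]
      norm_num at hrec ⊢
      exact ⟨by linarith, by rw [hrec]; linear_combination (-12) * h1 + h0⟩
    | succ n ih =>
      refine ⟨ih.2, ?_⟩
      have hrec := toroidal_recurrence (n + 1)
      have e := hdsucc (n + 1)
      have e' := hdsucc n
      rw [hq' n, hp' n, e]
      push_cast at hrec ⊢
      have h1 := ih.1
      have h2 := ih.2
      rw [e'] at h2 ⊢
      linear_combination 12 * ((n : ℝ) + 2) * h2 - (2 * n + 3) ^ 2 * h1
        - c * ((2 * n + 3) * d n) * hrec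
  have hmpos : ∀ n, 0 < L * q n - p n := fun n => by
    rw [(hm n).1]; exact mul_pos hcpos (mul_pos (hdpos n) (hJpos _))
  have hcas : ∀ n, p (n + 1) * q n - p n * q (n + 1) = 8 * d n ^ 2 := by
    intro n
    induction n with
    | zero => rw [hd0, hp0, hp1, hq0, hq1]; norm_num
    | succ n ih =>
      rw [hp' n, hq' n, hdsucc]
      linear_combination (2 * (n : ℝ) + 3) ^ 2 * ih
  set w : ℝ := 1 + √2 with hw
  have hs2 : √2 ^ 2 = (2 : ℝ) := Real.sq_sqrt (by norm_num)
  have hw1 : 1 < w := by rw [hw]; linarith [Real.sqrt_pos.2 (show (0 : ℝ) < 2 by norm_num)]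
  have hw0 : 0 < w := by linarith
  have hw4 : 1 < w ^ 4 := one_lt_pow₀ hw1 (by norm_num)
  have ha : Tendsto (fun n => q n / (L * q n - p n) / w ^ (4 * n)) atTop
      (nhds (8 * w ^ 2 / c ^ 2 / (π * √2 / 4) / (1 - 1 / w ^ 4))) := by
    refine tendsto_of_affine_recurrence (b := fun n : ℕ => 8 * w ^ 2 / c ^ 2 /
      ((2 * (n : ℝ) + 3) * (w ^ (4 * n + 6) * (toroidal (n + 2) * toroidal (n + 1)))))
      (by positivity) (by rw [div_lt_one (by positivity)]; exact hw4) (fun n => ?_)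
      (tendsto_const_nhds.div tendsto_mul_toroidal_mul_toroidal (by positivity))
    have h1 := hmpos n
    have h2 := hmpos (n + 1)
    have hdiff : q (n + 1) / (L * q (n + 1) - p (n + 1)) = q n / (L * q n - p n)
        + 8 * d n ^ 2 / ((L * q (n + 1) - p (n + 1)) * (L * q n - p n)) := by
      rw [← hcas n, div_add_div _ _ h1.ne' (mul_pos h2 h1).ne',
        div_eq_div_iff h2.ne' (mul_pos h1 (mul_pos h2 h1)).ne']
      ring
    rw [hdiff, (hm n).2, (hm n).1, hdsucc]
    have := hJpos (n + 1)
    have := hJpos (n + 2)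
    have := hdpos n
    rw [show 4 * (n + 1) = 4 * n + 4 by ring, pow_add, pow_add]
    field_simp
  have hA : 8 * w ^ 2 / c ^ 2 / (π * √2 / 4) / (1 - 1 / w ^ 4) = w ^ 4 / (4 * L) := by
    have hc2 : c ^ 2 = 16 * L / π := by
      rw [hc, div_pow, hJ0]; field_simp
    have h4 : w ^ 4 = 4 * √2 * w ^ 2 + 1 := by
      have h2 : w ^ 2 = 2 * w + 1 := by rw [hw]; linear_combination hs2
      rw [show w ^ 4 = (w ^ 2) ^ 2 by ring, h2, hw]
      linear_combination (-4) * hs2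
    have h5 : 1 - 1 / w ^ 4 = 4 * √2 * w ^ 2 / w ^ 4 := by
      field_simp; linarith
    rw [h5, hc2]
    field_simp
    linear_combination (-16) * hs2
  rw [hA] at ha
  have hequiv : (fun n : ℕ => L - p n / q n) ~[atTop] (fun n : ℕ => 4 * L / w ^ (4 * n + 4)) := by
    refine (isEquivalent_iff_tendsto_one (Eventually.of_forall fun n => by positivity)).2 ?_
    have hone := (tendsto_const_nhds (x := w ^ 4 / (4 * L))).div ha (by positivity)
    rw [div_self (by positivity)] at hone
    refine hone.congr fun n => ?_
    have h1 := hmpos n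
    have h2 := (hpos n).1
    have h3 : L - p n / q n = (L * q n - p n) / q n := by field_simp
    rw [Pi.div_apply, Pi.div_apply, h3, pow_add]
    field_simp
  refine ⟨fun n => (hpos n).1.ne', ?_, hequiv⟩
  have hzero : Tendsto (fun n : ℕ => 4 * L / w ^ (4 * n + 4)) atTop (nhds 0) :=
    Tendsto.div_atTop tendsto_const_nhds ((tendsto_pow_atTop_atTop_of_one_lt hw1).comp
      (tendsto_atTop_mono (fun n => by simp only [id]; omega) tendsto_id))
  simpa using (hequiv.symm.tendsto_nhds hzero).const_sub L
end

section
/- Let z be a real number with z < 1 and z ≠ 0. Let p, q : ℕ → ℝ both satisfy the recurrence u(n) = (2n-1)(2-z)·u(n-1) - (n-1)²z²·u(n-2) for all n ≥ 2, with initial values p(0) = 0, p(1) = 2z, q(0) = 1, q(1) = 2-z. Then for all sufficiently large n, q(n) ≠ 0, and the sequence p(n)/q(n) converges to -log(1-z); moreover -log(1-z) - p(n)/q(n) is asymptotically equivalent (as n → ∞) to 2π/((1+√(1-z))²/z)^{2n+1}. -/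
open Filter Real Asymptotics

/-- The sequence `n ↦ π * P` of Laplace integrals, where `P` is the `n`-th Legendre polynomial at
`(1 + s²) / (1 - s²)`, rescaled by `(1 - s²) ^ n`. -/
noncomputable def laplaceIntegral (s : ℝ) (n : ℕ) : ℝ :=
  ∫ φ in (0 : ℝ)..π, (1 + s ^ 2 + 2 * s * cos φ) ^ n

/-- Euler type integral for the minimal solution of the Legendre recurrence. -/
noncomputable def eulerIntegral (z : ℝ) (n : ℕ) : ℝ :=
  ∫ t in (0 : ℝ)..1, (t * (1 - t) / (1 - z * t)) ^ n / (1 - z * t)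

theorem laplaceIntegral_zero (s : ℝ) : laplaceIntegral s 0 = π := by
  simp [laplaceIntegral]

theorem laplaceIntegral_one (s : ℝ) : laplaceIntegral s 1 = (1 + s ^ 2) * π := by
  have h : ∀ x, HasDerivAt (fun φ => (1 + s ^ 2) * φ + 2 * s * sin φ)
      ((1 + s ^ 2 + 2 * s * cos x) ^ 1) x := fun x => by
    refine (((hasDerivAt_id x).const_mul (1 + s ^ 2)).add
      ((hasDerivAt_sin x).const_mul (2 * s))).congr_deriv ?_
    ring
  rw [laplaceIntegral, intervalIntegral.integral_eq_sub_of_hasDerivAt (fun x _ => h x)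
    (Continuous.intervalIntegrable (by fun_prop) _ _)]
  simp

theorem laplaceIntegral_succ_succ (s : ℝ) (n : ℕ) :
    ((n : ℝ) + 2) * laplaceIntegral s (n + 2) =
      (2 * n + 3) * (1 + s ^ 2) * laplaceIntegral s (n + 1)
        - (n + 1) * (1 - s ^ 2) ^ 2 * laplaceIntegral s n := by
  have hint (k : ℕ) (a : ℝ) : IntervalIntegrable
      (fun φ => a * (1 + s ^ 2 + 2 * s * cos φ) ^ k) MeasureTheory.volume 0 π :=
    Continuous.intervalIntegrable (by fun_prop) _ _
  have hderiv : ∀ x, HasDerivAt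
      (fun φ => (1 + s ^ 2 + 2 * s * cos φ) ^ (n + 1) * (2 * s * sin φ))
      ((n + 2) * (1 + s ^ 2 + 2 * s * cos x) ^ (n + 2)
        - (2 * n + 3) * (1 + s ^ 2) * (1 + s ^ 2 + 2 * s * cos x) ^ (n + 1)
        + (n + 1) * (1 - s ^ 2) ^ 2 * (1 + s ^ 2 + 2 * s * cos x) ^ n) x := fun x => by
    have h := ((((hasDerivAt_cos x).const_mul (2 * s)).const_add (1 + s ^ 2)).pow (n + 1)).mul
      ((hasDerivAt_sin x).const_mul (2 * s))
    refine h.congr_deriv ?_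
    simp only [Pi.pow_apply, Nat.cast_add, Nat.cast_one, Nat.add_sub_cancel]
    linear_combination (-(4 * s ^ 2 * (n + 1) * (1 + s ^ 2 + 2 * s * cos x) ^ n)) *
      sin_sq_add_cos_sq x
  have key := intervalIntegral.integral_eq_sub_of_hasDerivAt (a := 0) (b := π)
    (fun x _ => hderiv x) (((hint _ _).sub (hint _ _)).add (hint _ _))
  rw [intervalIntegral.integral_add ((hint _ _).sub (hint _ _)) (hint _ _),
    intervalIntegral.integral_sub (hint _ _) (hint _ _)] at key
  simp only [intervalIntegral.integral_const_mul, sin_pi, sin_zero, mul_zero, sub_zero] at key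
  simp only [laplaceIntegral]
  linarith

theorem one_sub_mul_pos {z t : ℝ} (hz : z < 1) (ht : t ∈ Set.uIcc (0 : ℝ) 1) :
    0 < 1 - z * t := by
  rw [Set.uIcc_of_le zero_le_one] at ht
  rcases le_or_gt z 0 with h | h <;> nlinarith [ht.1, ht.2]

theorem intervalIntegrable_eulerIntegrand {z : ℝ} (hz : z < 1) (n : ℕ) :
    IntervalIntegrable (fun t => (t * (1 - t) / (1 - z * t)) ^ n / (1 - z * t))
      MeasureTheory.volume 0 1 := by
  refine ContinuousOn.intervalIntegrable ?_
  have h : ∀ t ∈ Set.uIcc (0 : ℝ) 1, 1 - z * t ≠ 0 := fun t ht => (one_sub_mul_pos hz ht).ne'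
  exact ((ContinuousOn.div (by fun_prop) (by fun_prop) h).pow n).div (by fun_prop) h

theorem eulerIntegral_zero {z : ℝ} (hz : z < 1) : z * eulerIntegral z 0 = -log (1 - z) := by
  have hderiv : ∀ t ∈ Set.uIcc (0 : ℝ) 1, HasDerivAt (fun t => -log (1 - z * t))
      (z * ((t * (1 - t) / (1 - z * t)) ^ 0 / (1 - z * t))) t := fun t ht => by
    have h := ((((hasDerivAt_id t).const_mul z).const_sub 1).log (one_sub_mul_pos hz ht).ne').neg
    refine h.congr_deriv ?_
    simp only [pow_zero, id]
    ring
  rw [eulerIntegral, ← intervalIntegral.integral_const_mul,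
    intervalIntegral.integral_eq_sub_of_hasDerivAt hderiv
      ((intervalIntegrable_eulerIntegrand hz 0).const_mul z)]
  simp

theorem hasDerivAt_eulerPrimitive {z t : ℝ} (h : 1 - z * t ≠ 0) :
    HasDerivAt (fun t => (1 - 2 * t + z * t ^ 2) / (1 - z * t))
      (z ^ 2 * ((t * (1 - t) / (1 - z * t)) ^ 1 / (1 - z * t))
        - (2 - z) * ((t * (1 - t) / (1 - z * t)) ^ 0 / (1 - z * t))) t := by
  have h1 : HasDerivAt (fun t => 1 - 2 * t + z * t ^ 2) (-2 + z * (2 * t)) t := by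
    refine ((((hasDerivAt_id t).const_mul 2).const_sub 1).add
      (((hasDerivAt_id t).pow 2).const_mul z)).congr_deriv ?_
    simp
  have h2 : HasDerivAt (fun t => 1 - z * t) (-z) t := by
    simpa using ((hasDerivAt_id t).const_mul z).const_sub 1
  refine (h1.div h2 h).congr_deriv ?_
  field_simp
  ring

theorem eulerIntegral_one {z : ℝ} (hz : z < 1) :
    z ^ 2 * eulerIntegral z 1 = (2 - z) * eulerIntegral z 0 - 2 := by
  have hint := fun (k : ℕ) (a : ℝ) => (intervalIntegrable_eulerIntegrand hz k).const_mul a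
  have key := intervalIntegral.integral_eq_sub_of_hasDerivAt (a := 0) (b := 1)
    (fun t ht => hasDerivAt_eulerPrimitive (one_sub_mul_pos hz ht).ne')
    ((hint _ _).sub (hint _ _))
  rw [intervalIntegral.integral_sub (hint _ _) (hint _ _)] at key
  simp only [intervalIntegral.integral_const_mul] at key
  have h1 : (1 - 2 * 1 + z * 1 ^ 2) / (1 - z * 1) = -1 := by
    rw [div_eq_iff (by linarith)]; ring
  rw [h1] at key
  simp only [eulerIntegral]
  norm_num at key ⊢
  linarith

theorem eulerIntegral_succ_succ {z : ℝ} (hz : z < 1) (n : ℕ) :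
    ((n : ℝ) + 2) * z ^ 2 * eulerIntegral z (n + 2) =
      (2 * n + 3) * (2 - z) * eulerIntegral z (n + 1) - (n + 1) * eulerIntegral z n := by
  have hint := fun (k : ℕ) (a : ℝ) => (intervalIntegrable_eulerIntegrand hz k).const_mul a
  have hderiv : ∀ t ∈ Set.uIcc (0 : ℝ) 1, HasDerivAt
      (fun t => (t * (1 - t) / (1 - z * t)) ^ (n + 1) * ((1 - 2 * t + z * t ^ 2) / (1 - z * t)))
      ((n + 2) * z ^ 2 * ((t * (1 - t) / (1 - z * t)) ^ (n + 2) / (1 - z * t))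
        - (2 * n + 3) * (2 - z) * ((t * (1 - t) / (1 - z * t)) ^ (n + 1) / (1 - z * t))
        + (n + 1) * ((t * (1 - t) / (1 - z * t)) ^ n / (1 - z * t))) t := fun t ht => by
    have h0 := (one_sub_mul_pos hz ht).ne'
    have h1 : HasDerivAt (fun t => t * (1 - t)) (1 - 2 * t) t := by
      refine ((hasDerivAt_id t).mul ((hasDerivAt_id t).const_sub 1)).congr_deriv ?_
      simp only [id]
      ring
    have h2 : HasDerivAt (fun t => 1 - z * t) (-z) t := by
      simpa using ((hasDerivAt_id t).const_mul z).const_sub 1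
    refine (((h1.div h2 h0).pow (n + 1)).mul (hasDerivAt_eulerPrimitive h0)).congr_deriv ?_
    simp only [Pi.pow_apply, Pi.div_apply, Nat.cast_add, Nat.cast_one, Nat.add_sub_cancel]
    have hsplit : ∀ k : ℕ, (t * (1 - t) / (1 - z * t)) ^ (n + k) =
        (t * (1 - t) / (1 - z * t)) ^ n * (t * (1 - t) / (1 - z * t)) ^ k := fun k => pow_add _ _ _
    rw [hsplit 1, hsplit 2]
    generalize (t * (1 - t) / (1 - z * t)) ^ n = G
    field_simp
    ring
  have key := intervalIntegral.integral_eq_sub_of_hasDerivAt hderiv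
    (((hint _ _).sub (hint _ _)).add (hint _ _))
  rw [intervalIntegral.integral_add ((hint _ _).sub (hint _ _)) (hint _ _),
    intervalIntegral.integral_sub (hint _ _) (hint _ _)] at key
  simp only [intervalIntegral.integral_const_mul] at key
  simp only [eulerIntegral]
  norm_num at key ⊢
  linarith

theorem abs_eulerIntegral_le {s : ℝ} (hs : 0 < s) (n : ℕ) :
    |eulerIntegral (1 - s ^ 2) n| ≤ eulerIntegral (1 - s ^ 2) 0 * (1 / (1 + s) ^ 2) ^ n := by
  have hz : 1 - s ^ 2 < 1 := by nlinarith
  rw [eulerIntegral, eulerIntegral, ← intervalIntegral.integral_mul_const, ← Real.norm_eq_abs]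
  refine intervalIntegral.norm_integral_le_of_norm_le zero_le_one (.of_forall fun t ht => ?_)
    ((intervalIntegrable_eulerIntegrand hz 0).mul_const _)
  have h0 : 0 < 1 - (1 - s ^ 2) * t := one_sub_mul_pos hz
    (by rw [Set.uIcc_of_le zero_le_one]; exact ⟨ht.1.le, ht.2⟩)
  have h1 : 0 ≤ t * (1 - t) / (1 - (1 - s ^ 2) * t) :=
    div_nonneg (mul_nonneg ht.1.le (by linarith [ht.2])) h0.le
  have h2 : t * (1 - t) / (1 - (1 - s ^ 2) * t) ≤ 1 / (1 + s) ^ 2 := by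
    rw [div_le_div_iff₀ h0 (by positivity)]
    nlinarith [sq_nonneg ((1 + s) * t - 1)]
  rw [Real.norm_of_nonneg (by positivity), pow_zero, div_mul_eq_mul_div, one_mul]
  gcongr

theorem tendsto_sqrt_mul_integral_one_sub_cos_pow {b : ℝ} (hb : 0 < b) (hb' : b ≤ 1 / 2) :
    Tendsto (fun n : ℕ => √n * ∫ φ in (0 : ℝ)..π, (1 - b * (1 - cos φ)) ^ n) atTop
      (nhds (√(π / (b / 2)) / 2)) := by
  have hscale : ∀ᶠ n : ℕ in atTop, (∫ t in Set.Ioi (0 : ℝ),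
      (Set.Ioc 0 (π * √n)).indicator (fun t => (1 - b * (1 - cos (t / √n))) ^ n) t) =
      √n * ∫ φ in (0 : ℝ)..π, (1 - b * (1 - cos φ)) ^ n := by
    filter_upwards [eventually_gt_atTop 0] with n hn
    have hn' : 0 < √(n : ℝ) := by positivity
    have h := intervalIntegral.integral_comp_div (a := 0) (b := π * √n)
      (fun φ => (1 - b * (1 - cos φ)) ^ n) hn'.ne'
    rw [zero_div, mul_div_cancel_right₀ _ hn'.ne', smul_eq_mul] at h
    rw [← h, MeasureTheory.setIntegral_indicator measurableSet_Ioc,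
      intervalIntegral.integral_of_le (by positivity),
      Set.inter_eq_right.mpr Set.Ioc_subset_Ioi_self]
  refine Tendsto.congr' hscale ?_
  rw [← integral_gaussian_Ioi]
  refine MeasureTheory.tendsto_integral_of_dominated_convergence
    (fun t => exp (-(b * (2 / π ^ 2)) * t ^ 2)) (fun n => ?_)
    (integrable_exp_neg_mul_sq (by positivity)).integrableOn (fun n => ?_) ?_
  · refine (Measurable.indicator ?_ measurableSet_Ioc).aestronglyMeasurable
    fun_prop
  · refine .of_forall fun t => ?_
    by_cases ht : t ∈ Set.Ioc 0 (π * √n)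
    · rw [Set.indicator_of_mem ht]
      have hn : 0 < √(n : ℝ) := pos_of_mul_pos_right (ht.1.trans_le ht.2) pi_pos.le
      have hle : |t / √n| ≤ π := by
        rw [abs_of_pos (div_pos ht.1 hn), div_le_iff₀ hn]
        exact ht.2
      have h0 : 0 ≤ 1 - b * (1 - cos (t / √n)) := by nlinarith [neg_one_le_cos (t / √n)]
      have h1 := cos_le_one_sub_mul_cos_sq hle
      rw [Real.norm_of_nonneg (pow_nonneg h0 n)]
      have h2 : 1 - b * (1 - cos (t / √n)) ≤ exp (-(b * (2 / π ^ 2)) * (t / √n) ^ 2) := by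
        refine le_trans ?_ (add_one_le_exp _)
        nlinarith
      refine (pow_le_pow_left₀ h0 h2 n).trans_eq ?_
      rw [← exp_nat_mul, div_pow, sq_sqrt n.cast_nonneg]
      have hn0 : (n : ℝ) ≠ 0 := (sqrt_pos.mp hn).ne'
      congr 1
      field_simp
    · rw [Set.indicator_of_notMem ht, norm_zero]
      positivity
  · refine (MeasureTheory.ae_restrict_iff' measurableSet_Ioi).mpr (.of_forall fun t ht => ?_)
    have hsqrt : Tendsto (fun n : ℕ => √(n : ℝ)) atTop atTop :=
      tendsto_sqrt_atTop.comp tendsto_natCast_atTop_atTop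
    have hmem : ∀ᶠ n : ℕ in atTop, (1 + -b * (1 - cos (t / √n))) ^ n =
        (Set.Ioc 0 (π * √n)).indicator (fun t => (1 - b * (1 - cos (t / √n))) ^ n) t := by
      filter_upwards [(hsqrt.const_mul_atTop pi_pos).eventually_ge_atTop t] with n hn
      rw [Set.indicator_of_mem (Set.mem_Ioc.mpr ⟨ht, hn⟩)]
      ring
    refine Tendsto.congr' hmem (tendsto_one_add_pow_exp_of_tendsto ?_)
    have hsinc : Tendsto (fun n : ℕ => -(b / 2) * t ^ 2 * sinc (t / √n / 2) ^ 2) atTop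
        (nhds (-(b / 2) * t ^ 2 * sinc (0 / 2) ^ 2)) :=
      ((((continuous_sinc.tendsto _).comp
        ((tendsto_const_nhds.div_atTop hsqrt).div_const 2)).pow 2).const_mul _)
    rw [zero_div, sinc_zero, one_pow, mul_one] at hsinc
    refine hsinc.congr' ?_
    filter_upwards [eventually_gt_atTop 0] with n hn
    have hn' : 0 < √(n : ℝ) := by positivity
    have ht' : (t : ℝ) ≠ 0 := (Set.mem_Ioi.mp ht).ne'
    have hcos : cos (t / √n) = 1 - 2 * sin (t / √n / 2) ^ 2 := by
      have h := cos_two_mul (t / √n / 2)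
      rw [mul_div_cancel₀ _ two_ne_zero, cos_sq'] at h
      linarith
    rw [sinc_of_ne_zero (by positivity), hcos]
    field_simp
    rw [sq_sqrt n.cast_nonneg]
    ring

theorem tendsto_sqrt_mul_laplaceIntegral {s : ℝ} (hs : 0 < s) :
    Tendsto (fun n : ℕ => √n * laplaceIntegral s n / ((1 + s) ^ 2) ^ n) atTop
      (nhds ((1 + s) / 2 * √(π / s))) := by
  have hb : 2 * s / (1 + s) ^ 2 ≤ 1 / 2 := by
    rw [div_le_div_iff₀ (by positivity) two_pos]
    nlinarith [sq_nonneg (1 - s)]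
  have h := tendsto_sqrt_mul_integral_one_sub_cos_pow (b := 2 * s / (1 + s) ^ 2)
    (by positivity) hb
  have hlim : √(π / (2 * s / (1 + s) ^ 2 / 2)) / 2 = (1 + s) / 2 * √(π / s) := by
    rw [show π / (2 * s / (1 + s) ^ 2 / 2) = (1 + s) ^ 2 * (π / s) by field_simp,
      sqrt_mul (by positivity), sqrt_sq (by positivity)]
    ring
  rw [hlim] at h
  refine h.congr fun n => ?_
  rw [laplaceIntegral, mul_div_assoc (√(n : ℝ)), ← intervalIntegral.integral_div]
  congr 2
  ext φ
  rw [← div_pow]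
  congr 1
  field_simp
  ring

theorem laplaceIntegral_pos {s : ℝ} (hs : 0 < s) (hs1 : s ≠ 1) (n : ℕ) :
    0 < laplaceIntegral s n := by
  refine intervalIntegral.intervalIntegral_pos_of_pos
    (Continuous.intervalIntegrable (by fun_prop) _ _) (fun φ => pow_pos ?_ n) pi_pos
  have : 0 < (1 - s) ^ 2 := by positivity [sub_ne_zero.mpr hs1.symm]
  nlinarith [neg_one_le_cos φ]

theorem wronskian_eulerIntegral_laplaceIntegral {s : ℝ} (hs : 0 < s) (n : ℕ) :
    eulerIntegral (1 - s ^ 2) n * laplaceIntegral s (n + 1)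
      - (1 - s ^ 2) ^ 2 * eulerIntegral (1 - s ^ 2) (n + 1) * laplaceIntegral s n =
      2 * π / (n + 1) := by
  have hz : 1 - s ^ 2 < 1 := by nlinarith
  induction n with
  | zero =>
    have h := eulerIntegral_one hz
    simp only [zero_add, laplaceIntegral_zero, laplaceIntegral_one, h, Nat.cast_zero]
    ring
  | succ n ih =>
    have h1 := eulerIntegral_succ_succ hz n
    have h2 := laplaceIntegral_succ_succ s n
    rw [eq_div_iff (by positivity)] at ih ⊢
    push_cast
    linear_combination ih + eulerIntegral (1 - s ^ 2) (n + 1) * h2 - laplaceIntegral s (n + 1) * h1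

theorem isLittleO_of_sub_succ {h G : ℕ → ℝ} (hh : Tendsto h atTop (nhds 0))
    (hG : Tendsto G atTop (nhds 0)) (hanti : Antitone G)
    (ho : (fun n => h n - h (n + 1)) =o[atTop] fun n => G n - G (n + 1)) : h =o[atTop] G := by
  refine isLittleO_iff.mpr fun ε hε => ?_
  obtain ⟨N, hN⟩ := eventually_atTop.mp (isLittleO_iff.mp ho hε)
  have hG0 : ∀ n, 0 ≤ G n := fun n => hanti.le_of_tendsto hG n
  have hstep : ∀ k, |h (k + N) - h (k + N + 1)| ≤ ε * (G (k + N) - G (k + N + 1)) := fun k => by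
    have := hN (k + N) (Nat.le_add_left _ _)
    rwa [Real.norm_eq_abs, Real.norm_of_nonneg (sub_nonneg.mpr (hanti (Nat.le_succ _)))] at this
  have htail : ∀ f : ℕ → ℝ, Tendsto f atTop (nhds 0) → (∀ k, f (k + N + 1) ≤ f (k + N)) →
      ∀ k, 0 ≤ f (k + N) := fun f hf hle k =>
    (antitone_nat_of_succ_le (f := fun k => f (k + N)) fun k => by
      simpa [add_right_comm] using hle k).le_of_tendsto ((tendsto_add_atTop_iff_nat N).mpr hf) k
  have h1 := htail (fun n => ε * G n - h n) (by simpa using (hG.const_mul ε).sub hh)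
    fun k => by have := abs_le.mp (hstep k); linarith
  have h2 := htail (fun n => ε * G n + h n) (by simpa using (hG.const_mul ε).add hh)
    fun k => by have := abs_le.mp (hstep k); linarith
  filter_upwards [eventually_ge_atTop N] with n hn
  obtain ⟨k, rfl⟩ := Nat.exists_eq_add_of_le' hn
  rw [Real.norm_eq_abs, Real.norm_of_nonneg (hG0 _), abs_le]
  constructor <;> linarith [h1 k, h2 k]

theorem eq_of_recurrence {z : ℝ} {u f : ℕ → ℝ}
    (hu : ∀ n : ℕ, 2 ≤ n →
      u n = (2 * (n : ℝ) - 1) * (2 - z) * u (n - 1) - ((n : ℝ) - 1) ^ 2 * z ^ 2 * u (n - 2))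
    (hf : ∀ n : ℕ, ((n : ℝ) + 2) * f (n + 2) =
      (2 * n + 3) * (2 - z) * f (n + 1) - (n + 1) * z ^ 2 * f n)
    (h0 : u 0 = f 0) (h1 : u 1 = f 1) (n : ℕ) : u n = n.factorial * f n := by
  induction n using Nat.twoStepInduction with
  | zero => simpa using h0
  | one => simpa using h1
  | more n ih ih' =>
    rw [hu (n + 2) (Nat.le_add_left _ _), Nat.add_sub_cancel, show n + 2 - 1 = n + 1 by lia, ih, ih']
    push_cast [Nat.factorial_succ]
    linear_combination (-((n : ℝ) + 1) * n.factorial) * hf n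

theorem tendsto_sqrt_mul_pow {x : ℝ} (hx0 : 0 ≤ x) (hx1 : x < 1) :
    Tendsto (fun n : ℕ => √n * x ^ n) atTop (nhds 0) := by
  refine squeeze_zero (fun n => by positivity) (fun n => ?_)
    (tendsto_self_mul_const_pow_of_lt_one hx0 hx1)
  gcongr
  rcases n.eq_zero_or_pos with rfl | hn
  · simp
  · have h1 : (1 : ℝ) ≤ n := by exact_mod_cast hn
    exact sqrt_le_iff.mpr ⟨by positivity, by nlinarith⟩

theorem tendsto_eulerIntegral_div_laplaceIntegral {s : ℝ} (hs : 0 < s) (hs1 : s ≠ 1) :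
    Tendsto (fun n : ℕ => π * ((1 - s ^ 2) ^ (2 * n + 1) * eulerIntegral (1 - s ^ 2) n) /
      laplaceIntegral s n) atTop (nhds 0) := by
  have hx1 : ((1 - s) / (1 + s)) ^ 2 < 1 := by
    rw [div_pow, div_lt_one (by positivity)]
    nlinarith
  have hlim := ((tendsto_sqrt_mul_pow (sq_nonneg _) hx1).div (tendsto_sqrt_mul_laplaceIntegral hs)
    (by positivity)).const_mul (π * |1 - s ^ 2| * eulerIntegral (1 - s ^ 2) 0)
  rw [zero_div, mul_zero] at hlim
  refine squeeze_zero_norm' ?_ hlim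
  filter_upwards [eventually_gt_atTop 0] with n hn
  have hV := laplaceIntegral_pos hs hs1 n
  have hn' : 0 < √(n : ℝ) := by positivity
  have hpow : |1 - s ^ 2| ^ (2 * n + 1) =
      |1 - s ^ 2| * (((1 - s) / (1 + s)) ^ 2) ^ n * ((1 + s) ^ 2) ^ n * ((1 + s) ^ 2) ^ n := by
    rw [pow_succ', pow_mul, sq_abs, mul_assoc, mul_assoc, ← mul_pow, ← mul_pow]
    congr 2
    field_simp
    ring
  rw [norm_div, norm_mul, norm_mul, norm_pow, Real.norm_of_nonneg pi_pos.le,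
    Real.norm_of_nonneg hV.le, Real.norm_eq_abs, Real.norm_eq_abs, hpow, div_le_iff₀ hV]
  refine (mul_le_mul_of_nonneg_left (mul_le_mul_of_nonneg_left (abs_eulerIntegral_le hs n)
    (by positivity)) pi_pos.le).trans_eq ?_
  simp only [Pi.div_apply, one_div, inv_pow]
  field_simp

theorem eulerIntegral_div_laplaceIntegral_sub_succ {s : ℝ} (hs : 0 < s) (hs1 : s ≠ 1) {n : ℕ}
    (hn : 0 < n) :
    π * ((1 - s ^ 2) ^ (2 * n + 1) * eulerIntegral (1 - s ^ 2) n) / laplaceIntegral s n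
      - π * ((1 - s ^ 2) ^ (2 * (n + 1) + 1) * eulerIntegral (1 - s ^ 2) (n + 1)) /
        laplaceIntegral s (n + 1) =
    (((1 - s) / (1 + s)) ^ 2) ^ n * (2 * π ^ 2 * ((1 - s) / (1 + s)) * √(n / (n + 1)) /
      ((√n * laplaceIntegral s n / ((1 + s) ^ 2) ^ n) *
        (√(n + 1 : ℕ) * laplaceIntegral s (n + 1) / ((1 + s) ^ 2) ^ (n + 1)))) := by
  have hV := laplaceIntegral_pos hs hs1 n
  have hV' := laplaceIntegral_pos hs hs1 (n + 1)
  have hn' : 0 < √(n : ℝ) := by positivity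
  have hn1 : 0 < √((n : ℝ) + 1) := by positivity
  have hW := wronskian_eulerIntegral_laplaceIntegral hs n
  have hsq : √((n : ℝ) + 1) ^ 2 = n + 1 := sq_sqrt (by positivity)
  have h1 : π * ((1 - s ^ 2) ^ (2 * n + 1) * eulerIntegral (1 - s ^ 2) n) / laplaceIntegral s n
      - π * ((1 - s ^ 2) ^ (2 * (n + 1) + 1) * eulerIntegral (1 - s ^ 2) (n + 1)) /
        laplaceIntegral s (n + 1) =
      π * (1 - s ^ 2) ^ (2 * n + 1) * (2 * π / (n + 1)) /
        (laplaceIntegral s n * laplaceIntegral s (n + 1)) := by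
    rw [← hW]
    field_simp
    ring
  have hpow : (1 - s ^ 2) ^ (2 * n + 1) = ((1 - s) ^ 2) ^ n * (1 - s) * ((1 + s) ^ 2) ^ n *
      (1 + s) := by
    rw [pow_succ, pow_mul, show (1 - s ^ 2) ^ 2 = (1 - s) ^ 2 * (1 + s) ^ 2 by ring, mul_pow]
    ring
  rw [h1, hpow, sqrt_div n.cast_nonneg, div_pow, div_pow, Nat.cast_succ, ← hsq, pow_succ _ n]
  rw [sqrt_sq hn1.le]
  field_simp

theorem isEquivalent_eulerIntegral_div_laplaceIntegral {s : ℝ} (hs : 0 < s) (hs1 : s ≠ 1) :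
    (fun n : ℕ => π * ((1 - s ^ 2) ^ (2 * n + 1) * eulerIntegral (1 - s ^ 2) n) /
      laplaceIntegral s n) ~[atTop] fun n => 2 * π / ((1 + s) / (1 - s)) ^ (2 * n + 1) := by
  set x : ℝ := ((1 - s) / (1 + s)) ^ 2 with hx
  have hs1' : 1 - s ≠ 0 := sub_ne_zero.mpr hs1.symm
  have hx0 : 0 ≤ x := sq_nonneg _
  have hx' : 1 - x = 4 * s / (1 + s) ^ 2 := by
    rw [hx]
    field_simp
    ring
  have hx1 : x < 1 := by
    have : 0 < 4 * s / (1 + s) ^ 2 := by positivity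
    linarith
  have hg : (fun n : ℕ => 2 * π / ((1 + s) / (1 - s)) ^ (2 * n + 1)) =
      fun n => 2 * π * ((1 - s) / (1 + s)) * x ^ n := by
    ext n
    rw [div_eq_mul_inv, ← inv_pow, inv_div, pow_succ, pow_mul]
    ring
  have hxlim := tendsto_pow_atTop_nhds_zero_of_lt_one hx0 hx1
  have ha := tendsto_sqrt_mul_laplaceIntegral hs
  have hδ := ((((continuous_sqrt.tendsto 1).comp (tendsto_natCast_div_add_atTop (1 : ℝ))).const_mul
    (2 * π ^ 2 * ((1 - s) / (1 + s)))).div (ha.mul (ha.comp (tendsto_add_atTop_nat 1)))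
      (by positivity)).sub_const (2 * π * ((1 - s) / (1 + s)) * (1 - x))
  have hK : ((1 + s) / 2 * √(π / s)) * ((1 + s) / 2 * √(π / s)) = (1 + s) ^ 2 / 4 * (π / s) := by
    rw [mul_mul_mul_comm, mul_self_sqrt (by positivity)]
    ring
  have hzero : 2 * π ^ 2 * ((1 - s) / (1 + s)) * √1 /
      (((1 + s) / 2 * √(π / s)) * ((1 + s) / 2 * √(π / s)))
      - 2 * π * ((1 - s) / (1 + s)) * (1 - x) = 0 := by
    rw [hK, hx', sqrt_one]
    field_simp
    ring
  rw [hzero] at hδ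
  rw [hg]
  refine (isLittleO_of_sub_succ ?_ hxlim (pow_right_anti₀ hx0 hx1.le) ?_).trans_isBigO
    ((isBigO_refl _ _).const_mul_right (by positivity))
  · simpa [Pi.sub_def] using (tendsto_eulerIntegral_div_laplaceIntegral hs hs1).sub
      (hxlim.const_mul (2 * π * ((1 - s) / (1 + s))))
  · refine ((isBigO_refl (fun n : ℕ => x ^ n) atTop).mul_isLittleO
      ((isLittleO_const_iff (sub_pos.mpr hx1).ne').mpr hδ)).congr' ?_ (.of_forall fun n => by ring)
    filter_upwards [eventually_gt_atTop 0] with n hn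
    have h := eulerIntegral_div_laplaceIntegral_sub_succ hs hs1 hn
    simp only [Pi.sub_apply, Pi.div_apply, Function.comp_apply]
    rw [mul_sub, ← h]
    ring

/-- The continued fraction `[[0,(2n-1)(2-z)],[2z,-n²z²]]` converges to `-log(1-z)`,
with speed `2π/((1+√(1-z))²/z)^(2n+1)`. -/
theorem continuous_tiny_apery (z : ℝ) (hz1 : z < 1) (hz0 : z ≠ 0)
    (p q : ℕ → ℝ)
    (hp : ∀ n : ℕ, 2 ≤ n →
      p n = (2 * (n : ℝ) - 1) * (2 - z) * p (n - 1) - ((n : ℝ) - 1) ^ 2 * z ^ 2 * p (n - 2))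
    (hq : ∀ n : ℕ, 2 ≤ n →
      q n = (2 * (n : ℝ) - 1) * (2 - z) * q (n - 1) - ((n : ℝ) - 1) ^ 2 * z ^ 2 * q (n - 2))
    (hp0 : p 0 = 0) (hp1 : p 1 = 2 * z) (hq0 : q 0 = 1) (hq1 : q 1 = 2 - z) :
    (∀ᶠ n in atTop, q n ≠ 0) ∧
    Tendsto (fun n => p n / q n) atTop (nhds (-Real.log (1 - z))) ∧
    (fun n : ℕ => -Real.log (1 - z) - p n / q n) ~[atTop]
      (fun n : ℕ => 2 * π / ((1 + Real.sqrt (1 - z)) ^ 2 / z) ^ (2 * n + 1)) := by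
  obtain ⟨s, hs, rfl⟩ : ∃ s : ℝ, 0 < s ∧ z = 1 - s ^ 2 :=
    ⟨√(1 - z), sqrt_pos.mpr (by linarith), by rw [sq_sqrt (by linarith)]; ring⟩
  have hs1 : s ≠ 1 := by
    rintro rfl
    norm_num at hz0
  have hs1' : 1 - s ≠ 0 := sub_ne_zero.mpr hs1.symm
  have hsqrt : √(1 - (1 - s ^ 2)) = s := by rw [sub_sub_cancel, sqrt_sq hs.le]
  have hρ : (1 + √(1 - (1 - s ^ 2))) ^ 2 / (1 - s ^ 2) = (1 + s) / (1 - s) := by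
    rw [hsqrt, show 1 - s ^ 2 = (1 + s) * (1 - s) by ring]
    field_simp
  set L := -log (1 - (1 - s ^ 2)) with hL
  have hJ0 : (1 - s ^ 2) * eulerIntegral (1 - s ^ 2) 0 = L := eulerIntegral_zero hz1
  have hV0 := laplaceIntegral_zero s
  have hV1 := laplaceIntegral_one s
  have hV := laplaceIntegral_succ_succ s
  have hqV : ∀ n, q n = n.factorial * (laplaceIntegral s n / π) := by
    refine eq_of_recurrence hq (fun n => ?_) ?_ ?_
    · linear_combination (1 / π) * hV n
    · rw [hq0, hV0, div_self pi_ne_zero]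
    · rw [hq1, hV1, mul_div_cancel_right₀ _ pi_ne_zero]
      ring
  have hpV : ∀ n, p n = n.factorial * (L * (laplaceIntegral s n / π)
      - (1 - s ^ 2) ^ (2 * n + 1) * eulerIntegral (1 - s ^ 2) n) := by
    refine eq_of_recurrence hp (fun n => ?_) ?_ ?_
    · have hJ := eulerIntegral_succ_succ hz1 n
      linear_combination (L / π) * hV n - (1 - s ^ 2) ^ (2 * n + 3) * hJ
    · rw [hp0, hV0, div_self pi_ne_zero]
      linear_combination hJ0
    · have hJ := eulerIntegral_one hz1
      rw [hp1, hV1, mul_div_cancel_right₀ _ pi_ne_zero]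
      linear_combination (1 - s ^ 2) * hJ + (1 + s ^ 2) * hJ0
  have hq_ne : ∀ n, q n ≠ 0 := fun n => by
    have := laplaceIntegral_pos hs hs1 n
    rw [hqV]
    positivity
  have herr : ∀ n, π * ((1 - s ^ 2) ^ (2 * n + 1) * eulerIntegral (1 - s ^ 2) n) /
      laplaceIntegral s n = L - p n / q n := fun n => by
    have hVn := (laplaceIntegral_pos hs hs1 n).ne'
    have hfac : (n.factorial : ℝ) ≠ 0 := by positivity
    rw [hpV, hqV, mul_div_mul_left _ _ hfac]
    field_simp
    ring
  refine ⟨.of_forall hq_ne, ?_, ?_⟩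
  · have h := (tendsto_eulerIntegral_div_laplaceIntegral hs hs1).const_sub L
    simpa only [herr, sub_sub_cancel, sub_zero] using h
  · rw [hρ]
    simpa only [herr] using isEquivalent_eulerIntegral_div_laplaceIntegral hs hs1
end

section
/- Let z be a real number with z < 1 and z ≠ 0, and define the complete elliptic integrals K(z) = ∫₀^{π/2} (1 - z·sin²θ)^{-1/2} dθ and E(z) = ∫₀^{π/2} (1 - z·sin²θ)^{1/2} dθ. Let p, q : ℕ → ℝ both satisfy the recurrence u(n) = 4n(2-z)·u(n-1) - (2n-1)²z²·u(n-2) for all n ≥ 2, with initial values p(0) = 2-z, p(1) = 4(2-z)² - z², q(0) = 1, q(1) = 4(2-z). Then for all sufficiently large n, q(n) ≠ 0, and the sequence p(n)/q(n) converges to 2·E(z)/K(z). -/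
open Filter Real intervalIntegral

lemma one_sub_mul_sin_sq_pos {z : ℝ} (hz : z < 1) (θ : ℝ) : 0 < 1 - z * Real.sin θ ^ 2 := by
  rcases (sq_nonneg (Real.sin θ)).eq_or_lt with h | h
  · rw [← h]; norm_num
  · nlinarith [Real.sin_sq_le_one θ]

/-- The Fourier cosine integral `∫₀^{π/2} cos (2nθ) (1 - z sin²θ)^{-1/2} dθ`, which for `n = 0` is
the complete elliptic integral of the first kind. -/
noncomputable def ellipticCos (z : ℝ) (n : ℕ) : ℝ :=
  ∫ θ in (0 : ℝ)..(π / 2), Real.cos (2 * n * θ) / √(1 - z * Real.sin θ ^ 2)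

lemma continuous_cos_div_sqrt {z : ℝ} (hz : z < 1) (a : ℝ) :
    Continuous fun θ : ℝ => Real.cos (a * θ) / √(1 - z * Real.sin θ ^ 2) :=
  Continuous.div (by fun_prop) (by fun_prop)
    fun θ => (Real.sqrt_pos.2 (one_sub_mul_sin_sq_pos hz θ)).ne'

lemma hasDerivAt_sin_mul_sqrt {z : ℝ} (hz : z < 1) (n : ℕ) (θ : ℝ) :
    HasDerivAt (fun θ : ℝ => 4 * (Real.sin (2 * (n + 1) * θ) * √(1 - z * Real.sin θ ^ 2)))
      (z * (2 * n + 3) * (Real.cos (2 * (n + 2 : ℕ) * θ) / √(1 - z * Real.sin θ ^ 2))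
        + 4 * (n + 1) * (2 - z) * (Real.cos (2 * (n + 1 : ℕ) * θ) / √(1 - z * Real.sin θ ^ 2))
        + z * (2 * n + 1) * (Real.cos (2 * n * θ) / √(1 - z * Real.sin θ ^ 2))) θ := by
  have hW := one_sub_mul_sin_sq_pos hz θ
  have hs := Real.sqrt_pos.2 hW
  have h1 : HasDerivAt (fun θ : ℝ => 1 - z * Real.sin θ ^ 2)
      (-(2 * z * Real.sin θ * Real.cos θ)) θ := by
    have := (((Real.hasDerivAt_sin θ).pow 2).const_mul z).const_sub 1
    exact this.congr_deriv (by push_cast; ring)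
  have h2 : HasDerivAt (fun θ : ℝ => Real.sin (2 * (n + 1) * θ))
      (Real.cos (2 * (n + 1) * θ) * (2 * (n + 1))) θ := by
    have := ((hasDerivAt_id θ).const_mul (2 * ((n : ℝ) + 1))).sin
    simpa using this
  refine ((h2.mul (h1.sqrt hW.ne')).const_mul 4).congr_deriv ?_
  have e1 : Real.cos (2 * (n + 2 : ℕ) * θ) = Real.cos (2 * (n + 1) * θ + 2 * θ) := by
    congr 1; push_cast; ring
  have e2 : Real.cos (2 * n * θ) = Real.cos (2 * (n + 1) * θ - 2 * θ) := by
    congr 1; ring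
  have e3 : Real.cos (2 * (n + 1 : ℕ) * θ) = Real.cos (2 * (n + 1) * θ) := by
    push_cast; rfl
  rw [e1, e2, e3, Real.cos_add, Real.cos_sub, Real.cos_two_mul, Real.sin_two_mul]
  generalize Real.cos (2 * (n + 1) * θ) = c
  generalize Real.sin (2 * (n + 1) * θ) = s
  have hsq := Real.sq_sqrt hW.le
  generalize √(1 - z * Real.sin θ ^ 2) = r at *
  have hcs := Real.sin_sq_add_cos_sq θ
  field_simp
  rw [hsq]
  linear_combination (-8 * c * z * (n + 1)) * hcs

lemma ellipticCos_recurrence {z : ℝ} (hz : z < 1) (n : ℕ) :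
    z * (2 * n + 3) * ellipticCos z (n + 2) + 4 * (n + 1) * (2 - z) * ellipticCos z (n + 1)
      + z * (2 * n + 1) * ellipticCos z n = 0 := by
  have hI (a c : ℝ) : IntervalIntegrable
      (fun θ : ℝ => c * (Real.cos (a * θ) / √(1 - z * Real.sin θ ^ 2)))
      MeasureTheory.volume 0 (π / 2) :=
    ((continuous_cos_div_sqrt hz a).const_mul c).intervalIntegrable _ _
  have key := integral_eq_sub_of_hasDerivAt
    (fun θ (_ : θ ∈ Set.uIcc 0 (π / 2)) => hasDerivAt_sin_mul_sqrt hz n θ)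
    (((hI _ _).add (hI _ _)).add (hI _ _))
  rw [integral_add ((hI _ _).add (hI _ _)) (hI _ _), integral_add (hI _ _) (hI _ _),
    integral_const_mul, integral_const_mul, integral_const_mul] at key
  have hsin : Real.sin (2 * ((n : ℝ) + 1) * (π / 2)) = 0 := by
    have := Real.sin_nat_mul_pi (n + 1)
    rw [← this]; congr 1; push_cast; ring
  simp only [hsin, mul_zero, zero_mul, Real.sin_zero, sub_zero] at key
  exact key

lemma integral_rpow_neg_half_eq_ellipticCos {z : ℝ} (hz : z < 1) :
    ∫ θ in (0 : ℝ)..(π / 2), (1 - z * Real.sin θ ^ 2) ^ (-(1 : ℝ) / 2) = ellipticCos z 0 := by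
  refine integral_congr fun θ _ => ?_
  have hW := one_sub_mul_sin_sq_pos hz θ
  simp [neg_div, Real.rpow_neg hW.le, Real.sqrt_eq_rpow]

lemma two_mul_integral_rpow_half_eq {z : ℝ} (hz : z < 1) :
    2 * ∫ θ in (0 : ℝ)..(π / 2), (1 - z * Real.sin θ ^ 2) ^ ((1 : ℝ) / 2)
      = (2 - z) * ellipticCos z 0 + z * ellipticCos z 1 := by
  have hI (a c : ℝ) : IntervalIntegrable
      (fun θ : ℝ => c * (Real.cos (a * θ) / √(1 - z * Real.sin θ ^ 2)))
      MeasureTheory.volume 0 (π / 2) :=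
    ((continuous_cos_div_sqrt hz a).const_mul c).intervalIntegrable _ _
  rw [ellipticCos, ellipticCos, ← integral_const_mul, ← integral_const_mul, ← integral_const_mul,
    ← integral_add (hI _ _) (hI _ _)]
  refine integral_congr fun θ _ => ?_
  have hW := one_sub_mul_sin_sq_pos hz θ
  have hs := Real.sqrt_pos.2 hW
  have hsq := Real.sq_sqrt hW.le
  simp only [← Real.sqrt_eq_rpow, Nat.cast_zero, Nat.cast_one, mul_zero, zero_mul, Real.cos_zero,
    mul_one, Real.cos_two_mul]
  generalize √(1 - z * Real.sin θ ^ 2) = r at *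
  field_simp
  rw [hsq]
  linear_combination (-2 * z) * Real.sin_sq_add_cos_sq θ

lemma ellipticCos_zero_pos {z : ℝ} (hz : z < 1) : 0 < ellipticCos z 0 := by
  refine intervalIntegral_pos_of_pos
    ((continuous_cos_div_sqrt hz _).intervalIntegrable _ _) (fun θ => ?_) (by positivity)
  have hs := Real.sqrt_pos.2 (one_sub_mul_sin_sq_pos hz θ)
  simpa using hs

lemma abs_ellipticCos_le {z : ℝ} (hz : z < 1) (n : ℕ) : |ellipticCos z n| ≤ ellipticCos z 0 := by
  refine (abs_integral_le_integral_abs (by positivity)).trans ?_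
  refine integral_mono_on (by positivity)
    ((continuous_cos_div_sqrt hz _).abs.intervalIntegrable _ _)
    ((continuous_cos_div_sqrt hz _).intervalIntegrable _ _) fun θ _ => ?_
  rw [abs_div, abs_of_nonneg (Real.sqrt_nonneg _)]
  gcongr
  simpa using Real.abs_cos_le_one _

lemma eq_of_recurrence_s18 {a b : ℕ → ℝ} {u v : ℕ → ℝ}
    (hu : ∀ n, u (n + 2) = a n * u (n + 1) + b n * u n)
    (hv : ∀ n, v (n + 2) = a n * v (n + 1) + b n * v n)
    (h0 : u 0 = v 0) (h1 : u 1 = v 1) (n : ℕ) : u n = v n := by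
  induction n using Nat.twoStepInduction with
  | zero => exact h0
  | one => exact h1
  | more n ih1 ih2 => rw [hu, hv, ih1, ih2]

/-- The continued fraction `[[2-z,4n(2-z)],[-(2n+1)²z²]]` converges to `2E(z)/K(z)`,
where `K(z) = ∫₀^{π/2} (1-z·sin²θ)^{-1/2} dθ` and `E(z) = ∫₀^{π/2} (1-z·sin²θ)^{1/2} dθ`
are the complete elliptic integrals in the parameter `z`. -/
theorem continuous_half_shift_tiny_apery (z : ℝ) (hz1 : z < 1) (hz0 : z ≠ 0)
    (K E : ℝ)
    (hK : K = ∫ θ in (0 : ℝ)..(π / 2), (1 - z * Real.sin θ ^ 2) ^ (-(1 : ℝ) / 2))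
    (hE : E = ∫ θ in (0 : ℝ)..(π / 2), (1 - z * Real.sin θ ^ 2) ^ ((1 : ℝ) / 2))
    (p q : ℕ → ℝ)
    (hp : ∀ n : ℕ, 2 ≤ n →
      p n = 4 * (n : ℝ) * (2 - z) * p (n - 1) - (2 * (n : ℝ) - 1) ^ 2 * z ^ 2 * p (n - 2))
    (hq : ∀ n : ℕ, 2 ≤ n →
      q n = 4 * (n : ℝ) * (2 - z) * q (n - 1) - (2 * (n : ℝ) - 1) ^ 2 * z ^ 2 * q (n - 2))
    (hp0 : p 0 = 2 - z) (hp1 : p 1 = 4 * (2 - z) ^ 2 - z ^ 2)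
    (hq0 : q 0 = 1) (hq1 : q 1 = 4 * (2 - z)) :
    (∀ᶠ n in atTop, q n ≠ 0) ∧
    Tendsto (fun n => p n / q n) atTop (nhds (2 * E / K)) := by
  have hp' (n : ℕ) : p (n + 2) = 4 * ((n : ℝ) + 2) * (2 - z) * p (n + 1)
      + -((2 * (n : ℝ) + 3) ^ 2 * z ^ 2) * p n := by
    have := hp (n + 2) (by omega)
    simp only [Nat.add_sub_cancel, show n + 2 - 1 = n + 1 from rfl] at this
    rw [this]; push_cast; ring
  have hq' (n : ℕ) : q (n + 2) = 4 * ((n : ℝ) + 2) * (2 - z) * q (n + 1)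
      + -((2 * (n : ℝ) + 3) ^ 2 * z ^ 2) * q n := by
    have := hq (n + 2) (by omega)
    simp only [Nat.add_sub_cancel, show n + 2 - 1 = n + 1 from rfl] at this
    rw [this]; push_cast; ring
  have hKI : K = ellipticCos z 0 := hK.trans (integral_rpow_neg_half_eq_ellipticCos hz1)
  have hEI : 2 * E = (2 - z) * ellipticCos z 0 + z * ellipticCos z 1 :=
    hE ▸ two_mul_integral_rpow_half_eq hz1
  have hKpos : 0 < K := hKI ▸ ellipticCos_zero_pos hz1
  set d : ℕ → ℝ := fun n => ∏ k ∈ Finset.range n, (2 * (k : ℝ) + 3) with hd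
  have hdpos (n : ℕ) : 0 < d n := Finset.prod_pos fun k _ => by positivity
  have hds (n : ℕ) : d (n + 1) = d n * (2 * (n : ℝ) + 3) := Finset.prod_range_succ _ _
  have hd0 : d 0 = 1 := Finset.prod_range_zero _
  have hw : 0 < 2 - z := by linarith
  have hq_growth (n : ℕ) : 0 < q n ∧ (2 * (n : ℝ) + 3) * (2 - z) * q n ≤ q (n + 1) := by
    induction n with
    | zero => rw [zero_add, hq0, hq1]; norm_num; linarith
    | succ n ih =>
      obtain ⟨hpos, hle⟩ := ih
      have hpos' : 0 < q (n + 1) := lt_of_lt_of_le (by positivity) hle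
      refine ⟨hpos', ?_⟩
      rw [hq']
      push_cast
      have h1 : (2 * (n : ℝ) + 3) ^ 2 * z ^ 2 * q n ≤ (2 * (n : ℝ) + 3) ^ 2 * (2 - z) ^ 2 * q n := by
        gcongr ?_ * ?_ * _
        nlinarith
      have h2 := mul_le_mul_of_nonneg_left hle
        (show (0 : ℝ) ≤ (2 * (n : ℝ) + 3) * (2 - z) by positivity)
      linarith
  have hq_lower (n : ℕ) : d n * (2 - z) ^ n ≤ q n := by
    induction n with
    | zero => simp [hd0, hq0]
    | succ n ih =>
      refine le_trans ?_ (hq_growth n).2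
      rw [hds, pow_succ]
      have := mul_le_mul_of_nonneg_left ih
        (show (0 : ℝ) ≤ (2 * (n : ℝ) + 3) * (2 - z) by positivity)
      linarith
  have herr (n : ℕ) :
      K * p n - 2 * E * q n = (-z) ^ (n + 1) * d n * ellipticCos z (n + 1) := by
    refine eq_of_recurrence_s18 (a := fun n => 4 * ((n : ℝ) + 2) * (2 - z))
      (b := fun n => -((2 * (n : ℝ) + 3) ^ 2 * z ^ 2))
      (u := fun n => K * p n - 2 * E * q n)
      (v := fun n => (-z) ^ (n + 1) * d n * ellipticCos z (n + 1)) ?_ ?_ ?_ ?_ n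
    · intro n
      simp only [hp', hq']
      ring
    · intro n
      have hrec := ellipticCos_recurrence hz1 (n + 1)
      have e : d (n + 2) = d n * (2 * (n : ℝ) + 3) * (2 * (n : ℝ) + 5) := by
        rw [hds, hds]; push_cast; ring
      simp only [e, hds]
      push_cast at hrec
      linear_combination (-(-z) ^ (n + 2) * d n * (2 * (n : ℝ) + 3)) * hrec
    · simp only [hp0, hq0, hd0, hEI, hKI]
      ring
    · have hrec := ellipticCos_recurrence hz1 0
      simp only [hp1, hq1, hds, hd0, hEI, hKI]
      push_cast at hrec ⊢
      linear_combination (-z) * hrec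
  refine ⟨Eventually.of_forall fun n => (hq_growth n).1.ne', ?_⟩
  have hlim : Tendsto (fun n : ℕ => |z| * (|z| / (2 - z)) ^ n) atTop (nhds 0) := by
    have hlt : |z| / (2 - z) < 1 := by
      rw [div_lt_one hw, abs_lt]
      constructor <;> linarith
    simpa using (tendsto_pow_atTop_nhds_zero_of_lt_one (by positivity) hlt).const_mul |z|
  rw [tendsto_iff_norm_sub_tendsto_zero]
  refine squeeze_zero (fun _ => norm_nonneg _) (fun n => ?_) hlim
  have hqn := (hq_growth n).1
  have hdiff : p n / q n - 2 * E / K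
      = (-z) ^ (n + 1) * d n * ellipticCos z (n + 1) / (K * q n) := by
    rw [← herr]
    field_simp
  have hI : |ellipticCos z (n + 1)| ≤ K := hKI ▸ abs_ellipticCos_le hz1 (n + 1)
  rw [hdiff, Real.norm_eq_abs, abs_div, abs_mul, abs_mul, abs_pow, abs_neg, abs_of_pos (hdpos n),
    abs_of_pos (mul_pos hKpos hqn)]
  calc |z| ^ (n + 1) * d n * |ellipticCos z (n + 1)| / (K * q n)
      ≤ |z| ^ (n + 1) * d n * K / (K * (d n * (2 - z) ^ n)) := by
        have := hdpos n
        gcongr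
        exact hq_lower n
    _ = |z| * (|z| / (2 - z)) ^ n := by
        have := (hdpos n).ne'
        rw [div_pow, pow_succ]
        field_simp
end
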